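/- The Krull dimension of the quotient ring R/I_V equals 2, where R = F₂[a,b,c,d,v,w,x,y]. -/

import Mathlib

open MvPolynomial

noncomputable section

/-- The polynomial ring `R = 𝔽₂[a,b,c,d,v,w,x,y]`, with variables indexed
`a = X 0, b = X 1, c = X 2, d = X 3, v = X 4, w = X 5, x = X 6, y = X 7`. -/
abbrev SuzukiRing := MvPolynomial (Fin 8) (ZMod 2)

/-- The 4×4 anti-diagonal permutation matrix `T`. -/
def Tmat : Matrix (Fin 4) (Fin 4) SuzukiRing :=
  !![0, 0, 0, 1; 0, 0, 1, 0; 0, 1, 0, 0; 1, 0, 0, 0]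

/-- The lower unitriangular matrix `S(α, β, α₀, β₀)`. -/
def Smat (α β α₀ β₀ : SuzukiRing) : Matrix (Fin 4) (Fin 4) SuzukiRing :=
  !![1, 0, 0, 0;
     α, 1, 0, 0;
     α * α₀ + β, α₀, 1, 0;
     α ^ 2 * α₀ + α * β + β₀, β, α, 1]

/-- `X = T · S(a, b, v, w)`. -/
def Xmat : Matrix (Fin 4) (Fin 4) SuzukiRing := Tmat * Smat (X 0) (X 1) (X 4) (X 5)

/-- `Y = T · S(c, d, x, y)`. -/
def Ymat : Matrix (Fin 4) (Fin 4) SuzukiRing := Tmat * Smat (X 2) (X 3) (X 6) (X 7)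

/-- The ideal `I_V ⊆ R` generated by the 16 entries of
`X⁻¹YX⁻¹Y⁻¹X² − YX⁻²Y⁻¹XY⁻¹` (the inverses being the adjugates, since both
matrices have determinant 1). -/
def IV : Ideal SuzukiRing :=
  Ideal.span (Set.range fun p : Fin 4 × Fin 4 =>
    (Xmat.adjugate * Ymat * Xmat.adjugate * Ymat.adjugate * Xmat * Xmat
      - Ymat * Xmat.adjugate * Xmat.adjugate * Ymat.adjugate * Xmat * Ymat.adjugate)
      p.1 p.2)




namespace Char2
variable {D : Type} [CommRing D]

/-- merging of sorted lists of monomials, equal monomials cancel -/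
def merge (p : List Nat) : List Nat → List Nat :=
  List.rec (motive := fun _ => List Nat → List Nat) (fun q => q)
    (fun m ms ih q => List.rec (motive := fun _ => List Nat) (m :: ms)
      (fun n ns ih2 => cond (Nat.ble m n) (cond (Nat.beq m n) (ih ns) (m :: ih (n :: ns)))
        (n :: ih2)) q) p

/-- value of a monomial, exponents being base 64 digits -/
def mon : List D → Nat → D
  | [], _ => 1
  | y :: ys, n => y ^ (n % 64) * mon ys (n / 64)

/-- value of a polynomial -/
def ev (x : List D) : List Nat → D
  | [] => 0
  | n :: ns => mon x n + ev x ns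

theorem ev_cons (x : List D) (n : Nat) (ns : List Nat) : ev x (n :: ns) = mon x n + ev x ns := rfl

theorem merge_nil (q : List Nat) : merge [] q = q := rfl
theorem merge_cons_nil (m : Nat) (ms : List Nat) : merge (m :: ms) [] = m :: ms := rfl
theorem merge_cons_cons (m n : Nat) (ms ns : List Nat) : merge (m :: ms) (n :: ns) =
  cond (Nat.ble m n) (cond (Nat.beq m n) (merge ms ns) (m :: merge ms (n :: ns)))
        (n :: merge (m :: ms) ns) := rfl

theorem ev_merge [CharP D 2] (x : List D) (p q : List Nat) :
    ev x (merge p q) = ev x p + ev x q := by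
  induction p generalizing q with
  | nil => simp [merge_nil, ev]
  | cons m ms ih =>
    induction q with
    | nil => simp [merge_cons_nil, ev]
    | cons n ns ih2 =>
      rw [merge_cons_cons]
      cases h : Nat.ble m n with
      | false =>
        simp only [cond_false, ev_cons, ih2]
        ring
      | true =>
        cases h' : Nat.beq m n with
        | false =>
          simp only [cond_false, cond_true, ev_cons, ih]
          ring
        | true =>
          have := Nat.eq_of_beq_eq_true h'
          subst this
          simp only [cond_true, ev_cons, ih]
          linear_combination -(mon x m) * (CharTwo.two_eq_zero : (2 : D) = 0)

/-- all exponents of a monomial are less than 32 -/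
def okMon : Nat → Nat → Bool
  | 0, _ => true
  | k + 1, n => cond (Nat.blt (n % 64) 32) (okMon k (n / 64)) false

def okPoly (k : Nat) : List Nat → Bool
  | [] => true
  | n :: ns => cond (okMon k n) (okPoly k ns) false

theorem mon_add (x : List D) (m n : Nat) (hm : okMon x.length m = true)
    (hn : okMon x.length n = true) : mon x (m + n) = mon x m * mon x n := by
  induction x generalizing m n with
  | nil => simp [mon]
  | cons y ys ih =>
    simp only [List.length_cons, okMon, Bool.cond_false_right, Bool.and_eq_true, Nat.blt_eq] at hm hn
    have h1 : (m + n) % 64 = m % 64 + n % 64 := by omega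
    have h2 : (m + n) / 64 = m / 64 + n / 64 := by omega
    simp only [mon, h1, h2, ih _ _ hm.2 hn.2, pow_add]
    ring

def mulMon (m : Nat) : List Nat → List Nat
  | [] => []
  | n :: ns => Nat.add m n :: mulMon m ns

theorem ev_mulMon (x : List D) (m : Nat) (p : List Nat) (hm : okMon x.length m = true)
    (hp : okPoly x.length p = true) : ev x (mulMon m p) = mon x m * ev x p := by
  induction p with
  | nil => simp [mulMon, ev]
  | cons n ns ih =>
    simp only [okPoly, Bool.cond_false_right, Bool.and_eq_true] at hp
    have : ev x (mulMon m (n :: ns)) = mon x (m + n) + ev x (mulMon m ns) := rfl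
    rw [this, ih hp.2, mon_add x m n hm hp.1, ev_cons]
    ring

def mul (p : List Nat) : List Nat → List Nat
  | [] => []
  | n :: ns => merge (mulMon n p) (mul p ns)

theorem ev_mul [CharP D 2] (x : List D) (p q : List Nat) (hp : okPoly x.length p = true)
    (hq : okPoly x.length q = true) : ev x (mul p q) = ev x p * ev x q := by
  induction q with
  | nil => simp [mul, ev]
  | cons n ns ih =>
    simp only [okPoly, Bool.cond_false_right, Bool.and_eq_true] at hq
    rw [mul, ev_merge, ev_mulMon x n p hq.1 hp, ih hq.2, ev_cons]
    ring

/-- polynomial expressions -/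
inductive E where
  | poly : List Nat → E
  | add : E → E → E
  | mul : E → E → E

def E.den (x : List D) : E → D
  | .poly p => ev x p
  | .add e f => e.den x + f.den x
  | .mul e f => e.den x * f.den x

def addO (p q : Option (List Nat)) : Option (List Nat) :=
  match p, q with
  | some p, some q => some (merge p q)
  | _, _ => none

def mulO (k : Nat) (p q : Option (List Nat)) : Option (List Nat) :=
  match p, q with
  | some p, some q => cond (okPoly k p) (cond (okPoly k q) (some (Char2.mul p q)) none) none
  | _, _ => none

def E.norm (k : Nat) : E → Option (List Nat)
  | .poly p => some p
  | .add e f => addO (e.norm k) (f.norm k)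
  | .mul e f => mulO k (e.norm k) (f.norm k)

theorem E.norm_sound [CharP D 2] (x : List D) (e : E) :
    ∀ p, e.norm x.length = some p → e.den x = ev x p := by
  induction e with
  | poly q => intro p h; simp only [norm, Option.some.injEq] at h; subst h; rfl
  | add e f ihe ihf =>
    intro p h
    simp only [norm, addO] at h
    split at h
    · rename_i p1 p2 h1 h2
      cases h
      rw [ev_merge, den, ihe _ h1, ihf _ h2]
    · cases h
  | mul e f ihe ihf =>
    intro p h
    simp only [norm, mulO] at h
    split at h
    · rename_i p1 p2 h1 h2
      cases o1 : okPoly x.length p1 with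
      | false => simp [o1] at h
      | true =>
        cases o2 : okPoly x.length p2 with
        | false => simp [o1, o2] at h
        | true =>
          simp only [o1, o2, cond_true, Option.some.injEq] at h
          subst h
          rw [ev_mul x _ _ o1 o2, den, ihe _ h1, ihf _ h2]
    · cases h

def isZ (p : Option (List Nat)) : Bool :=
  match p with
  | some [] => true
  | _ => false

theorem E.sound [CharP D 2] (x : List D) (e : E) (k : Nat) (hk : x.length = k)
    (h : isZ (e.norm k) = true) : e.den x = 0 := by
  subst hk
  unfold isZ at h
  split at h
  · rename_i h'
    rw [E.norm_sound x e _ h']; rfl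
  · cases h

end Char2

/-! ### Reduction of the matrix equation -/

theorem group_red {G : Type*} [Group G] (T A B : G) (hT : T * T = 1) :
    ((T * A)⁻¹ * (T * (A * B)) * (T * A)⁻¹ * (T * (A * B))⁻¹ * (T * A) * (T * A) =
      (T * (A * B)) * (T * A)⁻¹ * (T * A)⁻¹ * (T * (A * B))⁻¹ * (T * A) * (T * (A * B))⁻¹) ↔
    ((T * A * T) * A * B * B * (T * A * T) = B * (T * (A * B⁻¹) * T) * A * B * A⁻¹) := by
  have hT' : T⁻¹ = T := inv_eq_of_mul_eq_one_left hT
  have e1 : (T * A * T) * A * B * B * (T * A * T) =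
      (T * A) * ((T * (A * B)) * (T * A)⁻¹ * (T * A)⁻¹ * (T * (A * B))⁻¹ * (T * A) *
        (T * (A * B))⁻¹)⁻¹ * (T * A) * B * A⁻¹ := by
    simp only [mul_inv_rev, inv_inv, hT', mul_assoc, inv_mul_cancel_left, mul_inv_cancel_left]
    have h2 : ∀ x, T * (T * x) = x := fun x => by rw [← mul_assoc, hT, one_mul]
    simp [h2]
  have e2 : B * (T * (A * B⁻¹) * T) * A * B * A⁻¹ =
      (T * A) * ((T * A)⁻¹ * (T * (A * B)) * (T * A)⁻¹ * (T * (A * B))⁻¹ * (T * A) *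
        (T * A))⁻¹ * (T * A) * B * A⁻¹ := by
    simp only [mul_inv_rev, inv_inv, hT', mul_assoc, inv_mul_cancel_left, mul_inv_cancel_left]
    have h2 : ∀ x, T * (T * x) = x := fun x => by rw [← mul_assoc, hT, one_mul]
    simp [h2]
  rw [e1, e2]
  simp only [mul_left_inj, mul_right_inj, inv_inj]
  exact eq_comm

theorem group_red2 {G : Type*} [Group G] (T A B : G) (hT : T * T = 1)
    (h : (T * A * T) * A * B * B * (T * A * T) = B * (T * (A * B⁻¹) * T) * A * B * A⁻¹) :
    B⁻¹ * (T * A * T) * A * B * B = (T * (A * B⁻¹) * T) * A * B * A⁻¹ * (T * A⁻¹ * T) := by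
  have hT' : T⁻¹ = T := inv_eq_of_mul_eq_one_left hT
  have h2 : ∀ x, T * (T * x) = x := fun x => by rw [← mul_assoc, hT, one_mul]
  have h3 := congrArg (fun g => B⁻¹ * g * (T * A⁻¹ * T)) h
  simp only [mul_assoc, inv_mul_cancel_left, h2, mul_inv_cancel_left] at h3 ⊢
  simpa [hT] using h3

section rel
variable {D : Type} [CommRing D]

def tM (D : Type) [CommRing D] : Matrix (Fin 4) (Fin 4) D :=
  !![0, 0, 0, 1; 0, 0, 1, 0; 0, 1, 0, 0; 1, 0, 0, 0]

def lM (a b v z : D) : Matrix (Fin 4) (Fin 4) D :=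
  !![1, 0, 0, 0; a, 1, 0, 0; a * v + b, v, 1, 0; z, b, a, 1]

def lMi (a b v z : D) : Matrix (Fin 4) (Fin 4) D :=
  !![1, 0, 0, 0; a, 1, 0, 0; b, v, 1, 0; z, a * v + b, a, 1]

def barM (M : Matrix (Fin 4) (Fin 4) D) : Matrix (Fin 4) (Fin 4) D := M.submatrix Fin.rev Fin.rev

theorem tM_sq : tM D * tM D = 1 := by
  ext i j
  fin_cases i <;> fin_cases j <;> simp [tM, Matrix.mul_apply, Fin.sum_univ_four]

theorem tM_bar (M : Matrix (Fin 4) (Fin 4) D) : tM D * M * tM D = barM M := by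
  ext i j
  fin_cases i <;> fin_cases j <;> simp [tM, barM, Matrix.mul_apply, Matrix.vecMul, dotProduct, Fin.sum_univ_four]

theorem lM_mul [CharP D 2] (a b v z : D) : lM a b v z * lMi a b v z = 1 := by
  ext i j
  fin_cases i <;> fin_cases j <;>
    simp [lM, lMi, Matrix.mul_apply, Fin.sum_univ_four] <;> grind

theorem lMi_mul [CharP D 2] (a b v z : D) : lMi a b v z * lM a b v z = 1 := by
  ext i j
  fin_cases i <;> fin_cases j <;>
    simp [lM, lMi, Matrix.mul_apply, Fin.sum_univ_four] <;> grind

/-- the first form of the relation -/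
def form1 (a b v z p q r t : D) : Matrix (Fin 4) (Fin 4) D :=
  barM (lM a b v z) * lM a b v z * lM p q r t * lM p q r t * barM (lM a b v z) +
    lM p q r t * barM (lM a b v z * lMi p q r t) * lM a b v z * lM p q r t * lMi a b v z

/-- the second form of the relation -/
def form2 (a b v z p q r t : D) : Matrix (Fin 4) (Fin 4) D :=
  lMi p q r t * barM (lM a b v z) * lM a b v z * lM p q r t * lM p q r t +
    barM (lM a b v z * lMi p q r t) * lM a b v z * lM p q r t * lMi a b v z * barM (lMi a b v z)

theorem mat_add_eq_zero [CharP D 2] (M N : Matrix (Fin 4) (Fin 4) D) : M + N = 0 ↔ M = N := by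
  constructor
  · intro h
    ext i j
    have := congrFun (congrFun h i) j
    exact CharTwo.add_eq_zero.1 this
  · rintro rfl
    ext i j
    exact CharTwo.add_self_eq_zero _

def uL [CharP D 2] (a b v z : D) : (Matrix (Fin 4) (Fin 4) D)ˣ :=
  ⟨lM a b v z, lMi a b v z, lM_mul a b v z, lMi_mul a b v z⟩

def uT (D : Type) [CommRing D] : (Matrix (Fin 4) (Fin 4) D)ˣ := ⟨tM D, tM D, tM_sq, tM_sq⟩

theorem form2_of_form1 [CharP D 2] (a b v z p q r t : D) (h : form1 a b v z p q r t = 0) :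
    form2 a b v z p q r t = 0 := by
  rw [form1, mat_add_eq_zero] at h
  rw [form2, mat_add_eq_zero]
  simp only [← tM_bar] at h ⊢
  have key := group_red2 (uT D) (uL a b v z) (uL p q r t) (Units.ext tM_sq)
    (Units.ext h)
  exact congrArg Units.val key

theorem adj_eq_of_unit (u : (Matrix (Fin 4) (Fin 4) D)ˣ) (h : u.val.det = 1) :
    u.val.adjugate = (u⁻¹).val := by
  have h1 := Matrix.adjugate_mul u.val
  rw [h, one_smul] at h1
  exact (Units.inv_eq_of_mul_eq_one_left h1).symm

theorem det_uT : (uT D).val.det = 1 := by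
  simp [uT, tM, Matrix.det_succ_row_zero, Fin.sum_univ_succ, Fin.succAbove]
  ring

theorem det_uL [CharP D 2] (a b v z : D) : (uL a b v z).val.det = 1 := by
  simp [uL, lM, Matrix.det_succ_row_zero, Fin.sum_univ_succ, Fin.succAbove]

theorem rel_iff [CharP D 2] (φ : SuzukiRing →+* D) (a b v z p q r t : D)
    (h0 : φ (X 0) = a) (h1 : φ (X 1) = b) (h4 : φ (X 4) = v)
    (h5 : φ (X 5) = z + a ^ 2 * v + a * b) (h2 : φ (X 2) = a + p) (h6 : φ (X 6) = v + r)
    (h3 : φ (X 3) = b + q + a * r)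
    (h7 : φ (X 7) = t + z + b * p + a * (p * r + q) + (a + p) ^ 2 * (v + r) +
      (a + p) * (b + q + a * r)) :
    (∀ g ∈ IV, φ g = 0) ↔ form1 a b v z p q r t = 0 := by
  have hX : φ.mapMatrix Xmat = (uT D * uL a b v z).val := by
    rw [Xmat, map_mul]
    congr 1
    · ext i j
      fin_cases i <;> fin_cases j <;> simp [Tmat, uT, tM]
    · ext i j
      fin_cases i <;> fin_cases j <;> simp [Smat, uL, lM, h0, h1, h4, h5] <;> grind
  have hY : φ.mapMatrix Ymat = (uT D * (uL a b v z * uL p q r t)).val := by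
    rw [Ymat, map_mul]
    congr 1
    · ext i j
      fin_cases i <;> fin_cases j <;> simp [Tmat, uT, tM]
    · ext i j
      fin_cases i <;> fin_cases j <;>
        simp [Smat, uL, lM, h2, h3, h6, h7, Matrix.mul_apply, Fin.sum_univ_four] <;> grind
  have hXi : φ.mapMatrix Xmat.adjugate = ((uT D * uL a b v z)⁻¹).val := by
    rw [RingHom.map_adjugate, hX]
    exact adj_eq_of_unit _ (by rw [Units.val_mul, Matrix.det_mul, det_uT, det_uL, one_mul])
  have hYi : φ.mapMatrix Ymat.adjugate = ((uT D * (uL a b v z * uL p q r t))⁻¹).val := by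
    rw [RingHom.map_adjugate, hY]
    exact adj_eq_of_unit _ (by
      rw [Units.val_mul, Units.val_mul, Matrix.det_mul, Matrix.det_mul, det_uT, det_uL, det_uL]
      simp)
  have key := group_red (uT D) (uL a b v z) (uL p q r t) (Units.ext tM_sq)
  have e1 : (∀ g ∈ IV, φ g = 0) ↔ φ.mapMatrix (Xmat.adjugate * Ymat * Xmat.adjugate *
      Ymat.adjugate * Xmat * Xmat - Ymat * Xmat.adjugate * Xmat.adjugate * Ymat.adjugate *
      Xmat * Ymat.adjugate) = 0 := by
    constructor
    · intro h
      ext i j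
      exact h _ (Ideal.subset_span ⟨(i, j), rfl⟩)
    · intro h
      have : IV ≤ RingHom.ker φ := by
        rw [IV, Ideal.span_le]
        rintro _ ⟨⟨i, j⟩, rfl⟩
        exact congrFun (congrFun h i) j
      exact fun g hg => this hg
  rw [e1, map_sub, sub_eq_zero]
  simp only [map_mul, hX, hY, hXi, hYi]
  simp only [← Units.val_mul]
  rw [Units.val_inj, key, form1, mat_add_eq_zero, ← Units.val_inj]
  simp only [Units.val_mul, ← tM_bar]
  rfl

end rel

namespace Char2
section
variable {D : Type} [CommRing D]

abbrev EM := Fin 4 → Fin 4 → E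

def emul (A B : EM) : EM := fun i j =>
  .add (.add (.mul (A i 0) (B 0 j)) (.mul (A i 1) (B 1 j)))
    (.add (.mul (A i 2) (B 2 j)) (.mul (A i 3) (B 3 j)))

def ebar (A : EM) : EM := fun i j => A i.rev j.rev

def eL (a b v z : E) : EM :=
  ![![.poly [0], .poly [], .poly [], .poly []], ![a, .poly [0], .poly [], .poly []],
    ![.add (.mul a v) b, v, .poly [0], .poly []], ![z, b, a, .poly [0]]]

def eLi (a b v z : E) : EM :=
  ![![.poly [0], .poly [], .poly [], .poly []], ![a, .poly [0], .poly [], .poly []],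
    ![b, v, .poly [0], .poly []], ![z, .add (.mul a v) b, a, .poly [0]]]

def ef1 (a b v z p q r t : E) : EM := fun i j =>
  .add (emul (emul (emul (emul (ebar (eL a b v z)) (eL a b v z)) (eL p q r t)) (eL p q r t))
    (ebar (eL a b v z)) i j)
  (emul (emul (emul (emul (eL p q r t) (ebar (emul (eL a b v z) (eLi p q r t)))) (eL a b v z))
    (eL p q r t)) (eLi a b v z) i j)

def ef2 (a b v z p q r t : E) : EM := fun i j =>
  .add (emul (emul (emul (emul (eLi p q r t) (ebar (eL a b v z))) (eL a b v z)) (eL p q r t))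
    (eL p q r t) i j)
  (emul (emul (emul (emul (ebar (emul (eL a b v z) (eLi p q r t))) (eL a b v z)) (eL p q r t))
    (eLi a b v z)) (ebar (eLi a b v z)) i j)

def dM (x : List D) (A : EM) : Matrix (Fin 4) (Fin 4) D := Matrix.of fun i j => (A i j).den x

theorem dM_mul (x : List D) (A B : EM) : dM x (emul A B) = dM x A * dM x B := by
  ext i j
  simp only [dM, Matrix.of_apply, Matrix.mul_apply, Fin.sum_univ_four, emul, E.den]
  ring

theorem dM_bar (x : List D) (A : EM) : dM x (ebar A) = barM (dM x A) := rfl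

theorem mon_zero (x : List D) : mon x 0 = 1 := by
  induction x with
  | nil => rfl
  | cons y ys ih => simp [mon, ih]

theorem dM_eL (x : List D) (a b v z : E) :
    dM x (eL a b v z) = lM (a.den x) (b.den x) (v.den x) (z.den x) := by
  ext i j
  fin_cases i <;> fin_cases j <;> simp [dM, eL, lM, E.den, mon_zero, ev]

theorem dM_eLi (x : List D) (a b v z : E) :
    dM x (eLi a b v z) = lMi (a.den x) (b.den x) (v.den x) (z.den x) := by
  ext i j
  fin_cases i <;> fin_cases j <;> simp [dM, eLi, lMi, E.den, mon_zero, ev]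

theorem dM_ef1 (x : List D) (a b v z p q r t : E) : dM x (ef1 a b v z p q r t) =
    form1 (a.den x) (b.den x) (v.den x) (z.den x) (p.den x) (q.den x) (r.den x) (t.den x) := by
  simp only [form1, ← dM_eL, ← dM_eLi, ← dM_bar, ← dM_mul]
  rfl

theorem dM_ef2 (x : List D) (a b v z p q r t : E) : dM x (ef2 a b v z p q r t) =
    form2 (a.den x) (b.den x) (v.den x) (z.den x) (p.den x) (q.den x) (r.den x) (t.den x) := by
  simp only [form2, ← dM_eL, ← dM_eLi, ← dM_bar, ← dM_mul]
  rfl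

/-- the `n`-th variable, for n ≤ 7 -/
def vE (n : Nat) : E := .poly [Nat.pow 64 n]

def G1 : EM := ef1 (vE 0) (vE 1) (vE 2) (vE 3) (vE 4) (vE 5) (vE 6) (vE 7)
def G2 : EM := ef2 (vE 0) (vE 1) (vE 2) (vE 3) (vE 4) (vE 5) (vE 6) (vE 7)

theorem den_G1 [CharP D 2] (a b v z p q r t : D) (h : form1 a b v z p q r t = 0) (i j : Fin 4) :
    (G1 i j).den [a, b, v, z, p, q, r, t] = 0 := by
  have := dM_ef1 [a, b, v, z, p, q, r, t] (vE 0) (vE 1) (vE 2) (vE 3) (vE 4) (vE 5) (vE 6) (vE 7)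
  have h2 : form1 (E.den [a, b, v, z, p, q, r, t] (vE 0)) (E.den [a, b, v, z, p, q, r, t] (vE 1))
    (E.den [a, b, v, z, p, q, r, t] (vE 2)) (E.den [a, b, v, z, p, q, r, t] (vE 3))
    (E.den [a, b, v, z, p, q, r, t] (vE 4)) (E.den [a, b, v, z, p, q, r, t] (vE 5))
    (E.den [a, b, v, z, p, q, r, t] (vE 6)) (E.den [a, b, v, z, p, q, r, t] (vE 7)) = 0 := by
    simpa [vE, E.den, ev, mon] using h
  rw [h2] at this
  exact congrFun (congrFun this i) j

theorem den_G2 [CharP D 2] (a b v z p q r t : D) (h : form1 a b v z p q r t = 0) (i j : Fin 4) :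
    (G2 i j).den [a, b, v, z, p, q, r, t] = 0 := by
  have := dM_ef2 [a, b, v, z, p, q, r, t] (vE 0) (vE 1) (vE 2) (vE 3) (vE 4) (vE 5) (vE 6) (vE 7)
  have h2 : form2 (E.den [a, b, v, z, p, q, r, t] (vE 0)) (E.den [a, b, v, z, p, q, r, t] (vE 1))
    (E.den [a, b, v, z, p, q, r, t] (vE 2)) (E.den [a, b, v, z, p, q, r, t] (vE 3))
    (E.den [a, b, v, z, p, q, r, t] (vE 4)) (E.den [a, b, v, z, p, q, r, t] (vE 5))
    (E.den [a, b, v, z, p, q, r, t] (vE 6)) (E.den [a, b, v, z, p, q, r, t] (vE 7)) = 0 := by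
    have h' := form2_of_form1 _ _ _ _ _ _ _ _ h
    simpa [vE, E.den, ev, mon] using h'
  rw [h2] at this
  exact congrFun (congrFun this i) j
end
end Char2

namespace Char2
section
variable {D : Type} [CommRing D]

def F1L : Fin 4 → Fin 4 → List Nat :=
  ![![[2, 128, 4161, 524288, 16777217, 16781376, 33554432, 1073741888, 1090523136, 2147483648, 68719476801, 68719738882, 68736254018, 68736258049, 68753031233, 68753035264, 68753293312, 69793218563, 69809995778, 137438953474, 137472507904, 4398046773248, 4398063288384, 4399120252929, 4466765987842, 4466782765057, 8796093022208],
    [1, 3, 129, 4160, 4162, 262208, 524289, 16777216, 17043456, 33558592, 1074003968, 1090519104, 1090523137, 2147483649, 68719476800, 68719738881, 68736516096, 68736516098, 68753293313, 69793218560, 69793218562, 137438953473, 137455730688, 4398063292416, 4399120252928, 4466765987841],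
    [64, 66, 192, 4097, 4225, 8256, 262145, 266304, 524352, 17039360, 33554496, 1073741824, 1090519041, 68719476737, 68736253952, 68736254080, 68736516161, 68736520192, 68753293376, 4398063288320],
    [4098, 4224, 8257, 262144, 786432, 16777280, 1073741825, 68736520193, 68736778241, 68753555456, 4398046511104]],
  ![[1, 4160, 8193, 262208, 266241, 16785408, 33554433, 33558592, 50331648, 1073745920, 1090519104, 1107300352, 2164260864, 68719476802, 68719480833, 68719480835, 68736254017, 68736258048, 68736258050, 68736516098, 68753031234, 68753035265, 68753293313, 68769808449, 68769812480, 69793218560, 69793218562, 69809995777, 69809995779, 69826772994, 137438953473, 137455730688, 137455730690, 137489285120, 4398046511168, 4398046515201, 4398063292416, 4398063550464, 4398080065600, 4399120252928, 4399137030145, 4466782765058, 4466799542273, 8796109799424],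
    [2, 128, 8192, 8194, 262209, 266242, 16777217, 16781376, 16785409, 33554432, 33562624, 33820672, 50335808, 1073741888, 1073745921, 1090781184, 1107296320, 1107300353, 2147483648, 2164260865, 68719476801, 68719480832, 68719480834, 68736254018, 68736258049, 68736258051, 68736516097, 68753035266, 69793218561, 69809995776, 69809995778, 137438953472, 137455730689, 137472507904, 4398080069632, 4399137030144, 4466782765057],
    [4096, 4098, 12288, 262272, 266305, 16781313, 33558528, 33816576, 50331712, 1107296257, 68719476736, 68736253953, 68736254081, 68736258114, 68736262145, 68753031168, 68753031296, 68753035329, 4398080065536],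
    [64, 66, 192, 4099, 8256, 8258, 12289, 262145, 266304, 270337, 524352, 528385, 16781312, 17039360, 33554496, 1073741824, 1090519041, 68736254080, 68736262146, 68736516161, 68736520192, 68736520194, 68753293376, 68753297409, 4398063288320]],
  ![[64, 4097, 262145, 16781312, 1090519041, 1090523200, 1107296256, 2147483712, 2164264960, 3221225472, 68719476737, 68719476739, 68736253954, 68736262144, 68753031169, 68753035328, 68769808384, 69793218625, 69793222656, 69793480706, 69809995842, 69809999873, 69810257921, 69826773057, 70866960387, 70883737600, 70883737602, 137438953538, 137438957569, 137438957571, 137455992834, 137472507968, 137472507970, 137472770049, 137489285185, 137489289216, 138512695296, 138529472513, 138529472515, 138546249728, 138546249730, 206158430209, 206175207424, 206175207426, 206208761856, 4398046511105, 4398063288320, 4399120515072, 4399137030208, 4400193994753, 4466765987904, 4466765991937, 4466782769152, 4466783027200, 4466799542336, 4467839729664, 4467839729666, 4535502241794, 4535519019009, 8797166764032, 8864829276160],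
    [4096, 4098, 262146, 16781313, 33558528, 1090785280, 1107300416, 2147745792, 2164260928, 2164264961, 3221225473, 68719476738, 68736253955, 68736258112, 68736262145, 68753031168, 68753031170, 68753039360, 68753297408, 68769812544, 69793222657, 69793480705, 69809995841, 69810257920, 69826773056, 69826777089, 70866960386, 70883737601, 137438953537, 137438957568, 137438957570, 137455730752, 137455734785, 137455992833, 137472507969, 138529472514, 206158430208, 206175207425, 206191984640, 4399137034240, 4400193994752, 4466799546368, 4467839729665, 4467856506880, 4535502241793],
    [2, 128, 8192, 262209, 16777217, 33554432, 1073741888, 1090781184, 1107296320, 2147483648, 2164260865, 68719480832, 68736254016, 68736254018, 68753031233, 68753035264, 68753293312, 68769808448, 69793218561, 69809995776, 69826772993, 137438953472, 137455730689, 137472507904, 4399137030144, 4466799542272],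
    [1, 3, 129, 4160, 4162, 8193, 262208, 266241, 524289, 16777216, 1074003968, 1090519104, 2147483649, 68719476800, 68719480833, 68736254017, 68736258048, 68736258050, 68736516098, 68753031232, 68753293313, 69793218560, 69809995777, 4399120252928, 4466782765056]],
  ![[262144, 33558528, 1090527232, 2147487744, 68719476738, 68736253953, 68736253955, 68769808385, 69793218626, 69793222657, 69793222659, 69809995841, 69826777089, 70866960384, 70866960386, 70883737601, 138512695297, 138529472512, 4398063292480, 4399120257025, 4466765987905, 4466766249986, 4466782765120, 4466782765122, 4466782769153, 4466783027201, 4466799542337, 4466799546368, 4467839729667, 4467856506882, 4535485464578, 4535519019008, 8796093284352, 8796109799488, 8797166764033, 8864812498946, 8864829276161, 13194139533312],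
    [64, 262145, 16781312, 33558529, 50335744, 1090519041, 1090523200, 1090527233, 1107296256, 1107304448, 2147483712, 2147487745, 3221225472, 68719476737, 69793218625, 69793222656, 69793222658, 69809999873, 70866960385, 138512695296, 4398046511105, 4398063288320, 4398063554560, 4398080069696, 4399120515072, 4399137030208, 4399137034241, 4400193994753, 4466765987904, 4466766249985, 4466782765121, 4467839729664, 4467839729666, 4535485464577, 4535502241792, 8796109803520, 8797166764032, 8864812498945],
    [1, 4160, 262208, 33554433, 50331648, 1073745920, 1090519104, 1090523137, 1107300352, 2164260864, 68736254017, 68736258048, 68753031232, 69793218560, 4398046511168, 4398063550464, 4398080065600, 4399120252928, 4399137030145, 4466765987841, 4466782765056, 8796109799424],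
    [2, 128, 4161, 524288, 16777217, 33554432, 1073741888, 1073745921, 1090523136, 2147483648, 68736254016, 68736258049, 68736516097, 68753293312, 4398046773248, 4398063288384, 4399120252929, 8796093022208]]]

theorem F1L_check : ∀ i j, isZ ((E.add (G1 i j) (.poly (F1L i j))).norm 8) = true := by
  decide +kernel

theorem ev_F1 [CharP D 2] (a b v z p q r t : D) (h : form1 a b v z p q r t = 0) (i j : Fin 4) :
    ev [a, b, v, z, p, q, r, t] (F1L i j) = 0 := by
  have h1 := E.sound [a, b, v, z, p, q, r, t] _ 8 rfl (F1L_check i j)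
  rwa [E.den, den_G1 a b v z p q r t h i j, zero_add] at h1

def F2L : Fin 4 → Fin 4 → List Nat :=
  ![![[2, 128, 4161, 524288, 16777217, 16781376, 33554432, 1073741888, 1090523136, 2147483648, 68719476801, 68719738882, 68736254018, 68736258049, 68753031233, 68753035264, 68753293312, 69793218563, 69809995778, 137438953474, 137472507904, 4398046773248, 4398063288384, 4399120252929, 4466765987842, 4466782765057, 8796093022208],
    [1, 4160, 262208, 16777216, 16777218, 16781377, 17043456, 33554433, 33558592, 1073741889, 1074003968, 1090519104, 68719476800, 68719476802, 68719738881, 68719738883, 68736254019, 68736258050, 68736516096, 68736516098, 68753031234, 68753035265, 69793218560, 69793218562, 69793218564, 69809995779, 137438953473, 137438953475, 137455730688, 137472507905, 4398046773249, 4398063288385, 4398063292416, 4399120252928, 4399120252930, 4466765987841, 4466765987843, 4466782765058, 8796093022209],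
    [64, 262145, 16777281, 16781312, 16781314, 16781440, 16785473, 17039360, 17047552, 33558529, 33562688, 1073741824, 1073741952, 1073745985, 1074008064, 1090519041, 2147483712, 68719476737, 68719476865, 68719480896, 68719480898, 68719738946, 68719742977, 68719742979, 68736253952, 68736254080, 68736254082, 68736258113, 68736258115, 68736262146, 68736516161, 68736520194, 68753031297, 68753035328, 68753035330, 68753039361, 69793218627, 69793222656, 69793222658, 69793222660, 69809995842, 69809999875, 137438953538, 137438957569, 137438957571, 137455734784, 137472507968, 137472512001, 4398046773312, 4398046777345, 4398063288320, 4398063288448, 4398063292481, 4398063296512, 4399120252993, 4399120257024, 4399120257026, 4466765987906, 4466765991937, 4466765991939, 4466782765121, 4466782769154, 8796093022272, 8796093026305],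
    [262144, 33554497, 33558656, 33816576, 1090519042, 1090519168, 1090523201, 1090785280, 2147483713, 2147745792, 68719476738, 68719476864, 68720001026, 68736253953, 68736254081, 68736516160, 68736516162, 68736520193, 68736778241, 68753293377, 68753297408, 69793218624, 69793218626, 69793480707, 69810257922, 137438953537, 137439215618, 137455730752, 137472770048, 4398046511104, 4398047035392, 4398063288321, 4398063292480, 4398063550528, 4399120252992, 4399120515073, 4466765987905, 4466766249986, 4466783027201, 8796093284352]],
  ![[1, 4160, 8193, 262208, 266241, 16777218, 16777344, 16781377, 16785408, 17301504, 1073745920, 68719476802, 68719480833, 68719480835, 68736258048, 68736258050, 68753293313, 68770070528, 69793218560, 69793218562, 69809995777, 137438953473, 137455730688, 4398046511168, 4398046515201, 4398063292416, 4399120252928],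
    [128, 4161, 8192, 17039424, 33562624, 1073741888, 2147483648, 68719476801, 68719476803, 68719480832, 68719480836, 68736254016, 68736254018, 68753035266, 68753293312, 69793218563, 69809995778, 137438953472, 137438953474, 137455730689, 4398046511169, 4398046515202, 4398063292417, 4399120252929],
    [65, 4096, 4098, 16777280, 17039361, 33558528, 33566720, 1090519040, 2147487744, 68719476736, 68719476866, 68719484928, 68719484932, 68736254081, 68736258114, 68736262145, 68753035329, 68753039362, 69793218624, 69793218626, 69793222659, 69809995841, 69809999874, 137438953537, 137438957568, 137438957570, 137455730752, 137455734785, 4398046511232, 4398046519298, 4398063292480, 4398063296513, 4399120252992, 4399120257025],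
    [64, 4097, 16777281, 16781312, 16781314, 16781440, 16785473, 17047552, 33558529, 33562688, 1073741824, 1073741952, 1073745985, 1074008064, 1090519041, 2147483712, 68719476737, 68719476865, 68719480896, 68719480898, 68719738946, 68719742977, 68719742979, 68736258113, 68736516161, 68753297409, 69793218625, 69793480704, 69793480706, 69810257921, 137438953536, 137439215617, 137455992832, 4398046773312, 4398046777345, 4398063554560, 4399120515072]],
  ![[64, 4097, 262145, 16781312, 1073741826, 1073741952, 1073745985, 1074266112, 68719476739, 68719480896, 68719484929, 68719738944, 68719742977, 68736253954, 69809995840, 69810257921, 69827035136, 137455730753, 137455734784, 137455734786, 137472507968, 137472512001, 4398046511105, 4398063288320],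
    [65, 4096, 33558528, 1073741825, 1073745984, 1074004032, 1090519040, 68719476740, 68719476864, 68719480897, 68719484928, 68736253953, 68753031170, 69810257920, 137455730752, 137455734785, 4398046511106, 4398063288321],
    [2, 16777217, 16781376, 33554432, 33562624, 1074003969, 1090523136, 68719476803, 68719480834, 68719480836, 68736254016, 68753031233, 68753035266, 4398046511169, 4398046515202, 4398063288384, 4398063292417],
    [1, 16777216, 16777218, 16781377, 17043456, 33554433, 33558592, 1073741889, 1090519104, 68719476802, 68719480833, 68719738881, 68719738883, 68736254017, 68736516096, 68753293313, 4398046773249, 4398063550464]],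
  ![[262144, 16777280, 16781313, 17039361, 1073741825, 1073745984, 1073750017, 1074004032, 1074008065, 68719476738, 68736253953, 68736258112, 68736262145, 68736516160, 68736520193, 68753031170, 68769808385, 69809995841, 69809999872, 69809999874, 69826773056, 69826777089, 137472507969, 137472512000, 137472512002, 137489285184, 137489289217, 4398046511106, 4398046511232, 4398046515265, 4398047035392, 4466782765120, 4466783027201, 4466799804416],
    [64, 16777281, 1073741952, 1073745985, 1073750016, 68719476737, 68719476739, 68736253954, 68736254080, 68736258113, 68736262144, 68753031169, 69809995840, 69809999873, 137472507968, 137472512001, 4398046515264, 4398046773312, 4466783027200],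
    [1, 16777218, 16785408, 1073741889, 1073745922, 68719476802, 68719480833, 68719480835, 68736258048, 4398046515201, 4398046773249],
    [16781376, 1073745921, 68719476801, 68719738882, 68736254016, 68736258049, 68736516097]]]

theorem F2L_check : ∀ i j, isZ ((E.add (G2 i j) (.poly (F2L i j))).norm 8) = true := by
  decide +kernel

theorem ev_F2 [CharP D 2] (a b v z p q r t : D) (h : form1 a b v z p q r t = 0) (i j : Fin 4) :
    ev [a, b, v, z, p, q, r, t] (F2L i j) = 0 := by
  have h1 := E.sound [a, b, v, z, p, q, r, t] _ 8 rfl (F2L_check i j)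
  rwa [E.den, den_G2 a b v z p q r t h i j, zero_add] at h1

end
end Char2

namespace Char2
section
variable {D : Type} [CommRing D]

set_option maxRecDepth 100000 in
theorem c1_0 [CharP D 2] {a b v z p q r t : D} (h : form1 a b v z p q r t = 0) (wa : a = 0) :
    p ^ 2 * (v+r) = 0 := by
  have kwa : ev [a, b, v, z, p, q, r, t] [1] = 0 := by
    simp [ev, mon, wa]
  have key := E.sound [a, b, v, z, p, q, r, t]
    (.add (.add (.poly [33558528, 68753031168]) (.mul (.poly [68719476736, 4398046511104])
    (.poly (F2L 3 3)))) (.add (.mul (.poly [64, 16781312, 1073741824]) (.poly (F2L 3 2))) (.add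
    (.mul (.poly [4096, 68719476736]) (.poly (F2L 2 2))) (.mul (.poly [64, 4097, 16777281,
    33558529, 1073741824, 1073741952, 1073745985, 1074008064, 1090519041, 1090523200,
    1090527233, 2147483712, 2147487745, 68719476737, 68719476865, 68719480896, 68719484929,
    68719484931, 68736253952, 68736258113, 68736262144, 68736262146, 68753035328, 68753039361,
    69793218625, 69793222658, 69793480704, 137438953536, 137438953538, 137438957569,
    137438957571, 137439215617, 137455734784, 137455992832, 137472507968, 137472512001,
    4398046519297, 4398046773312, 4398063554560, 4399120515072, 4466765991937, 4466766249985,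
    4466783027200]) (.poly [1])))))
    8 rfl (by decide +kernel)
  simp only [E.den, ev_F1 _ _ _ _ _ _ _ _ h, ev_F2 _ _ _ _ _ _ _ _ h, kwa, mul_zero, add_zero] at key
  simp only [ev, mon, Nat.reduceMod, Nat.reduceDiv] at key
  linear_combination key

set_option maxRecDepth 100000 in
theorem c1_1 [CharP D 2] {a b v z p q r t : D} (h : form1 a b v z p q r t = 0) (wa : a = 0) (wv : v = r) :
    p ^ 3 * (t ^ 2+r ^ 2+1) = 0 := by
  have kwa : ev [a, b, v, z, p, q, r, t] [1] = 0 := by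
    simp [ev, mon, wa]
  have kwv : ev [a, b, v, z, p, q, r, t] [4096, 68719476736] = 0 := by
    simp [ev, mon, wv, CharTwo.add_self_eq_zero]
  have key := E.sound [a, b, v, z, p, q, r, t]
    (.add (.add (.add (.poly [50331648, 137489285120, 8796143353856]) (.add (.mul (.poly
    [16777216, 50331648, 1074003968, 68719476800]) (.poly (F2L 2 2))) (.mul (.poly [262208,
    50331648, 69793218560, 137455730688]) (.poly (F1L 3 3))))) (.add (.add (.mul (.poly [64,
    17039360, 1073741824, 4398063288320]) (.poly (F2L 2 1))) (.mul (.poly [0, 33554432,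
    2147483648, 68736254016, 137472507904, 4466765987840]) (.poly (F2L 2 3)))) (.add (.mul
    (.poly [1073741824, 68736253952]) (.poly (F1L 1 2))) (.mul (.poly [262144, 4398046511104])
    (.poly (F2L 3 1)))))) (.add (.add (.add (.mul (.poly [262144]) (.poly (F1L 0 2))) (.mul
    (.poly [262208, 16777216, 1090519104, 68719476800, 68736516096, 68753031232, 69826772992,
    137455730688, 137489285120, 4398046511168, 4399120252928, 4466782765056]) (.poly (F2L 1
    1)))) (.add (.mul (.poly [0, 128, 17039424, 33554432, 2181038080, 68719738880,
    137506062336]) (.poly (F1L 2 3))) (.mul (.poly [0, 33554432, 2147483648, 69809995776,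
    4466765987840]) (.poly (F2L 1 0))))) (.add (.add (.mul (.poly [64, 1073741824]) (.poly (F2L
    1 2))) (.mul (.poly [17039360, 1107296256, 68736253952, 68769808384]) (.poly (F1L 2 1))))
    (.add (.mul (.poly [0, 2, 130, 256, 4289, 8320, 266240, 524416, 16777217, 16781376,
    17039424, 17039426, 17039552, 17043457, 17043585, 17047616, 17301505, 17305664, 17563712,
    33554432, 33554434, 33554560, 33558593, 33820672, 34078720, 50335808, 67108864, 1074003969,
    1074008128, 1090523136, 1090523264, 1090781184, 1107296320, 1107300353, 1107558401,
    1124335616, 2147483776, 2147491840, 2147749888, 2148007936, 2164523072, 2181038082,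
    2181038208, 2181042241, 2181046272, 2181562368, 3221225536, 3238264832, 3271561216,
    68719476801, 68719476803, 68719476929, 68719480832, 68719480834, 68719480960, 68719484995,
    68719738882, 68719739010, 68719743041, 68719743043, 68719747072, 68720005120, 68720263168,
    68736258049, 68736262208, 68736516099, 68753031233, 68753035264, 68753035266, 68753035392,
    68753039425, 68753301504, 68753555521, 68769808450, 68769812483, 68770332736, 68803362880,
    68803366913, 69793218563, 69793222722, 69793226755, 69793480768, 69793484801, 69793484803,
    69809995778, 69809995906, 69809999937, 69809999939, 69810003968, 69810257985, 69810262016,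
    69810520064, 69826772993, 69826773121, 69826781185, 69827035200, 69827039233, 69843550208,
    69843550210, 69843554369, 69843558400, 69843816448, 69860327425, 70866960449, 70866964480,
    70867222530, 70883737666, 70883999745, 70900514881, 70900518912, 70917296129, 70917554177,
    70934331392, 71940702209, 71974256641, 71991033856, 137438953472, 137439215681,
    137439219712, 137455730689, 137455734848, 137455992896, 137455996931, 137456254977,
    137472507904, 137472507906, 137472508034, 137472512065, 137472512067, 137472770113,
    137472774144, 137489285121, 137489285249, 137489289280, 137489551361, 137506062464,
    137506328576, 137506586624, 137522839553, 138512695360, 138512695362, 138512699393,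
    138529472577, 138529476610, 138529734656, 138529734658, 138546249792, 138546253827,
    138563031040, 138563289088, 138579808257, 138596585472, 139586437120, 139619991554,
    139636768769, 206158430273, 206175207488, 206175207490, 206175211521, 206175211523,
    206175469569, 206191984705, 206191988736, 206192246784, 206192246786, 206208761920,
    206208761922, 206208765955, 206225539137, 206242578433, 206259355648, 207248949248,
    207248949250, 207265726465, 207282503682, 207316058112, 274894684161, 274928238593,
    4398046511169, 4398046515200, 4398046515328, 4398046519361, 4398046773248, 4398046773376,
    4398046777409, 4398063288384, 4398063296576, 4398063550465, 4398063554624, 4398080069632,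
    4398096842816, 4398096846849, 4398113624064, 4399120252929, 4399120257088, 4399120261121,
    4399120515136, 4399120519169, 4399137030144, 4399137030272, 4399137034305, 4399137038336,
    4399137296384, 4399153811520, 4399170584576, 4400194256896, 4400210772032, 4466765987840,
    4466765987842, 4466765987968, 4466765987970, 4466765992003, 4466765996032, 4466766254080,
    4466782765057, 4466782765059, 4466782765185, 4466782769216, 4466783031297, 4466799542272,
    4466799542400, 4466799808512, 4466816319489, 4466816323648, 4467839729728, 4467839733763,
    4467890065408, 4468913471488, 4468913471490, 4468930248705, 4535485464641, 4535485468674,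
    4535485726720, 4535485726722, 4535502241858, 4535502245891, 4535519019073, 4535519023104,
    4535535796288, 4535552577536, 4536575983616, 4536575983618, 4536592760833, 4536609538048,
    4604204941312, 4604221718529, 4604272050176, 8796093022336, 8796093026369, 8796109799425,
    8796109803584, 8796126576640, 8797166768129, 8797183545344, 8798240505856, 8864812503040,
    8864812761088, 8864829276224, 8864829280257, 8864846057472, 8865903017984]) (.poly [1]))
    (.mul (.poly [192, 524352, 17039360, 17039488, 33562688, 33820736, 50335744, 50593792,
    83890176, 1073741952, 1073750016, 1074008064, 1090523200, 1090781248, 1107304448,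
    1107562496, 1107820544, 1124077632, 1124335680, 1140850688, 2147483712, 2164264960,
    2198077440, 2214592576, 68719480896, 68736253952, 68736262144, 68736520192, 68736778240,
    68769808512, 68770332672, 68786589760, 68786847808, 69793222656, 69793480704, 69826777088,
    69843550272, 70917292032, 137438953536, 137489289216, 137506062400, 137523101696,
    137539616832, 138546249728, 206208761856, 206242316288, 4398046515264, 4398046773312,
    4398063288448, 4398080069696, 4399153811456, 4399154069504, 4400210771968, 4400244326400,
    4466765987904, 4466783027200, 4466816323584, 4466816581632, 4467873284096, 4535569350656,
    8796093022272, 8864829276160]) (.poly [4096, 68719476736]))))))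
    8 rfl (by decide +kernel)
  simp only [E.den, ev_F1 _ _ _ _ _ _ _ _ h, ev_F2 _ _ _ _ _ _ _ _ h, kwa, kwv, mul_zero, add_zero] at key
  simp only [ev, mon, Nat.reduceMod, Nat.reduceDiv] at key
  linear_combination key

set_option maxRecDepth 100000 in
theorem c1_2 [CharP D 2] {a b v z p q r t : D} (h : form1 a b v z p q r t = 0) (wa : a = 0) (wv : v = r)
    (h1 : t ^ 2+r ^ 2+1 = 0) :
    p ^ 2 * (b * p + t + r) = 0 := by
  have kh1 : ev [a, b, v, z, p, q, r, t] [0, 137438953472, 8796093022208] = 0 := by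
    simp only [ev, mon, Nat.reduceMod, Nat.reduceDiv]
    linear_combination h1
  have kwa : ev [a, b, v, z, p, q, r, t] [1] = 0 := by
    simp [ev, mon, wa]
  have kwv : ev [a, b, v, z, p, q, r, t] [4096, 68719476736] = 0 := by
    simp [ev, mon, wv, CharTwo.add_self_eq_zero]
  have key := E.sound [a, b, v, z, p, q, r, t]
    (.add (.add (.add (.add (.poly [50331712, 68753031168, 4398080065536]) (.mul (.poly
    [16777280, 50331712, 1124073472, 68786585600, 70866960384, 137439215616, 4398080065536,
    4535485464576]) (.poly [0, 137438953472, 8796093022208]))) (.add (.mul (.poly [16777280,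
    33816576, 50331712, 1090519040, 1124073472, 68719476736, 68753031168, 68786585600,
    70866960384, 137439215616, 137455730752, 138529472512, 206158430208, 206191984640,
    4398046511104, 4398080065536, 4535485464576]) (.poly (F2L 2 2))) (.mul (.poly [16777280,
    50331712, 68753031168, 138529472512]) (.poly (F1L 3 3))))) (.add (.add (.mul (.poly [0,
    4466765987840]) (.poly (F2L 2 1))) (.mul (.poly [64, 17039360, 33554496, 1073741824,
    68736253952, 138512695296, 4398063288320]) (.poly (F2L 2 3)))) (.add (.mul (.poly
    [68719738880, 69809995776, 137472507904, 4466765987840]) (.poly (F1L 1 2))) (.mul (.poly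
    [69793218560]) (.poly (F2L 3 1)))))) (.add (.add (.add (.mul (.poly [262144, 16777280,
    33816576, 68753031168, 69793218624, 137455730752, 206191984640, 4535485464576]) (.poly (F2L
    1 1))) (.mul (.poly [16777216]) (.poly (F2L 2 0)))) (.add (.mul (.poly [64, 33554496,
    50593792, 1140850688, 68719738944, 68769808384, 68803362816, 69793480704, 69809995840,
    4398063288320, 4398096842752, 4467839729664]) (.poly (F1L 2 3))) (.mul (.poly [33554496,
    1073741824, 1107296256, 68736253952, 68769808384, 138512695296, 206175207424,
    4398063288320]) (.poly (F2L 1 0))))) (.add (.add (.mul (.poly [68719476800, 69793218560])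
    (.poly (F2L 1 3))) (.mul (.poly [33554432, 137438953472]) (.poly (F1L 3 0)))) (.add (.mul
    (.poly [0, 33554432, 67108864, 68719738880, 68736254016, 137438953472]) (.poly (F1L 2 1)))
    (.add (.mul (.poly [64, 66, 192, 4097, 4225, 8256, 262145, 524352, 16777281, 16781440,
    33554498, 33554624, 33558529, 33558657, 33816577, 34078784, 50335744, 50335872, 50593792,
    50593794, 50593920, 50597953, 50601984, 50860032, 51118080, 67108928, 67112961, 67371009,
    83890176, 1073741824, 1073741952, 1073750016, 1074008064, 1107296256, 1107296384,
    1107304448, 1107562496, 1107820544, 1124335680, 1140850690, 1140850816, 1140854849,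
    1140858880, 1141116928, 1141374976, 2164264960, 2164523008, 2181038144, 2197819392,
    2231373824, 3221225472, 3254779904, 68719476739, 68719476865, 68719738944, 68719738946,
    68719739072, 68719742979, 68719743105, 68719747136, 68720001025, 68720263232, 68736262144,
    68736262272, 68736520192, 68736778240, 68736778242, 68753031169, 68753031297, 68753035330,
    68753293378, 68769808386, 68769808514, 68769812547, 68769816576, 68770074624, 68786851841,
    68787109889, 68803362816, 68803629056, 68820140033, 69793222658, 69793480706, 69793480832,
    69793484865, 69793488896, 69793746944, 69794004992, 69809995842, 69809995968, 69809999875,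
    69810000001, 69810257921, 69810520128, 69826777088, 69827035138, 69843550272, 69843550274,
    69843554305, 69843554307, 69843812353, 69877104704, 69877366785, 69893885952, 69894144000,
    70866960385, 70867222592, 70884003840, 70900514817, 70900518976, 70917292032, 70934069249,
    70950846464, 71940964352, 137438953538, 137438953664, 137438957569, 137438957571,
    137438957697, 137439215745, 137439219778, 137455730753, 137455734784, 137455734786,
    137455992832, 137455992960, 137456255041, 137472507968, 137472507970, 137472516160,
    137472774208, 137473032256, 137489285185, 137489289218, 137489547264, 137506062402,
    137506066435, 137506324481, 137523101696, 137539616832, 137539878913, 137556656128,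
    138512695296, 138512695298, 138512695424, 138512695426, 138512699457, 138512699459,
    138512703488, 138512961538, 138529472513, 138529472641, 138529476672, 138529734720,
    138529738753, 138529996801, 138546249730, 138546249856, 138546253889, 138546257920,
    138546511937, 138546774016, 138563026945, 138563289152, 138579804160, 138596581377,
    138613358592, 139586441217, 139586441219, 139603218432, 139619991616, 139619995649,
    140660178944, 206158430209, 206158692418, 206158696451, 206175207424, 206175731712,
    206191984769, 206191988800, 206192246848, 206192250881, 206208761984, 206208766017,
    206208770048, 206225543232, 206242316288, 207232434178, 207248953347, 207249211393,
    207282503744, 207282507777, 208305913857, 208322691072, 274877907008, 274877907010,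
    274877911043, 274894688258, 274911461440, 274911465473, 274928238657, 274928500736,
    274945015872, 275985203200, 275985203202, 276001980417, 343630938113, 343647715328,
    4398046777345, 4398063288322, 4398063288448, 4398063292481, 4398063554560, 4398080065537,
    4398080069696, 4398080327744, 4398096842752, 4398096842754, 4398096850944, 4398097108992,
    4398097367040, 4398113624128, 4399120257024, 4399120515072, 4399137034241, 4399153811456,
    4399170588673, 4399187365888, 4400210771968, 4400244326400, 4466765987906, 4466765991937,
    4466765991939, 4466782769154, 4466783027202, 4466799542338, 4466799546371, 4466816319553,
    4466816323584, 4466833100801, 4466833358849, 4466849878016, 4466850136064, 4467839729664,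
    4467839729666, 4467839737856, 4467840253952, 4467856506881, 4467856511040, 4467873284098,
    4467890061313, 4468913475585, 4468930252800, 4469987213312, 4535485464577, 4535485464579,
    4535485726784, 4535485730817, 4535502241792, 4535502241920, 4535502245953, 4535502249984,
    4535502508032, 4535519023168, 4535535796224, 4535569350656, 4536559210496, 4536559468544,
    4536576245761, 4536592764928, 4536593022976, 4604204941376, 4604205203457, 4604238495808,
    4605278683136, 4605312237568, 8796093022272, 8796093026305, 8796110061568, 8796126576704,
    8796126580737, 8796143357952, 8797200318464, 8864812498945, 8864829276160, 8864846053377,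
    8864862830592, 9002251452417, 9002268229632]) (.poly [1])) (.mul (.poly [128, 266240,
    16781376, 17039424, 34078720, 50335808, 67108864, 83890240, 100663296, 1090523136,
    1107296320, 1124077568, 1140850752, 1157632000, 1157890048, 1174405184, 2147483648,
    2181038080, 2214592512, 68719480832, 68719739008, 68719747072, 68736254016, 68736254144,
    68736520256, 68753035392, 68753293312, 68803362880, 68820402176, 68836917312, 69793222720,
    69810003968, 69810262016, 69810520064, 69843550336, 69877104640, 70866964480, 70867222528,
    70883737664, 70900518912, 71957479424, 137438953472, 137438953600, 137439219712,
    137455734848, 137472507904, 137472508032, 137472516096, 137473032192, 137489289280,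
    137506062464, 137539616768, 138529734656, 138546249792, 138563031040, 139586437120,
    139619991552, 206191988736, 206192246784, 206208761920, 207248949248, 274877906944,
    274911461376, 4398063288384, 4398080327680, 4398096842816, 4398113624064, 4399170584576,
    4399204139008, 4466765996032, 4466783027264, 4466833096704, 4466866651136, 4467839729728,
    4467873284160, 4535485468672, 4535519281152, 4535535796288, 4604238495744, 8796126576640])
    (.poly [4096, 68719476736])))))))
    8 rfl (by decide +kernel)
  simp only [E.den, ev_F1 _ _ _ _ _ _ _ _ h, ev_F2 _ _ _ _ _ _ _ _ h, kh1, kwa, kwv, mul_zero, add_zero] at key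
  simp only [ev, mon, Nat.reduceMod, Nat.reduceDiv] at key
  linear_combination key

set_option maxRecDepth 100000 in
theorem c1_3 [CharP D 2] {a b v z p q r t : D} (h : form1 a b v z p q r t = 0) (wa : a = 0) (wv : v = r)
    (h1 : t ^ 2+r ^ 2+1 = 0)
    (h2 : b * p + t + r = 0) :
    p ^ 1 * (b ^ 2+p ^ 2+r ^ 2) = 0 := by
  have kh1 : ev [a, b, v, z, p, q, r, t] [0, 137438953472, 8796093022208] = 0 := by
    simp only [ev, mon, Nat.reduceMod, Nat.reduceDiv]
    linear_combination h1
  have kh2 : ev [a, b, v, z, p, q, r, t] [16777280, 68719476736, 4398046511104] = 0 := by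
    simp only [ev, mon, Nat.reduceMod, Nat.reduceDiv]
    linear_combination h2
  have kwa : ev [a, b, v, z, p, q, r, t] [1] = 0 := by
    simp [ev, mon, wa]
  have kwv : ev [a, b, v, z, p, q, r, t] [4096, 68719476736] = 0 := by
    simp [ev, mon, wv, CharTwo.add_self_eq_zero]
  have key := E.sound [a, b, v, z, p, q, r, t]
    (.add (.add (.add (.poly [16777344, 50331648, 137455730688]) (.add (.mul (.poly
    [68719476800, 137455730688]) (.poly [0, 137438953472, 8796093022208])) (.mul (.poly
    [2147483712, 68719738944, 69793480704, 69809995840, 70883737600, 137438953536,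
    138512695296, 206175207424, 206208761856, 4466765987904]) (.poly [16777280, 68719476736,
    4398046511104])))) (.add (.add (.mul (.poly [68719476800, 69793218560]) (.poly (F2L 2 2)))
    (.mul (.poly [69793218560]) (.poly (F1L 3 3)))) (.add (.mul (.poly [64, 1073741824]) (.poly
    (F2L 2 1))) (.mul (.poly [137438953472]) (.poly (F2L 2 3)))))) (.add (.add (.mul (.poly
    [1073741824, 68736253952]) (.poly (F1L 1 2))) (.add (.mul (.poly [68719476736]) (.poly (F1L
    0 2))) (.mul (.poly [16777216, 69793218560, 137455730688]) (.poly (F2L 1 1))))) (.add (.add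
    (.mul (.poly [33554432, 68719738880, 4466765987840]) (.poly (F1L 2 3))) (.mul (.poly [64,
    68736253952]) (.poly (F1L 2 1)))) (.add (.mul (.poly [128, 4161, 262209, 33554432,
    33554434, 33554560, 33558593, 33562624, 33820672, 34078720, 1073745921, 1074008128,
    1090523136, 2147483648, 2164265024, 3221225536, 68719476801, 68719476803, 68719480832,
    68719738882, 68719739008, 68719743041, 68719747072, 68720005120, 68720263168, 68736254016,
    68736258051, 68736262208, 68736516097, 68736520256, 68753031233, 68753035264, 68769808448,
    68770070529, 68786847744, 69793218563, 69809995776, 69809995778, 69809999937, 69810003968,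
    70866960449, 70866964480, 70883737664, 70900518912, 71957479424, 137438953600,
    137438953602, 137438957635, 137439219712, 137455730689, 137455992896, 137455996929,
    137456254977, 137472507904, 137472507906, 137472508032, 137473032192, 137489285121,
    137489289280, 138512699393, 138529476608, 138529734656, 138563031040, 139586437122,
    139619991552, 206158430273, 206158434304, 206158692352, 206158692354, 206175207490,
    206175211521, 206175211523, 206191984705, 206191988736, 206208761920, 206208765953,
    207232172033, 207248949248, 207248949250, 274894684161, 4398046511169, 4398063292417,
    4398080069632, 4399120252929, 4466765987840, 4466765987842, 4466765996032, 4466766254080,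
    4466766512128, 4466782769216, 4467839729728, 4468913471488, 4535485468672, 4535485726720,
    4535502241856, 4535502503937, 4535519023104, 4535519281152, 4536575983616, 4604238495744])
    (.poly [1])) (.mul (.poly [16781312, 33554496, 50335744, 1073741952, 1073750016,
    1090781248, 1107296384, 2147483712, 68736262144, 68753293376, 68769808512, 69793222656,
    69827035136, 69843550272, 137438953536, 137455992832, 137489547264, 137506062400,
    4399137030208, 4466765987904, 4466799542336, 4467873284096, 4535502241792, 4535535796224])
    (.poly [4096, 68719476736]))))))
    8 rfl (by decide +kernel)
  simp only [E.den, ev_F1 _ _ _ _ _ _ _ _ h, ev_F2 _ _ _ _ _ _ _ _ h, kh1, kh2, kwa, kwv, mul_zero, add_zero] at key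
  simp only [ev, mon, Nat.reduceMod, Nat.reduceDiv] at key
  linear_combination key

set_option maxRecDepth 100000 in
theorem c1_4 [CharP D 2] {a b v z p q r t : D} (h : form1 a b v z p q r t = 0) (wa : a = 0) (wv : v = r)
    (h1 : t ^ 2+r ^ 2+1 = 0)
    (h2 : b * p + t + r = 0)
    (h3 : b ^ 2+p ^ 2+r ^ 2 = 0) :
    p ^ 1 * (q ^ 2 + p ^ 2 * r ^ 2 + p ^ 2 + r ^ 2 + 1) = 0 := by
  have kh1 : ev [a, b, v, z, p, q, r, t] [0, 137438953472, 8796093022208] = 0 := by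
    simp only [ev, mon, Nat.reduceMod, Nat.reduceDiv]
    linear_combination h1
  have kh2 : ev [a, b, v, z, p, q, r, t] [16777280, 68719476736, 4398046511104] = 0 := by
    simp only [ev, mon, Nat.reduceMod, Nat.reduceDiv]
    linear_combination h2
  have kh3 : ev [a, b, v, z, p, q, r, t] [128, 33554432, 137438953472] = 0 := by
    simp only [ev, mon, Nat.reduceMod, Nat.reduceDiv]
    linear_combination h3
  have kwa : ev [a, b, v, z, p, q, r, t] [1] = 0 := by
    simp [ev, mon, wa]
  have kwv : ev [a, b, v, z, p, q, r, t] [4096, 68719476736] = 0 := by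
    simp [ev, mon, wv, CharTwo.add_self_eq_zero]
  have key := E.sound [a, b, v, z, p, q, r, t]
    (.add (.add (.add (.poly [16777216, 50331648, 2164260864, 137455730688, 137489285120])
    (.mul (.poly [16777216, 50331648, 68719476800, 137455730688]) (.poly [0, 137438953472,
    8796093022208]))) (.add (.mul (.poly [33554496, 68736253952, 69809995840, 137438953536,
    137472507968, 4398063288320, 4398096842752, 4466765987904, 4535502241792]) (.poly
    [16777280, 68719476736, 4398046511104])) (.add (.mul (.poly [16777216, 50331648,
    68719476800, 69793218560, 69826772992, 137489285120, 4466782765056]) (.poly [128, 33554432,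
    137438953472])) (.mul (.poly [50331648, 137455730688]) (.poly (F2L 2 2)))))) (.add (.add
    (.mul (.poly [64]) (.poly (F2L 2 1))) (.add (.mul (.poly [1073741824, 68736253952]) (.poly
    (F1L 1 2))) (.mul (.poly [16777216]) (.poly (F2L 1 1))))) (.add (.mul (.poly [33554432,
    68736254016]) (.poly (F1L 2 3))) (.add (.mul (.poly [128, 16781376, 33554432, 33554434,
    33554560, 33558593, 33562624, 33820672, 34078720, 50331649, 67108864, 1073741888,
    1073745921, 1074008128, 1090523136, 1124335616, 68719476803, 68719480960, 68736254016,
    68736254144, 68736258049, 68736258051, 68736258177, 68736262208, 68736778304, 68769808448,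
    68769808450, 68769812481, 68769812483, 68770070529, 68786847744, 68803362880, 68803366913,
    69809995776, 69809995778, 69809995904, 69809999937, 69810003968, 69826772993, 69826777152,
    70883737664, 137472507904, 137472516096, 137472770113, 137489289280, 137489547328,
    138529734656, 138546249792, 206175207490, 206175211521, 206175211523, 206208761920,
    206208765953, 4398046511169, 4398063292417, 4398080069632, 4398096842816, 4398096846849,
    4398113624064, 4399137030144, 4535502241856, 4535502245889, 4535519023104]) (.poly [1]))
    (.mul (.poly [64, 16781312, 50335744, 67108928, 83890176, 1073741824, 1073741952,
    1073750016, 1107296256, 1140850688, 68719480896, 68736253952, 68736254080, 68736262144,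
    68769808384, 68803362816, 69793222656, 137438953536, 137455734784, 137489289216,
    138512695296, 138546249728, 206175207424, 206208761856]) (.poly [4096, 68719476736]))))))
    8 rfl (by decide +kernel)
  simp only [E.den, ev_F1 _ _ _ _ _ _ _ _ h, ev_F2 _ _ _ _ _ _ _ _ h, kh1, kh2, kh3, kwa, kwv, mul_zero, add_zero] at key
  simp only [ev, mon, Nat.reduceMod, Nat.reduceDiv] at key
  linear_combination key

set_option maxRecDepth 100000 in
theorem c1_5 [CharP D 2] {a b v z p q r t : D} (h : form1 a b v z p q r t = 0) (wa : a = 0) (wv : v = r)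
    (h1 : t ^ 2+r ^ 2+1 = 0)
    (h2 : b * p + t + r = 0)
    (h3 : b ^ 2+p ^ 2+r ^ 2 = 0)
    (h4 : q ^ 2 + p ^ 2 * r ^ 2 + p ^ 2 + r ^ 2 + 1 = 0) :
    p ^ 1 * (z + p * q + p ^ 2 * r + t) = 0 := by
  have kh1 : ev [a, b, v, z, p, q, r, t] [0, 137438953472, 8796093022208] = 0 := by
    simp only [ev, mon, Nat.reduceMod, Nat.reduceDiv]
    linear_combination h1
  have kh2 : ev [a, b, v, z, p, q, r, t] [16777280, 68719476736, 4398046511104] = 0 := by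
    simp only [ev, mon, Nat.reduceMod, Nat.reduceDiv]
    linear_combination h2
  have kh3 : ev [a, b, v, z, p, q, r, t] [128, 33554432, 137438953472] = 0 := by
    simp only [ev, mon, Nat.reduceMod, Nat.reduceDiv]
    linear_combination h3
  have kh4 : ev [a, b, v, z, p, q, r, t] [0, 33554432, 2147483648, 137438953472, 137472507904] = 0 := by
    simp only [ev, mon, Nat.reduceMod, Nat.reduceDiv]
    linear_combination h4
  have kwa : ev [a, b, v, z, p, q, r, t] [1] = 0 := by
    simp [ev, mon, wa]
  have kwv : ev [a, b, v, z, p, q, r, t] [4096, 68719476736] = 0 := by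
    simp [ev, mon, wv, CharTwo.add_self_eq_zero]
  have key := E.sound [a, b, v, z, p, q, r, t]
    (.add (.add (.add (.poly [17039360, 1107296256, 68769808384, 4398063288320]) (.add (.mul
    (.poly [1073741824]) (.poly [0, 137438953472, 8796093022208])) (.mul (.poly [16777216,
    50331648, 2164260864, 68736516096, 68753031232, 69793218560, 137489285120, 4399120252928])
    (.poly [16777280, 68719476736, 4398046511104])))) (.add (.mul (.poly [64]) (.poly [128,
    33554432, 137438953472])) (.add (.mul (.poly [17039360, 1073741824]) (.poly [0, 33554432,
    2147483648, 137438953472, 137472507904])) (.mul (.poly [1073741824, 68736253952]) (.poly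
    (F2L 2 2)))))) (.add (.add (.mul (.poly [16777216]) (.poly (F2L 2 1))) (.add (.mul (.poly
    [68719476736]) (.poly (F2L 2 3))) (.mul (.poly [16777216]) (.poly (F1L 1 2))))) (.add (.add
    (.mul (.poly [64, 1073741824]) (.poly (F2L 1 1))) (.mul (.poly [16777216]) (.poly (F1L 2
    1)))) (.add (.mul (.poly [4224, 16777280, 17039361, 17043520, 1073741825, 1073745984,
    1124073472, 2147745792, 2181042176, 3238002688, 68719476736, 68719476864, 68719476866,
    68719480899, 68736253953, 68736253955, 68736254081, 68753031170, 68753031296, 68769812544,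
    69793218626, 69793222657, 69809999872, 69843554304, 70866960386, 70900514816, 137438957568,
    137439215616, 137439215618, 137455730752, 137455730754, 137455734787, 137489289217,
    138512695297, 138529472512, 138546249729, 206191984640, 4398046511232, 4398046515265,
    4398063288321, 4398063292480, 4398080065536, 4399120252992, 4400193994752, 4466766249984,
    4466782765120, 4466782769153, 4466799546368, 4467856506880, 4535519019008]) (.poly [1]))
    (.mul (.poly [4160, 16777216, 16785408, 33558592, 50331648, 1073745920, 1107558400,
    1124073536, 2164260864, 68736516096, 68770070528, 68786585664, 69826772992, 137455730688,
    4399153807360, 4466816319488]) (.poly [4096, 68719476736]))))))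
    8 rfl (by decide +kernel)
  simp only [E.den, ev_F1 _ _ _ _ _ _ _ _ h, ev_F2 _ _ _ _ _ _ _ _ h, kh1, kh2, kh3, kh4, kwa, kwv, mul_zero, add_zero] at key
  simp only [ev, mon, Nat.reduceMod, Nat.reduceDiv] at key
  linear_combination key

set_option maxRecDepth 100000 in
theorem c2_0 [CharP D 2] {a b v z p q r t : D} (h : form1 a b v z p q r t = 0) (wv : v = 0) :
    r ^ 1 * (a+p) = 0 := by
  have kwv : ev [a, b, v, z, p, q, r, t] [4096] = 0 := by
    simp [ev, mon, wv]
  have key := E.sound [a, b, v, z, p, q, r, t]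
    (.add (.add (.poly [68719476737, 68736253952]) (.mul (.poly [0]) (.poly (F1L 0 2)))) (.add
    (.mul (.poly [0]) (.poly (F1L 1 3))) (.mul (.poly [1, 3, 129, 4162, 8193, 266241, 524289,
    16777216, 68736258050, 68736516098, 68753293313]) (.poly [4096]))))
    8 rfl (by decide +kernel)
  simp only [E.den, ev_F1 _ _ _ _ _ _ _ _ h, ev_F2 _ _ _ _ _ _ _ _ h, kwv, mul_zero, add_zero] at key
  simp only [ev, mon, Nat.reduceMod, Nat.reduceDiv] at key
  linear_combination key

set_option maxRecDepth 100000 in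
theorem c2_1 [CharP D 2] {a b v z p q r t : D} (h : form1 a b v z p q r t = 0) (wv : v = 0) (wa : a = p) :
    r ^ 3 * (z ^ 2+1) = 0 := by
  have kwv : ev [a, b, v, z, p, q, r, t] [4096] = 0 := by
    simp [ev, mon, wv]
  have kwa : ev [a, b, v, z, p, q, r, t] [1, 16777216] = 0 := by
    simp [ev, mon, wa, CharTwo.add_self_eq_zero]
  have key := E.sound [a, b, v, z, p, q, r, t]
    (.add (.add (.add (.add (.poly [206158430208, 206158954496]) (.mul (.poly [64, 1107296256,
    68719738944, 68769808384, 137455992832, 4466765987904, 4535502241792]) (.poly (F2L 3 2))))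
    (.add (.mul (.poly [262144, 50331712, 1090519040, 1124073472, 68753031168, 69793218624,
    70866960384, 137439215616, 137455730752, 138529472512, 206158430208, 4466782765120,
    4535519019008]) (.poly (F2L 2 2))) (.mul (.poly [50331712, 68786585600, 137455730752,
    138529472512, 206158430208]) (.poly (F1L 3 3))))) (.add (.add (.mul (.poly [0, 128,
    68719738880, 137438953472, 4466765987840]) (.poly (F2L 2 1))) (.mul (.poly [1073741888,
    68736254016, 69809995776, 137438953472, 137472507904, 4466765987840]) (.poly (F1L 1 2))))
    (.add (.mul (.poly [68719476800]) (.poly (F2L 3 1))) (.add (.mul (.poly [16777216,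
    50331648, 69793218560]) (.poly (F1L 0 2))) (.mul (.poly [16777280, 33816576, 1090519040,
    1124073472, 68719476736, 68719476864, 69793218624, 137455730752, 4398046511104,
    4398080065536, 4466766249984, 4467856506880, 8864812498944]) (.poly (F2L 1 1))))))) (.add
    (.add (.add (.mul (.poly [16777216, 50331648, 69793218560, 137455730688]) (.poly (F2L 2
    0))) (.mul (.poly [262144, 16777280, 33816576, 1124073472, 68753031168, 68786585600,
    137439215616, 4398046511104, 4398080065536, 4535485464576]) (.poly (F1L 2 2)))) (.add (.mul
    (.poly [1073741824, 68736253952, 68769808384, 138512695296]) (.poly (F2L 1 0))) (.add (.mul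
    (.poly [67108864, 68719738880, 68736254016, 69809995776, 137472507904, 4466765987840,
    4466799542272]) (.poly (F2L 1 2))) (.mul (.poly [69793218560]) (.poly (F2L 1 3)))))) (.add
    (.add (.mul (.poly [68736254016, 69809995776]) (.poly (F1L 3 0))) (.mul (.poly [64,
    137438953536]) (.poly (F2L 0 1)))) (.add (.mul (.poly [0, 67108864, 68719738880,
    4466765987840]) (.poly (F1L 2 1))) (.add (.mul (.poly [2, 266240, 16777217, 16777345,
    17039424, 33554432, 33816641, 33820672, 50593856, 67108864, 67108992, 67375104, 83886081,
    83890240, 100671488, 1073741888, 1073742016, 1073745921, 1073750080, 1074003969,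
    1074004097, 1107296320, 1124073537, 1124077568, 1140850752, 1157890048, 1174405184,
    2147483648, 2164260865, 2181038080, 2181038082, 2231369729, 68719476801, 68719476803,
    68719738882, 68719738884, 68736254018, 68736254020, 68736258049, 68736262208, 68736516097,
    68736516225, 68736520256, 68753031233, 68753035392, 68753293314, 68753293316, 68753301504,
    68769808452, 68769816640, 68786585665, 68786589696, 68786589700, 68786847746, 68803362880,
    68820140097, 68820144128, 68820144130, 68820402176, 68836917312, 69793218561, 69793218563,
    69793218689, 69793222720, 69793480770, 69809995776, 69809995778, 69809995906, 69810003968,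
    69810257985, 69810262016, 69810520064, 69826772995, 69826773121, 69827035200, 69843558400,
    69860327427, 69877104642, 69893881857, 70883999745, 71957479424, 137438953476,
    137438953604, 137438961664, 137439215681, 137439215683, 137439219712, 137439219716,
    137455730689, 137455730691, 137455730817, 137455734848, 137455734852, 137455992898,
    137472507908, 137472508034, 137472516096, 137472774144, 137472774146, 137473032192,
    137489289282, 137489547328, 137506062336, 137506062338, 137506070528, 137539616768,
    138512695360, 138529472577, 138529476612, 138546249792, 138546249794, 138563027009,
    138563031040, 138563031042, 139586437120, 139586437122, 139586437124, 139619991552,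
    139636768769, 206158434304, 206158692352, 206158692354, 206158692356, 206175469569,
    206175469571, 206191984705, 206191988740, 206192246786, 206225543170, 207232172035,
    207248949248, 207248949252, 207265726465, 207265726467, 274877906946, 274877906948,
    274911461378, 4398046773250, 4398063288384, 4398063288386, 4398063550465, 4398080069632,
    4398080327682, 4398096842818, 4398097104897, 4398113620033, 4398113624064, 4398113624066,
    4398130397248, 4398130401281, 4399120252929, 4399153807361, 4399187361793, 4399204139008,
    4466765987844, 4466765987968, 4466765987970, 4466765996032, 4466766250049, 4466766254080,
    4466766254082, 4466782765185, 4466782769216, 4466782769218, 4466783027264, 4466783031297,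
    4466799542274, 4466799542276, 4466799542400, 4466799546433, 4466799550464, 4466799808512,
    4466816319489, 4466816323648, 4466833096704, 4466833096706, 4466833104896, 4466866651136,
    4467839729728, 4467839729730, 4467856506945, 4467856510976, 4467856510978, 4467856769024,
    4467873288193, 4467890065408, 4468913471488, 4468913471490, 4468947025920, 4535485464643,
    4535485468672, 4535485468676, 4535485726720, 4535485726722, 4535485726724, 4535502241856,
    4535502241858, 4535502241860, 4535502245889, 4535519019073, 4535519023104, 4535519023108,
    4535519281154, 4535552573505, 4535552577536, 4535552577538, 4536559206403, 4536575983618,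
    4536575983620, 4536592760835, 4604204941312, 4604204941314, 4604221718529, 4604221718531,
    4604238495744, 4604238495748, 4604255272961, 4604272050178, 8796093022210, 8796109799425,
    8796126576642, 8796143353857, 8864812503040, 8864812503042, 8864812761090, 8864829276224,
    8864829276226, 8864829280257, 8864829538305, 8864846053441, 8864846057472, 8864846057474,
    8864862830656, 8864862834689, 8865886240769, 8865903017984, 8865903017986, 8933531975680,
    8933531975684, 8933548752897, 8933565530112, 8933582307329, 13262859010050,
    13262875787265]) (.poly [4096])) (.mul (.poly [64, 192, 262145, 524352, 17039360, 17039488,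
    33816577, 34078784, 50331713, 67371009, 1073741952, 1074266112, 1090519041, 1140850688,
    2181038144, 3221225472, 68719476737, 68719476739, 68719476867, 68720001025, 68736253954,
    68736254082, 68736516161, 68753031169, 68753031297, 68753293376, 68753293378, 68769808386,
    68769808514, 68770070593, 68786585601, 68786847808, 68803362816, 68803362818, 69793218627,
    69793480704, 69793480832, 69809995840, 69809995842, 69809995968, 69827035138, 69843550272,
    69860327489, 69860589568, 69877104704, 70867222592, 70883737600, 70883737602, 70917292032,
    70917292034, 70934069249, 137438953538, 137438953664, 137438953666, 137439215617,
    137439215619, 137439477824, 137455730753, 137455730881, 137455992960, 137472507968,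
    137472508096, 137489285185, 137506062400, 137522839617, 137523101696, 137539616832,
    138512695296, 138512695424, 138512695426, 138546249730, 138546249856, 138563026945,
    138596581377, 139586437184, 139603476480, 140676956161, 206158430209, 206158430211,
    206158692416, 206175207554, 206175469633, 206175731712, 206192246848, 206208761856,
    206208761984, 207232172097, 207232172099, 207232434176, 207248949312, 207249211393,
    207265988608, 208305913857, 208322691072, 274877907008, 274894684225, 274894946304,
    275951648768, 4398046511233, 4398063288320, 4398080065537, 4398096842752, 4398096842880,
    4399120252993, 4399170584640, 4466765988032, 4466766512192, 4466782765121, 4466799542338,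
    4466816319553, 4467839729664, 4467839729666, 4467856769088, 4467873284096, 4467873284098,
    4467906838528, 4469987213312, 4535485464579, 4535485726786, 4535502241792, 4535502241922,
    4535502504001, 4535502766080, 4535519019009, 4535519019137, 4535569350656, 4536559468546,
    4536576245761, 4536593022976, 4537632948225, 4604204941378, 4604205203457, 4604221718593,
    4604238495810, 4604255273025, 4605295460353, 4605312237568, 8796126576704, 8797166764032,
    8797200318464, 8864812498945, 8864829276288, 8865886502912, 8933531975746, 8933548752961,
    8933549015040, 8933565530176, 8934605717504, 8934605717506, 8934622494721, 9002251452417,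
    9002268229632, 13262859010112, 13263932751872]) (.poly [1, 16777216])))))))
    8 rfl (by decide +kernel)
  simp only [E.den, ev_F1 _ _ _ _ _ _ _ _ h, ev_F2 _ _ _ _ _ _ _ _ h, kwv, kwa, mul_zero, add_zero] at key
  simp only [ev, mon, Nat.reduceMod, Nat.reduceDiv] at key
  linear_combination key

set_option maxRecDepth 100000 in
theorem c2_2 [CharP D 2] {a b v z p q r t : D} (h : form1 a b v z p q r t = 0) (wv : v = 0) (wa : a = p)
    (h1 : z ^ 2+1 = 0) :
    (q ^ 2+z * r+p ^ 2) = 0 := by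
  have kh1 : ev [a, b, v, z, p, q, r, t] [0, 524288] = 0 := by
    simp only [ev, mon, Nat.reduceMod, Nat.reduceDiv]
    linear_combination h1
  have kwv : ev [a, b, v, z, p, q, r, t] [4096] = 0 := by
    simp [ev, mon, wv]
  have kwa : ev [a, b, v, z, p, q, r, t] [1, 16777216] = 0 := by
    simp [ev, mon, wa, CharTwo.add_self_eq_zero]
  have key := E.sound [a, b, v, z, p, q, r, t]
    (.add (.add (.add (.poly [33554432, 2147483648, 68719738880]) (.add (.mul (.poly
    [2147483648, 68719738880, 69809995776, 4466765987840]) (.poly [0, 524288])) (.mul (.poly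
    [68719476736]) (.poly (F1L 0 3))))) (.add (.mul (.poly [16777216, 68719476800]) (.poly (F2L
    3 2))) (.add (.mul (.poly [33554432, 1073741888, 68736254016]) (.poly (F2L 2 2))) (.mul
    (.poly [2147483648, 69809995776]) (.poly (F1L 3 3)))))) (.add (.add (.mul (.poly
    [68736253952]) (.poly (F2L 2 0))) (.add (.mul (.poly [2147483648, 69809995776,
    4466765987840]) (.poly (F1L 2 2))) (.mul (.poly [69793218560]) (.poly (F2L 1 0))))) (.add
    (.add (.mul (.poly [68719476736]) (.poly (F2L 3 0))) (.mul (.poly [1090519040,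
    4398046511104]) (.poly (F1L 2 1)))) (.add (.mul (.poly [33558528, 50331712, 67112960,
    1090519040, 1090519168, 1107296257, 1107300416, 2147483713, 2147487744, 2164260928,
    2181300224, 2197815360, 3221225473, 3238002688, 3254779905, 68719476738, 68719476864,
    68719480897, 68736253953, 68736253955, 68736258112, 68753031170, 68753031172, 68753031296,
    68769812544, 68786585602, 69793218628, 69809995841, 69826773058, 69826777089, 69843554304,
    69843812352, 69860327488, 70883737601, 70917292033, 137438953537, 137438953539,
    137455730752, 137455730754, 137455730756, 137455992833, 137489285186, 138512695297,
    138512695299, 138529472514, 138546249729, 138563026944, 4398046511104, 4398046511106,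
    4398080065536, 4398080065538, 4398096842753, 4399120252994, 4399137030209, 4399137292288,
    4399153807424, 4400210771969, 4400227549184, 4466765991936, 4466782765120, 4466782765122,
    4466782769153, 4466799542337, 4466799546368, 4466799804416, 4466816319552, 4467856506880,
    4467873284097, 4467890061312, 4535485464578, 4535502241793, 4535519019008, 8797183541248,
    8864846053376]) (.poly [4096])) (.mul (.poly [16777216, 50331648, 1073741889, 1090519104,
    1090781185, 68719476800, 68736254017, 68753031234, 68769808449, 69793218560, 69793218688,
    69793218690, 69809995777, 69809995905, 69826772992, 69826772994, 70883737665, 70900514880,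
    71940702208, 71957479425, 137438953473, 137438953601, 137455730690, 137455730816,
    137455730818, 137456254976, 137472507905, 137472508033, 138512695361, 138529472576,
    138546249793, 138563027008, 139586437121, 139619991553, 207232172032, 4398046773249,
    4398080065600, 4399120253056, 4466765987841, 4466782765056, 4466782765058, 4466782765184,
    4467839991808, 4467856506944, 4468913471489, 4468930248704, 4535485464640, 4535502241857,
    4535519019072, 4536559206400, 4536575983617, 4536592760832, 8865886240768, 8933548752896])
    (.poly [1, 16777216]))))))
    8 rfl (by decide +kernel)
  simp only [E.den, ev_F1 _ _ _ _ _ _ _ _ h, ev_F2 _ _ _ _ _ _ _ _ h, kh1, kwv, kwa, mul_zero, add_zero] at key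
  simp only [ev, mon, Nat.reduceMod, Nat.reduceDiv] at key
  linear_combination key

set_option maxRecDepth 100000 in
theorem c2_3 [CharP D 2] {a b v z p q r t : D} (h : form1 a b v z p q r t = 0) (wv : v = 0) (wa : a = p)
    (h1 : z ^ 2+1 = 0)
    (h2 : q ^ 2+z * r+p ^ 2 = 0) :
    r ^ 1 * (b ^ 2+z * r+p ^ 2) = 0 := by
  have kh1 : ev [a, b, v, z, p, q, r, t] [0, 524288] = 0 := by
    simp only [ev, mon, Nat.reduceMod, Nat.reduceDiv]
    linear_combination h1
  have kh2 : ev [a, b, v, z, p, q, r, t] [33554432, 2147483648, 68719738880] = 0 := by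
    simp only [ev, mon, Nat.reduceMod, Nat.reduceDiv]
    linear_combination h2
  have kwv : ev [a, b, v, z, p, q, r, t] [4096] = 0 := by
    simp [ev, mon, wv]
  have kwa : ev [a, b, v, z, p, q, r, t] [1, 16777216] = 0 := by
    simp [ev, mon, wa, CharTwo.add_self_eq_zero]
  have key := E.sound [a, b, v, z, p, q, r, t]
    (.add (.add (.add (.poly [68719476864, 68753031168, 137439215616]) (.add (.mul (.poly
    [16777280]) (.poly [0, 524288])) (.mul (.poly [16777280, 33816576]) (.poly [33554432,
    2147483648, 68719738880])))) (.add (.add (.mul (.poly [1073741824, 68736253952]) (.poly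
    (F2L 3 2))) (.mul (.poly [262144, 16777280, 1090519040, 68753031168, 4398046511104]) (.poly
    (F2L 2 2)))) (.add (.mul (.poly [16777280, 68753031168]) (.poly (F1L 3 3))) (.mul (.poly
    [0]) (.poly (F2L 2 1)))))) (.add (.add (.add (.mul (.poly [262144, 1090519040,
    4398046511104]) (.poly (F2L 1 1))) (.mul (.poly [64]) (.poly (F1L 2 3)))) (.add (.mul
    (.poly [68719476736, 4398046511104]) (.poly (F1L 2 2))) (.mul (.poly [1073741824,
    68736253952]) (.poly (F2L 1 0))))) (.add (.add (.mul (.poly [33554432]) (.poly (F2L 1 2)))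
    (.mul (.poly [0]) (.poly (F1L 2 1)))) (.add (.mul (.poly [2, 128, 130, 4161, 266240,
    16777217, 16777345, 17039424, 33554432, 33554434, 33554560, 50335808, 67108864, 67117056,
    1073745921, 1074003969, 1090519105, 1090523136, 2147483648, 2147483650, 2164260865,
    68719738880, 68719738882, 68736254016, 68736254020, 68736516097, 68753031233, 68753035268,
    68753293312, 68769812481, 68786585665, 68786589696, 68786589698, 69793218561, 69809995778,
    69826772995, 69843550210, 137438953474, 137472507906, 137472507908, 137506062338,
    4398046511169, 4398063288384, 4398063288386, 4398080065601, 4398080069634, 4398096842816,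
    4398096846849, 4399137030144, 4399153807361, 4466765987842, 4466799542272, 4466799542274,
    4466816319489]) (.poly [4096])) (.mul (.poly [66, 192, 524352, 16777281, 17039360,
    50593792, 1073741824, 1074266112, 1090519041, 1090781248, 2164523008, 3221225472,
    68719476739, 68736254080, 68736254082, 68753293376, 69793480704, 69793480706, 70883737600,
    70883737602, 137438953536, 137439215617, 137455730753, 137455992832, 137472507970,
    137489285185, 138529472513, 206175207424, 4398046511105, 4398046773312, 4398063288448,
    4399120515072, 4399137030208, 4466765987904, 4466783027200, 4466799542336, 4467839729666,
    4535485464577, 8797166764032]) (.poly [1, 16777216]))))))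
    8 rfl (by decide +kernel)
  simp only [E.den, ev_F1 _ _ _ _ _ _ _ _ h, ev_F2 _ _ _ _ _ _ _ _ h, kh1, kh2, kwv, kwa, mul_zero, add_zero] at key
  simp only [ev, mon, Nat.reduceMod, Nat.reduceDiv] at key
  linear_combination key

set_option maxRecDepth 100000 in
theorem c2_4 [CharP D 2] {a b v z p q r t : D} (h : form1 a b v z p q r t = 0) (wv : v = 0) (wa : a = p) :
    (z ^ 3+b * p+p * q+z+t) = 0 := by
  have kwv : ev [a, b, v, z, p, q, r, t] [4096] = 0 := by
    simp [ev, mon, wv]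
  have kwa : ev [a, b, v, z, p, q, r, t] [1, 16777216] = 0 := by
    simp [ev, mon, wa, CharTwo.add_self_eq_zero]
  have key := E.sound [a, b, v, z, p, q, r, t]
    (.add (.add (.poly [262144, 786432, 16777280, 1090519040, 4398046511104]) (.mul (.poly [0])
    (.poly (F1L 0 3)))) (.add (.mul (.poly [2, 128, 4161, 68736516097]) (.poly [4096])) (.mul
    (.poly [1073741824, 68736778240]) (.poly [1, 16777216]))))
    8 rfl (by decide +kernel)
  simp only [E.den, ev_F1 _ _ _ _ _ _ _ _ h, ev_F2 _ _ _ _ _ _ _ _ h, kwv, kwa, mul_zero, add_zero] at key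
  simp only [ev, mon, Nat.reduceMod, Nat.reduceDiv] at key
  linear_combination key

set_option maxRecDepth 100000 in
theorem c3_1 [CharP D 2] {a b v z p q r t : D} (h : form1 a b v z p q r t = 0) (wa : a = 0) (wp : p = 0) :
    (v+q ^ 2 * t+r ^ 3+r) = 0 := by
  have kwa : ev [a, b, v, z, p, q, r, t] [1] = 0 := by
    simp [ev, mon, wa]
  have kwp : ev [a, b, v, z, p, q, r, t] [16777216] = 0 := by
    simp [ev, mon, wp]
  have key := E.sound [a, b, v, z, p, q, r, t]
    (.add (.add (.poly [4096, 68719476736, 206158430208, 4400193994752]) (.add (.mul (.poly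
    [0]) (.poly (F1L 1 2))) (.mul (.poly [1073741824]) (.poly (F1L 3 2))))) (.add (.add (.mul
    (.poly [4096, 68719476736]) (.poly (F2L 1 1))) (.mul (.poly [64]) (.poly (F1L 2 3)))) (.add
    (.mul (.poly [64, 66, 192, 4097, 4225, 524352, 16781312, 1073741824, 2147483712,
    2164264960, 68719480896, 68719480898, 68719484931, 68736253952, 68736258113, 68736262144,
    68736516161, 68753035328, 68753039361, 68753293376, 69793222658, 69809999873, 137438953536,
    137438953538, 137438957569, 137438957571, 137455730753, 137455734784, 137472512001,
    138512695298, 138529472513, 206158430209, 206175207424, 4398046515264, 4398046519297,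
    4398063296512, 4399120257024, 4400210771968, 4466765987904, 4466765991937, 4466782769152])
    (.poly [1])) (.mul (.poly [64, 266304, 16781312, 16789504, 17039360, 33554496, 1073741952,
    1107296256, 2147483712, 2164264960, 3221225472, 68719738944, 68736253952, 68736262144,
    68736520192, 69793222656, 69809995840, 137438953536, 137455992832, 4398063288320,
    4399120515072, 4399137030208, 4466765987904, 4467839729664, 8797166764032]) (.poly
    [16777216])))))
    8 rfl (by decide +kernel)
  simp only [E.den, ev_F1 _ _ _ _ _ _ _ _ h, ev_F2 _ _ _ _ _ _ _ _ h, kwa, kwp, mul_zero, add_zero] at key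
  simp only [ev, mon, Nat.reduceMod, Nat.reduceDiv] at key
  linear_combination key

set_option maxRecDepth 100000 in
theorem c3_2 [CharP D 2] {a b v z p q r t : D} (h : form1 a b v z p q r t = 0) (wa : a = 0) (wp : p = 0) :
    (z+t ^ 3+q ^ 2 * r+t) = 0 := by
  have kwa : ev [a, b, v, z, p, q, r, t] [1] = 0 := by
    simp [ev, mon, wa]
  have kwp : ev [a, b, v, z, p, q, r, t] [16777216] = 0 := by
    simp [ev, mon, wp]
  have key := E.sound [a, b, v, z, p, q, r, t]
    (.add (.add (.add (.poly [262144, 70866960384, 4398046511104, 13194139533312]) (.mul (.poly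
    [0]) (.poly (F1L 0 3)))) (.add (.mul (.poly [262144]) (.poly (F1L 3 3))) (.add (.mul (.poly
    [0]) (.poly (F2L 2 1))) (.mul (.poly [64, 1073741824]) (.poly (F1L 3 2)))))) (.add (.add
    (.mul (.poly [68719476736]) (.poly (F2L 1 1))) (.add (.mul (.poly [0]) (.poly (F2L 3 0)))
    (.mul (.poly [0]) (.poly (F1L 3 0))))) (.add (.mul (.poly [0]) (.poly (F1L 2 1))) (.add
    (.mul (.poly [8256, 266304, 33554496, 1073750016, 1090523200, 1107296256, 3221225472,
    68719476737, 68719476739, 68736253952, 68736254080, 68736520192, 68753031169, 69793218625,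
    69793222658, 69793480704, 69809999873, 69826777088, 137438953538, 137438957569,
    137438957571, 137455730753, 137455992832, 137489289216, 138512695296, 138512695298,
    206158430209, 4398046515264, 4398063288320, 4399120257024, 4399120515072, 4399137030208,
    4400210771968, 4466765987904, 4466765991937, 4466766249985, 4466782765121, 4466799542336,
    4467839729664, 4467839729666, 4467856506881, 4535485464577, 4535502241792, 8797166764032,
    8864812498945, 8864829276160]) (.poly [1])) (.mul (.poly [16781312, 17039360, 33554496,
    1073741824, 1073741952, 1073750016, 1107296256, 2147483712, 2164264960, 3221225472,
    68719480896, 68719738944, 68736253952, 68736254080, 68736520192, 68753035328, 69809995840,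
    137438953536, 137455734784, 137455992832, 137472507968, 138512695296, 206175207424,
    4398046515264, 4398063288448, 4399120257024, 4399120515072, 4399137030208, 4466765987904,
    4466783027200, 4535502241792, 8797166764032]) (.poly [16777216]))))))
    8 rfl (by decide +kernel)
  simp only [E.den, ev_F1 _ _ _ _ _ _ _ _ h, ev_F2 _ _ _ _ _ _ _ _ h, kwa, kwp, mul_zero, add_zero] at key
  simp only [ev, mon, Nat.reduceMod, Nat.reduceDiv] at key
  linear_combination key

set_option maxRecDepth 100000 in
theorem c3_3 [CharP D 2] {a b v z p q r t : D} (h : form1 a b v z p q r t = 0) (wa : a = 0) (wp : p = 0) :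
    (b ^ 2+b * q+q ^ 2+v ^ 2+v * r+r ^ 2) = 0 := by
  have kwa : ev [a, b, v, z, p, q, r, t] [1] = 0 := by
    simp [ev, mon, wa]
  have kwp : ev [a, b, v, z, p, q, r, t] [16777216] = 0 := by
    simp [ev, mon, wp]
  have key := E.sound [a, b, v, z, p, q, r, t]
    (.add (.add (.poly [128, 8192, 1073741888, 2147483648, 68719480832, 137438953472]) (.mul
    (.poly [0]) (.poly (F2L 1 1)))) (.add (.mul (.poly [4160, 68719476800, 68719476802,
    68719480835, 68736254017, 68753035265, 69793218562, 69809995777, 137438953473,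
    137455730688, 4398046511168, 4398046515201, 4398063292416, 4399120252928]) (.poly [1]))
    (.mul (.poly [262208, 16785408, 68719476800, 68736516096]) (.poly [16777216]))))
    8 rfl (by decide +kernel)
  simp only [E.den, ev_F1 _ _ _ _ _ _ _ _ h, ev_F2 _ _ _ _ _ _ _ _ h, kwa, kwp, mul_zero, add_zero] at key
  simp only [ev, mon, Nat.reduceMod, Nat.reduceDiv] at key
  linear_combination key

set_option maxRecDepth 100000 in
theorem c3_4 [CharP D 2] {a b v z p q r t : D} (h : form1 a b v z p q r t = 0) (wa : a = 0) (wp : p = 0) :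
    (z ^ 2+z * t+t ^ 2+v ^ 2+v * r+r ^ 2) = 0 := by
  have kwa : ev [a, b, v, z, p, q, r, t] [1] = 0 := by
    simp [ev, mon, wa]
  have kwp : ev [a, b, v, z, p, q, r, t] [16777216] = 0 := by
    simp [ev, mon, wp]
  have key := E.sound [a, b, v, z, p, q, r, t]
    (.add (.add (.poly [8192, 524288, 68719480832, 137438953472, 4398046773248, 8796093022208])
    (.mul (.poly [0]) (.poly (F1L 3 3)))) (.add (.mul (.poly [0]) (.poly (F2L 1 1))) (.add
    (.mul (.poly [1, 16777216, 1073745920, 68719476800, 68719476802, 68719480835, 68736254017,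
    68736258048, 68736516096, 68753035265, 69793218562, 69809995777, 137438953473,
    137455730688, 4398046511168, 4398046515201, 4398063292416]) (.poly [1])) (.mul (.poly
    [262208, 16777216, 16785408, 1073745920, 4398046511168]) (.poly [16777216])))))
    8 rfl (by decide +kernel)
  simp only [E.den, ev_F1 _ _ _ _ _ _ _ _ h, ev_F2 _ _ _ _ _ _ _ _ h, kwa, kwp, mul_zero, add_zero] at key
  simp only [ev, mon, Nat.reduceMod, Nat.reduceDiv] at key
  linear_combination key

set_option maxRecDepth 100000 in
theorem c4_1 [CharP D 2] {a b v z p q r t : D} (h : form1 a b v z p q r t = 0) (wv : v = 0) (wr : r = 0) :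
    (q ^ 4+b ^ 2+p ^ 4+a ^ 2) = 0 := by
  have kwv : ev [a, b, v, z, p, q, r, t] [4096] = 0 := by
    simp [ev, mon, wv]
  have kwr : ev [a, b, v, z, p, q, r, t] [68719476736] = 0 := by
    simp [ev, mon, wr]
  have key := E.sound [a, b, v, z, p, q, r, t]
    (.add (.add (.add (.poly [2, 128, 67108864, 4294967296]) (.add (.mul (.poly [16777216])
    (.poly (F2L 3 2))) (.mul (.poly [16777217]) (.poly (F2L 2 2))))) (.add (.add (.mul (.poly
    [33554432, 2147483648]) (.poly (F1L 3 3))) (.mul (.poly [262144, 16777280]) (.poly (F2L 2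
    1)))) (.add (.mul (.poly [4398046511104]) (.poly (F1L 1 2))) (.mul (.poly [1073741824])
    (.poly (F2L 3 1)))))) (.add (.add (.mul (.poly [1073741888]) (.poly (F2L 1 1))) (.add (.mul
    (.poly [64, 1073741824]) (.poly (F2L 2 0))) (.mul (.poly [1, 16777216]) (.poly (F2L 1
    0))))) (.add (.add (.mul (.poly [262144, 1073741825]) (.poly (F2L 1 2))) (.mul (.poly
    [4398046511104]) (.poly (F1L 2 1)))) (.add (.mul (.poly [4098, 16777280, 16777282,
    17039361, 33554497, 33824768, 50331712, 50335745, 1073741825, 1073741827, 1073745984,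
    1074004032, 1090519042, 1090519168, 1107296257, 1107300416, 1107304449, 1124073472,
    2147483713, 2147487744, 2147745792, 3238002688, 68719476738, 68719476740, 68719476864,
    68719480897, 68719742980, 68736253953, 68736253957, 68736254081, 68736258112, 68736516162,
    68736520193, 68753031170, 68753293377, 68753297410, 68769808385, 68769808387, 69793218628,
    69793222661, 69793480705, 69793480707, 69809995841, 69809995843, 69809999872, 69809999874,
    69810257922, 69826777091, 70866960388, 70883737603, 137439215616, 137439215618,
    137455730752, 137455730754, 138512695297, 138512695299, 138529472512, 4398046511106,
    4398046519296, 4398046773313, 4398046777346, 4398063288321, 4398063288323, 4398063550528,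
    4398063554561, 4398080065536, 4398080065538, 4399120252992, 4399120252994, 4399120257027,
    4399120515073, 4399137034242, 4399137292288, 4399153807424, 4400193994754, 4400210771969,
    4466782765120, 4466782765122, 4466799542337, 4466799546368, 4466799804416, 4466816319552,
    4467839729665, 4467873284097, 4535485464576, 4535485464578, 4535502241793, 8797183541248,
    8864846053376]) (.poly [4096])) (.mul (.poly [262144, 262148, 262274, 16777282, 16777408,
    17039361, 17039489, 50331712, 50593793, 1073741825, 1073741827, 1073741953, 1074004034,
    1090519040, 1090519168, 1091043328, 1107558464, 2147483713, 2164260928, 68719476738,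
    68719738945, 68736254081, 68753031168, 69793218624, 69809995841, 4398046511104,
    4398046511106, 4398063288321, 4398063288323, 4398063288449, 4398080065538, 4398080065664,
    4399120515073, 4399137030209, 4399153807424, 4400193994754, 4400210771969, 4466765987905,
    4466782765120, 4466783027201, 4466799542337, 4467856506882, 4535485464576, 4535502241793,
    4535519019008, 8797166764033, 8797183541248, 8864829276161]) (.poly [68719476736]))))))
    8 rfl (by decide +kernel)
  simp only [E.den, ev_F1 _ _ _ _ _ _ _ _ h, ev_F2 _ _ _ _ _ _ _ _ h, kwv, kwr, mul_zero, add_zero] at key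
  simp only [ev, mon, Nat.reduceMod, Nat.reduceDiv] at key
  linear_combination key

set_option maxRecDepth 100000 in
theorem c4_2 [CharP D 2] {a b v z p q r t : D} (h : form1 a b v z p q r t = 0) (wv : v = 0) (wr : r = 0) :
    (b ^ 2 * q ^ 2+b ^ 2+a ^ 2 * p ^ 2+q ^ 2+a ^ 2+p ^ 2) = 0 := by
  have kwv : ev [a, b, v, z, p, q, r, t] [4096] = 0 := by
    simp [ev, mon, wv]
  have kwr : ev [a, b, v, z, p, q, r, t] [68719476736] = 0 := by
    simp [ev, mon, wr]
  have key := E.sound [a, b, v, z, p, q, r, t]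
    (.add (.add (.add (.poly [2, 128, 33554432, 33554434, 2147483648, 2147483776]) (.mul (.poly
    [1, 16777216]) (.poly (F2L 3 2)))) (.add (.mul (.poly [0]) (.poly (F2L 2 2))) (.add (.mul
    (.poly [262144]) (.poly (F2L 2 1))) (.mul (.poly [64, 1073741824]) (.poly (F2L 3 1))))))
    (.add (.add (.mul (.poly [0]) (.poly (F2L 1 1))) (.add (.mul (.poly [64]) (.poly (F2L 2
    0))) (.mul (.poly [1]) (.poly (F2L 1 0))))) (.add (.mul (.poly [262144]) (.poly (F2L 1 2)))
    (.add (.mul (.poly [65, 4096, 4098, 16777282, 33558528, 33824768, 1073741825, 1073741827,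
    1073745984, 1074004032, 1090519040, 1090519042, 2147483713, 2147487744, 2147745792,
    68719476736, 68719476738, 68719476864, 68719480897, 68719742980, 68736253953, 68736254081,
    68736258112, 68736516162, 68736520193, 68753031168, 68753293377, 68753297410, 69793480707,
    69809999872, 69810257922, 70883737601, 137439215616, 137439215618, 137455730752,
    137455730754, 138546249729, 4398046511232, 4398046777346, 4398063550528, 4398063554561,
    4399120252992, 4399120515073]) (.poly [4096])) (.mul (.poly [262144, 262148, 262274,
    16777408, 17039361, 17039489, 33816576, 50593793, 1073741827, 1074004032, 1074004034,
    1090519042, 1090519168, 1091043328, 1107296257, 1107558464, 2164260928, 68719476736,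
    68719738945, 68736254081, 69826773056, 4398063550528, 4399137292288]) (.poly
    [68719476736]))))))
    8 rfl (by decide +kernel)
  simp only [E.den, ev_F1 _ _ _ _ _ _ _ _ h, ev_F2 _ _ _ _ _ _ _ _ h, kwv, kwr, mul_zero, add_zero] at key
  simp only [ev, mon, Nat.reduceMod, Nat.reduceDiv] at key
  linear_combination key

set_option maxRecDepth 100000 in
theorem c4_3 [CharP D 2] {a b v z p q r t : D} (h : form1 a b v z p q r t = 0) (wv : v = 0) (wr : r = 0) :
    (t+z ^ 3+z+a * q+b * p) = 0 := by
  have kwv : ev [a, b, v, z, p, q, r, t] [4096] = 0 := by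
    simp [ev, mon, wv]
  have kwr : ev [a, b, v, z, p, q, r, t] [68719476736] = 0 := by
    simp [ev, mon, wr]
  have key := E.sound [a, b, v, z, p, q, r, t]
    (.add (.add (.poly [262144, 786432, 16777280, 1073741825, 4398046511104]) (.mul (.poly [0])
    (.poly (F1L 0 3)))) (.add (.mul (.poly [2, 128, 4161, 68736516097]) (.poly [4096])) (.mul
    (.poly [17301505, 34078720]) (.poly [68719476736]))))
    8 rfl (by decide +kernel)
  simp only [E.den, ev_F1 _ _ _ _ _ _ _ _ h, ev_F2 _ _ _ _ _ _ _ _ h, kwv, kwr, mul_zero, add_zero] at key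
  simp only [ev, mon, Nat.reduceMod, Nat.reduceDiv] at key
  linear_combination key

set_option maxRecDepth 100000 in
theorem c4_4 [CharP D 2] {a b v z p q r t : D} (h : form1 a b v z p q r t = 0) (wv : v = 0) (wr : r = 0) :
    (z ^ 2+z * t+t ^ 2+b * p * t+a * q * t+b ^ 2+b * q+q ^ 2+a ^ 2+a * p+p ^ 2) = 0 := by
  have kwv : ev [a, b, v, z, p, q, r, t] [4096] = 0 := by
    simp [ev, mon, wv]
  have kwr : ev [a, b, v, z, p, q, r, t] [68719476736] = 0 := by
    simp [ev, mon, wr]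
  have key := E.sound [a, b, v, z, p, q, r, t]
    (.add (.add (.poly [2, 128, 524288, 16777217, 33554432, 1073741888, 2147483648,
    4398046773248, 4398063288384, 4399120252929, 8796093022208]) (.mul (.poly [0]) (.poly (F1L
    3 3)))) (.add (.mul (.poly [65, 1073741825, 1090519040, 68736253953]) (.poly [4096])) (.mul
    (.poly [16777280, 17039361, 33816576]) (.poly [68719476736]))))
    8 rfl (by decide +kernel)
  simp only [E.den, ev_F1 _ _ _ _ _ _ _ _ h, ev_F2 _ _ _ _ _ _ _ _ h, kwv, kwr, mul_zero, add_zero] at key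
  simp only [ev, mon, Nat.reduceMod, Nat.reduceDiv] at key
  linear_combination key

set_option maxRecDepth 100000 in
theorem c5_F [CharP D 2] {a b v z p q r t : D} (h : form1 a b v z p q r t = 0) :
    a ^ 1 * v ^ 1 * (a * b * p + a ^ 2 * q + a * t + v * p + a * r + p * r) = 0 := by
  have key := E.sound [a, b, v, z, p, q, r, t]
    (.add (.add (.add (.add (.poly [16781378, 16785409, 1073745923, 68719480834, 68736258049,
    4398046515202]) (.add (.mul (.poly [2, 128, 8192, 262209, 266240, 266242, 16777345,
    16781378, 16785409, 17039424, 17043457, 33554560, 33558593, 33562624, 1073741888,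
    1073741890, 1073745921, 1073745923, 1090519105, 1090523136, 1090523138, 2147483648,
    68719476801, 68736254016, 68736254018, 68736258051, 68736516097, 68753035264, 68753293312,
    68769808448, 68769812481, 69793218561, 69809995776, 137438953476, 137455730691,
    137472507906, 137489285121, 4398046511169, 4398046515202, 4398080069632, 8796093022208])
    (.poly (F2L 3 3))) (.mul (.poly [16777280, 68753031168]) (.poly (F1L 0 3))))) (.add (.mul
    (.poly [1, 4160, 262208, 266241, 16781377, 17043456, 33558592, 1073741889, 1073745922,
    1074003968, 1090523137, 68719480833, 68719480835, 68736258048, 68736516096, 68753035265,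
    69826772992, 137438953473, 137438953475, 137472507905, 4398046511168, 4466765987841])
    (.poly (F2L 3 2))) (.add (.mul (.poly [0, 128, 4161, 8192, 266240, 16777217, 16781376,
    16785409, 33562624, 68719476801, 68719480832, 68719480834, 68736258049, 69793218561,
    137438953474, 137455730689, 137472507904, 4398046515200, 4398046773248]) (.poly (F2L 2 2)))
    (.mul (.poly [4161, 16777217, 16781376, 16785409, 17039424, 33554432, 33562624,
    68719476801, 68719480834, 68753293312, 137438953472, 137455730689, 137472507904,
    4398046515200]) (.poly (F1L 3 3)))))) (.add (.add (.mul (.poly [65, 4098, 16777280,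
    33558528, 1073741825, 1090519040, 68736253953]) (.poly (F2L 2 1))) (.add (.mul (.poly
    [4160, 262208, 266241, 16777216, 16777344, 16781377, 1073741889, 1073745920, 1073745922,
    68719476800, 68719480833, 68736254017, 68736258050, 68736516096, 68753031232, 68753035265,
    137438953473, 137438953475, 137455730688, 137472507905, 4398046515201, 4466782765056])
    (.poly (F2L 2 3))) (.mul (.poly [65, 4096, 68719476738]) (.poly (F1L 1 2))))) (.add (.mul
    (.poly [16777281, 16781312, 68736253952]) (.poly (F2L 3 1))) (.add (.mul (.poly [4097,
    68719476737]) (.poly (F1L 0 2))) (.mul (.poly [1, 4160, 8193, 16785408, 68736258048,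
    137438953473, 137455730688]) (.poly (F1L 3 2))))))) (.add (.add (.add (.mul (.poly [0, 2,
    128, 8192, 8194, 16781376, 33554432, 33562624, 1073745921, 68719476801, 68736258049,
    68753035264]) (.poly (F2L 1 1))) (.add (.mul (.poly [16781312, 1073741824, 68719476737,
    68736253952]) (.poly (F2L 2 0))) (.mul (.poly [4097, 68719476737]) (.poly (F1L 1 3)))))
    (.add (.mul (.poly [1, 4160]) (.poly (F1L 2 3))) (.add (.mul (.poly [1, 4160, 8193,
    16777216, 16785408]) (.poly (F1L 0 1))) (.mul (.poly [0, 128, 4161, 266240, 16781376,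
    16785409, 33562624, 1073741888, 1073745921, 2147483648, 68719476801, 68719480834,
    68719738880, 68736254016, 68736258049, 68753035264, 69809995776, 137438953472,
    4398046515200, 4466765987840]) (.poly (F1L 2 2)))))) (.add (.add (.mul (.poly [4161, 8194,
    16785409, 33554432, 33562624, 1073745921, 1090523136, 2147483648, 68719480834, 68736254016,
    68736258049, 68753035264, 69793218561, 137438953472, 137455730689, 137472507904,
    4398046515200]) (.poly (F1L 0 0))) (.add (.mul (.poly [16785408, 69793218560]) (.poly (F2L
    1 0))) (.mul (.poly [4096, 4098, 16777280, 16781313, 68736253953]) (.poly (F2L 1 2)))))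
    (.add (.mul (.poly [266240, 1073741888, 2147483648, 68719480834, 68719738880, 68736254016,
    68736258049, 69809995776, 137438953472, 4398046515200, 4466765987840]) (.poly (F1L 1 1)))
    (.add (.mul (.poly [1073741824]) (.poly (F1L 3 1))) (.mul (.poly [16781313, 33558528,
    68719476738, 68753031168]) (.poly (F1L 2 1))))))))
    8 rfl (by decide +kernel)
  simp only [E.den, ev_F1 _ _ _ _ _ _ _ _ h, ev_F2 _ _ _ _ _ _ _ _ h, mul_zero, add_zero] at key
  simp only [ev, mon, Nat.reduceMod, Nat.reduceDiv] at key
  linear_combination key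

set_option maxRecDepth 100000 in
theorem c5_P [CharP D 2] {a b v z p q r t : D} (h : form1 a b v z p q r t = 0) :
    (a * v * q + a ^ 2 * z * r+a * z * r * p + b * v * p + a * b * r+b * p * r+a * v * p * r) =
    0 := by
  have key := E.sound [a, b, v, z, p, q, r, t]
    (.add (.poly [16781376, 1073745921, 68719476801, 68719738882, 68736254016, 68736258049,
    68736516097]) (.mul (.poly [0]) (.poly (F2L 3 3))))
    8 rfl (by decide +kernel)
  simp only [E.den, ev_F1 _ _ _ _ _ _ _ _ h, ev_F2 _ _ _ _ _ _ _ _ h, mul_zero, add_zero] at key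
  simp only [ev, mon, Nat.reduceMod, Nat.reduceDiv] at key
  linear_combination key

set_option maxRecDepth 100000 in
theorem c5_Z [CharP D 2] {a b v z p q r t : D} (h : form1 a b v z p q r t = 0)
    (hF : a * b * p + a ^ 2 * q + a * t + v * p + a * r + p * r = 0)
    (hP : a * v * q + a ^ 2 * z * r+a * z * r * p + b * v * p + a * b * r+b * p * r+a * v * p *
    r = 0) :
    (a ^ 2 * v * z ^ 2 + a ^ 2 * v ^ 3 + p ^ 2 * r + v * p ^ 2 + a ^ 2 * r) = 0 := by
  have khF : ev [a, b, v, z, p, q, r, t] [16777281, 16781312, 1073741826, 68719476737, 68736253952, 4398046511105] = 0 := by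
    simp only [ev, mon, Nat.reduceMod, Nat.reduceDiv]
    linear_combination hF
  have khP : ev [a, b, v, z, p, q, r, t] [16781376, 1073745921, 68719476801, 68719738882, 68736254016, 68736258049, 68736516097] = 0 := by
    simp only [ev, mon, Nat.reduceMod, Nat.reduceDiv]
    linear_combination hP
  have key := E.sound [a, b, v, z, p, q, r, t]
    (.add (.add (.add (.add (.poly [12290, 528386, 33558528, 68719476738, 68753031168]) (.mul
    (.poly [4160, 262208, 16777216, 50331648, 1073745920, 1074003968, 1107300352, 2164260864,
    68719476802, 68719480833, 68719480835, 68719738881, 68736516096, 68753031232, 68753035265,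
    69793218560, 69809995777, 137438953473, 137438953475, 137455730690, 4398046515201,
    4399120252928, 4466765987841, 4466765987843, 4466799542273, 8796093022209]) (.poly
    [16777281, 16781312, 1073741826, 68719476737, 68736253952, 4398046511105]))) (.add (.mul
    (.poly [262146, 16777280, 16781313, 17039361, 1090519040, 68719476740, 68753031170,
    4398046511106]) (.poly [16781376, 1073745921, 68719476801, 68719738882, 68736254016,
    68736258049, 68736516097])) (.add (.mul (.poly [65, 4096, 1073741825, 68753031168,
    4398046511104, 4398080065536]) (.poly (F2L 3 3))) (.mul (.poly [64, 262145, 16781312,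
    68719476737, 68719476739, 68736253954, 4398046511105]) (.poly (F2L 3 2)))))) (.add (.add
    (.mul (.poly [65, 4096, 16777280, 16781313, 1073741825, 1090519040, 68719476736,
    68736253953, 68753031168]) (.poly (F2L 2 2))) (.mul (.poly [16777280, 33558528, 1073741825,
    1090519040, 68719476740, 68736253953, 68753031168, 68753031170, 4398046511106]) (.poly (F1L
    3 3)))) (.add (.mul (.poly [2, 16777217]) (.poly (F2L 2 1))) (.add (.mul (.poly [4097,
    16781312, 68719476737, 68719476739, 68736253952, 68753031169]) (.poly (F2L 2 3))) (.mul
    (.poly [0, 16777217]) (.poly (F1L 1 2))))))) (.add (.add (.add (.mul (.poly [1, 16777216])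
    (.poly (F1L 0 2))) (.mul (.poly [64, 4097, 16781312, 1073741824, 68736253952]) (.poly (F1L
    3 2)))) (.add (.mul (.poly [16781313, 33558528, 1073741825, 68719476736, 68719476738,
    68753031168]) (.poly (F2L 1 1))) (.add (.mul (.poly [1]) (.poly (F2L 2 0))) (.mul (.poly
    [1]) (.poly (F1L 1 3)))))) (.add (.add (.mul (.poly [4097]) (.poly (F1L 0 1))) (.add (.mul
    (.poly [4096, 262144, 68719476736, 68719476738, 68736253953]) (.poly (F1L 2 2))) (.mul
    (.poly [1073741824]) (.poly (F2L 1 0))))) (.add (.mul (.poly [0, 33554432]) (.poly (F2L 1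
    2))) (.add (.mul (.poly [262144, 68736253953]) (.poly (F1L 1 1))) (.mul (.poly [16777217])
    (.poly (F1L 2 1))))))))
    8 rfl (by decide +kernel)
  simp only [E.den, ev_F1 _ _ _ _ _ _ _ _ h, ev_F2 _ _ _ _ _ _ _ _ h, khF, khP, mul_zero, add_zero] at key
  simp only [ev, mon, Nat.reduceMod, Nat.reduceDiv] at key
  linear_combination key

set_option maxRecDepth 100000 in
theorem c5_B [CharP D 2] {a b v z p q r t : D} (h : form1 a b v z p q r t = 0)
    (hF : a * b * p + a ^ 2 * q + a * t + v * p + a * r + p * r = 0)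
    (hP : a * v * q + a ^ 2 * z * r+a * z * r * p + b * v * p + a * b * r+b * p * r+a * v * p *
    r = 0)
    (hZ : a ^ 2 * v * z ^ 2 + a ^ 2 * v ^ 3 + p ^ 2 * r + v * p ^ 2 + a ^ 2 * r = 0) :
    a ^ 1 * (a * v * b ^ 2 + a ^ 2 * v ^ 2 * b+a * v ^ 2 * z+a ^ 3 * v+p * v+a * r+p * r) = 0
    := by
  have khF : ev [a, b, v, z, p, q, r, t] [16777281, 16781312, 1073741826, 68719476737, 68736253952, 4398046511105] = 0 := by
    simp only [ev, mon, Nat.reduceMod, Nat.reduceDiv]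
    linear_combination hF
  have khP : ev [a, b, v, z, p, q, r, t] [16781376, 1073745921, 68719476801, 68719738882, 68736254016, 68736258049, 68736516097] = 0 := by
    simp only [ev, mon, Nat.reduceMod, Nat.reduceDiv]
    linear_combination hP
  have khZ : ev [a, b, v, z, p, q, r, t] [12290, 528386, 33558528, 68719476738, 68753031168] = 0 := by
    simp only [ev, mon, Nat.reduceMod, Nat.reduceDiv]
    linear_combination hZ
  have key := E.sound [a, b, v, z, p, q, r, t]
    (.add (.add (.add (.add (.poly [4100, 4226, 8259, 270338, 16781313, 68719476738,
    68736253953]) (.mul (.poly [1, 4160, 8193, 262208, 266241, 16777216, 16785408, 33558592,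
    1073745920, 1074003968, 1090519104, 1090523137, 2147483649, 68719480833, 68719480835,
    68736254017, 68736258048, 68736516098, 68753035265, 68753293313, 68769812480, 69793218560,
    69793218562, 69809995777, 69826772992, 137438953473, 137438953475, 137489285120,
    4398046515201, 4398046773249, 4398063292416, 4399120252928, 4466765987843, 4466782765056,
    4466799542273, 8796093022209]) (.poly [16777281, 16781312, 1073741826, 68719476737,
    68736253952, 4398046511105]))) (.add (.mul (.poly [65, 262146, 16781313, 33554497,
    33558528, 1073741825, 1090519042, 68719476738, 68736253953, 4398080065536]) (.poly
    [16781376, 1073745921, 68719476801, 68719738882, 68736254016, 68736258049, 68736516097]))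
    (.add (.mul (.poly [0]) (.poly [12290, 528386, 33558528, 68719476738, 68753031168])) (.mul
    (.poly [17039361, 68719476736, 68736253955, 68753031168, 68769808385]) (.poly (F2L 3
    3)))))) (.add (.add (.mul (.poly [2]) (.poly (F1L 0 3))) (.add (.mul (.poly [4097,
    68719476737, 68719476739, 68736253952, 68769808384, 4398046511105]) (.poly (F2L 3 2)))
    (.mul (.poly [65, 4098, 16781313, 33558528, 1073741825, 68719476736, 68736253953,
    68753031168]) (.poly (F2L 2 2))))) (.add (.mul (.poly [262146, 16781313, 1073741825,
    1090519040, 68719476738, 68719476740, 68736253953, 68753031168, 68753031170,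
    4398046511106]) (.poly (F1L 3 3))) (.add (.mul (.poly [0, 2, 16777217]) (.poly (F2L 2 1)))
    (.mul (.poly [64, 16781312, 68719476737]) (.poly (F2L 2 3))))))) (.add (.add (.add (.mul
    (.poly [16777216]) (.poly (F2L 3 1))) (.mul (.poly [1, 16777216]) (.poly (F1L 0 2)))) (.add
    (.mul (.poly [4097, 1073741824, 68719476737, 68736253952]) (.poly (F1L 3 2))) (.add (.mul
    (.poly [65, 33558528, 1073741825, 68719476738, 68753031168]) (.poly (F2L 1 1))) (.mul
    (.poly [1, 16777216]) (.poly (F1L 1 3)))))) (.add (.add (.mul (.poly [4097, 1073741824,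
    68719476737]) (.poly (F1L 2 3))) (.add (.mul (.poly [65, 4098, 262144, 33558528,
    1090519040, 68719476738, 68736253953]) (.poly (F1L 2 2))) (.mul (.poly [16781312,
    1073741824]) (.poly (F2L 1 0))))) (.add (.mul (.poly [2, 16777217]) (.poly (F2L 1 2)))
    (.add (.mul (.poly [262144, 1090519040, 68719476736, 68753031168]) (.poly (F1L 1 1))) (.mul
    (.poly [0, 2]) (.poly (F1L 2 1))))))))
    8 rfl (by decide +kernel)
  simp only [E.den, ev_F1 _ _ _ _ _ _ _ _ h, ev_F2 _ _ _ _ _ _ _ _ h, khF, khP, khZ, mul_zero, add_zero] at key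
  simp only [ev, mon, Nat.reduceMod, Nat.reduceDiv] at key
  linear_combination key

set_option maxRecDepth 100000 in
theorem c6_1 [CharP D 2] {a b v z p q r t : D} (h : form1 a b v z p q r t = 0) (wp : p = 0)
    (hF : a * b * p + a ^ 2 * q + a * t + v * p + a * r + p * r = 0)
    (hP : a * v * q + a ^ 2 * z * r+a * z * r * p + b * v * p + a * b * r+b * p * r+a * v * p *
    r = 0)
    (hZ : a ^ 2 * v * z ^ 2 + a ^ 2 * v ^ 3 + p ^ 2 * r + v * p ^ 2 + a ^ 2 * r = 0)
    (hB : a * v * b ^ 2 + a ^ 2 * v ^ 2 * b+a * v ^ 2 * z+a ^ 3 * v+p * v+a * r+p * r = 0) :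
    a ^ 1 * v ^ 1 * (a ^ 2+1) = 0 := by
  have khF : ev [a, b, v, z, p, q, r, t] [16777281, 16781312, 1073741826, 68719476737, 68736253952, 4398046511105] = 0 := by
    simp only [ev, mon, Nat.reduceMod, Nat.reduceDiv]
    linear_combination hF
  have khP : ev [a, b, v, z, p, q, r, t] [16781376, 1073745921, 68719476801, 68719738882, 68736254016, 68736258049, 68736516097] = 0 := by
    simp only [ev, mon, Nat.reduceMod, Nat.reduceDiv]
    linear_combination hP
  have khZ : ev [a, b, v, z, p, q, r, t] [12290, 528386, 33558528, 68719476738, 68753031168] = 0 := by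
    simp only [ev, mon, Nat.reduceMod, Nat.reduceDiv]
    linear_combination hZ
  have khB : ev [a, b, v, z, p, q, r, t] [4099, 4225, 8258, 270337, 16781312, 68719476737, 68736253952] = 0 := by
    simp only [ev, mon, Nat.reduceMod, Nat.reduceDiv]
    linear_combination hB
  have kwp : ev [a, b, v, z, p, q, r, t] [16777216] = 0 := by
    simp [ev, mon, wp]
  have key := E.sound [a, b, v, z, p, q, r, t]
    (.add (.add (.add (.poly [4097, 4099]) (.add (.mul (.poly [8192, 266240, 1073745921,
    68719480832, 68719480834, 68719738880, 4398046515202]) (.poly [16777281, 16781312,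
    1073741826, 68719476737, 68736253952, 4398046511105])) (.mul (.poly [4099]) (.poly
    [16781376, 1073745921, 68719476801, 68719738882, 68736254016, 68736258049, 68736516097]))))
    (.add (.mul (.poly [1]) (.poly [12290, 528386, 33558528, 68719476738, 68753031168])) (.add
    (.mul (.poly [0, 2]) (.poly [4099, 4225, 8258, 270337, 16781312, 68719476737,
    68736253952])) (.mul (.poly [1073741824, 68719476737]) (.poly (F2L 3 3)))))) (.add (.add
    (.mul (.poly [4097]) (.poly (F2L 2 2))) (.add (.mul (.poly [4099]) (.poly (F1L 3 3))) (.mul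
    (.poly [4096, 4098, 68719476736]) (.poly (F2L 2 3))))) (.add (.add (.mul (.poly [4096])
    (.poly (F1L 3 2))) (.mul (.poly [4097]) (.poly (F1L 2 2)))) (.add (.mul (.poly [4096,
    4098]) (.poly (F2L 1 0))) (.mul (.poly [4100, 4224, 4226, 8259, 12290, 266305, 270338,
    528384, 528386, 16781313, 16785472, 16785474, 16789505, 33558528, 1073745984, 1073750017,
    1073750019, 1074008065, 1090523201, 1090527232, 2147487744, 2147487746, 68719480897,
    68719480899, 68719484930, 68719484932, 68719738945, 68719742978, 68736262145, 68736262147,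
    68736520193, 68736520195, 68753035329, 68753297408, 68753297410, 69793222659, 69793480705,
    69809999874, 137439215618, 137455734785, 137455992833, 4398046515265, 4398046519296,
    4398046519298, 4398046777346, 4398063292480, 4466765991936, 4466765991938, 4466766249984,
    4466782769153, 8796093026304]) (.poly [16777216]))))))
    8 rfl (by decide +kernel)
  simp only [E.den, ev_F1 _ _ _ _ _ _ _ _ h, ev_F2 _ _ _ _ _ _ _ _ h, khF, khP, khZ, khB, kwp, mul_zero, add_zero] at key
  simp only [ev, mon, Nat.reduceMod, Nat.reduceDiv] at key
  linear_combination key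

set_option maxRecDepth 100000 in
theorem c6_2 [CharP D 2] {a b v z p q r t : D} (h : form1 a b v z p q r t = 0) (wp : p = 0)
    (hF : a * b * p + a ^ 2 * q + a * t + v * p + a * r + p * r = 0)
    (hP : a * v * q + a ^ 2 * z * r+a * z * r * p + b * v * p + a * b * r+b * p * r+a * v * p *
    r = 0)
    (hB : a * v * b ^ 2 + a ^ 2 * v ^ 2 * b+a * v ^ 2 * z+a ^ 3 * v+p * v+a * r+p * r = 0) :
    a ^ 1 * v ^ 1 * (v+r) = 0 := by
  have khF : ev [a, b, v, z, p, q, r, t] [16777281, 16781312, 1073741826, 68719476737, 68736253952, 4398046511105] = 0 := by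
    simp only [ev, mon, Nat.reduceMod, Nat.reduceDiv]
    linear_combination hF
  have khP : ev [a, b, v, z, p, q, r, t] [16781376, 1073745921, 68719476801, 68719738882, 68736254016, 68736258049, 68736516097] = 0 := by
    simp only [ev, mon, Nat.reduceMod, Nat.reduceDiv]
    linear_combination hP
  have khB : ev [a, b, v, z, p, q, r, t] [4099, 4225, 8258, 270337, 16781312, 68719476737, 68736253952] = 0 := by
    simp only [ev, mon, Nat.reduceMod, Nat.reduceDiv]
    linear_combination hB
  have kwp : ev [a, b, v, z, p, q, r, t] [16777216] = 0 := by
    simp [ev, mon, wp]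
  have key := E.sound [a, b, v, z, p, q, r, t]
    (.add (.add (.add (.poly [8193, 68719480833]) (.mul (.poly [270336, 68719484928,
    137439215616]) (.poly [16777281, 16781312, 1073741826, 68719476737, 68736253952,
    4398046511105]))) (.add (.mul (.poly [4160, 69793218560, 137438953473]) (.poly [16781376,
    1073745921, 68719476801, 68719738882, 68736254016, 68736258049, 68736516097])) (.add (.mul
    (.poly [4096, 68719476736]) (.poly [4099, 4225, 8258, 270337, 16781312, 68719476737,
    68736253952])) (.mul (.poly [8192]) (.poly (F2L 3 2)))))) (.add (.add (.mul (.poly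
    [137438953472]) (.poly (F2L 2 3))) (.add (.mul (.poly [8192]) (.poly (F1L 3 2))) (.mul
    (.poly [4160, 8193, 1073745920, 68719480833]) (.poly (F1L 2 2))))) (.add (.mul (.poly
    [8192]) (.poly (F2L 1 0))) (.add (.mul (.poly [4160, 1073745920]) (.poly (F1L 1 1))) (.mul
    (.poly [8192, 8194, 8320, 270401, 274432, 532480, 16789568, 17047616, 33562624, 33562752,
    1074012161, 1090789376, 1107304512, 2147491840, 2147491842, 2164269057, 68719480834,
    68719484993, 68719489026, 68719747072, 68736258049, 68736258177, 68736266241, 68736520256,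
    68753035392, 68753039425, 68753301504, 69793222722, 69793226753, 69793226755, 69809999937,
    69810003968, 69810262016, 69826777152, 70883741697, 137438953474, 137438957633,
    137438957635, 137438961666, 137439215681, 137455730689, 137455734848, 137455734850,
    137455996929, 137472512065, 138512957441, 138529476610, 206158692354, 206175211521,
    206175469569, 4398046523392, 4398046781440, 4399137038336, 4466765992001, 4466765996032,
    4466782769216, 4466782773249, 4467856510976, 4535485726720, 4535502245889, 8796093030400])
    (.poly [16777216]))))))
    8 rfl (by decide +kernel)
  simp only [E.den, ev_F1 _ _ _ _ _ _ _ _ h, ev_F2 _ _ _ _ _ _ _ _ h, khF, khP, khB, kwp, mul_zero, add_zero] at key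
  simp only [ev, mon, Nat.reduceMod, Nat.reduceDiv] at key
  linear_combination key

set_option maxRecDepth 100000 in
theorem c6_3 [CharP D 2] {a b v z p q r t : D} (h : form1 a b v z p q r t = 0) (wr : r = 0)
    (hF : a * b * p + a ^ 2 * q + a * t + v * p + a * r + p * r = 0)
    (hP : a * v * q + a ^ 2 * z * r+a * z * r * p + b * v * p + a * b * r+b * p * r+a * v * p *
    r = 0)
    (hB : a * v * b ^ 2 + a ^ 2 * v ^ 2 * b+a * v ^ 2 * z+a ^ 3 * v+p * v+a * r+p * r = 0) :
    a ^ 1 * v ^ 1 * (v ^ 2+1) = 0 := by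
  have khF : ev [a, b, v, z, p, q, r, t] [16777281, 16781312, 1073741826, 68719476737, 68736253952, 4398046511105] = 0 := by
    simp only [ev, mon, Nat.reduceMod, Nat.reduceDiv]
    linear_combination hF
  have khP : ev [a, b, v, z, p, q, r, t] [16781376, 1073745921, 68719476801, 68719738882, 68736254016, 68736258049, 68736516097] = 0 := by
    simp only [ev, mon, Nat.reduceMod, Nat.reduceDiv]
    linear_combination hP
  have khB : ev [a, b, v, z, p, q, r, t] [4099, 4225, 8258, 270337, 16781312, 68719476737, 68736253952] = 0 := by
    simp only [ev, mon, Nat.reduceMod, Nat.reduceDiv]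
    linear_combination hB
  have kwr : ev [a, b, v, z, p, q, r, t] [68719476736] = 0 := by
    simp [ev, mon, wr]
  have key := E.sound [a, b, v, z, p, q, r, t]
    (.add (.add (.add (.add (.poly [4097, 12289]) (.mul (.poly [8192, 8194, 8320, 12353, 16384,
    266240, 4398046515200]) (.poly [16777281, 16781312, 1073741826, 68719476737, 68736253952,
    4398046511105]))) (.add (.mul (.poly [4099, 8256, 8258, 4398046511105]) (.poly [16781376,
    1073745921, 68719476801, 68719738882, 68736254016, 68736258049, 68736516097])) (.mul (.poly
    [0, 4398046515200]) (.poly [4099, 4225, 8258, 270337, 16781312, 68719476737,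
    68736253952])))) (.add (.add (.mul (.poly [4225]) (.poly (F2L 3 3))) (.mul (.poly [12288])
    (.poly (F2L 3 2)))) (.add (.mul (.poly [4097]) (.poly (F2L 2 2))) (.mul (.poly [4097])
    (.poly (F1L 3 3)))))) (.add (.add (.add (.mul (.poly [0]) (.poly (F1L 0 2))) (.mul (.poly
    [4096]) (.poly (F1L 3 2)))) (.add (.mul (.poly [4097]) (.poly (F2L 1 1))) (.mul (.poly [0])
    (.poly (F1L 1 3))))) (.add (.add (.mul (.poly [4096]) (.poly (F1L 2 3))) (.mul (.poly
    [4096]) (.poly (F1L 0 1)))) (.add (.mul (.poly [16781312]) (.poly (F1L 0 0))) (.add (.mul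
    (.poly [4096]) (.poly (F2L 1 0))) (.mul (.poly [4164, 4290, 8195, 8323, 16387, 266245,
    266371, 270402, 270404, 16781505, 16785410, 16785412, 16789571, 17043458, 17043460,
    17043586, 17047617, 17047619, 33562625, 50335809, 50339840, 1073745924, 1107300354,
    68719480833, 68719480835, 68769812480, 4398046511170, 4398046773251, 4398063288385,
    4398063550466, 4398080069633]) (.poly [68719476736])))))))
    8 rfl (by decide +kernel)
  simp only [E.den, ev_F1 _ _ _ _ _ _ _ _ h, ev_F2 _ _ _ _ _ _ _ _ h, khF, khP, khB, kwr, mul_zero, add_zero] at key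
  simp only [ev, mon, Nat.reduceMod, Nat.reduceDiv] at key
  linear_combination key

set_option maxRecDepth 100000 in
theorem c6_4 [CharP D 2] {a b v z p q r t : D} (h : form1 a b v z p q r t = 0) (wr : r = 0)
    (hF : a * b * p + a ^ 2 * q + a * t + v * p + a * r + p * r = 0)
    (hB : a * v * b ^ 2 + a ^ 2 * v ^ 2 * b+a * v ^ 2 * z+a ^ 3 * v+p * v+a * r+p * r = 0) :
    v ^ 1 * (a ^ 2+p ^ 2) = 0 := by
  have khF : ev [a, b, v, z, p, q, r, t] [16777281, 16781312, 1073741826, 68719476737, 68736253952, 4398046511105] = 0 := by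
    simp only [ev, mon, Nat.reduceMod, Nat.reduceDiv]
    linear_combination hF
  have khB : ev [a, b, v, z, p, q, r, t] [4099, 4225, 8258, 270337, 16781312, 68719476737, 68736253952] = 0 := by
    simp only [ev, mon, Nat.reduceMod, Nat.reduceDiv]
    linear_combination hB
  have kwr : ev [a, b, v, z, p, q, r, t] [68719476736] = 0 := by
    simp [ev, mon, wr]
  have key := E.sound [a, b, v, z, p, q, r, t]
    (.add (.add (.poly [4098, 33558528]) (.add (.mul (.poly [8193, 266241]) (.poly [16777281,
    16781312, 1073741826, 68719476737, 68736253952, 4398046511105])) (.mul (.poly [16777216])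
    (.poly [4099, 4225, 8258, 270337, 16781312, 68719476737, 68736253952])))) (.add (.mul
    (.poly [65, 262146]) (.poly (F2L 3 3))) (.add (.mul (.poly [4097]) (.poly (F2L 3 2))) (.mul
    (.poly [130, 4163, 8196, 266242, 524292, 16777217, 16777345, 16781378, 17043457, 17043459,
    17301507, 33554432]) (.poly [68719476736])))))
    8 rfl (by decide +kernel)
  simp only [E.den, ev_F1 _ _ _ _ _ _ _ _ h, ev_F2 _ _ _ _ _ _ _ _ h, khF, khB, kwr, mul_zero, add_zero] at key
  simp only [ev, mon, Nat.reduceMod, Nat.reduceDiv] at key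
  linear_combination key

set_option maxRecDepth 100000 in
theorem c7_1 [CharP D 2] {a b v z p q r t : D} (h : form1 a b v z p q r t = 0)
    (hF : a * b * p + a ^ 2 * q + a * t + v * p + a * r + p * r = 0)
    (hP : a * v * q + a ^ 2 * z * r+a * z * r * p + b * v * p + a * b * r+b * p * r+a * v * p *
    r = 0)
    (hZ : a ^ 2 * v * z ^ 2 + a ^ 2 * v ^ 3 + p ^ 2 * r + v * p ^ 2 + a ^ 2 * r = 0)
    (hB : a * v * b ^ 2 + a ^ 2 * v ^ 2 * b+a * v ^ 2 * z+a ^ 3 * v+p * v+a * r+p * r = 0) :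
    r ^ 1 * (a ^ 2 * v ^ 3 * p ^ 2+a ^ 5 * p * r+a ^ 2 * v ^ 2 * p ^ 2 * r+a ^ 3 * p ^ 3 * r+a
    ^ 4 * v+v ^ 3 * p ^ 2+a ^ 3 * p * r+a ^ 2 * p ^ 2 * r+v * p ^ 2 * r ^ 2+v * p ^ 2+a ^ 2 *
    r+p ^ 2 * r) = 0 := by
  have khF : ev [a, b, v, z, p, q, r, t] [16777281, 16781312, 1073741826, 68719476737, 68736253952, 4398046511105] = 0 := by
    simp only [ev, mon, Nat.reduceMod, Nat.reduceDiv]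
    linear_combination hF
  have khP : ev [a, b, v, z, p, q, r, t] [16781376, 1073745921, 68719476801, 68719738882, 68736254016, 68736258049, 68736516097] = 0 := by
    simp only [ev, mon, Nat.reduceMod, Nat.reduceDiv]
    linear_combination hP
  have khZ : ev [a, b, v, z, p, q, r, t] [12290, 528386, 33558528, 68719476738, 68753031168] = 0 := by
    simp only [ev, mon, Nat.reduceMod, Nat.reduceDiv]
    linear_combination hZ
  have khB : ev [a, b, v, z, p, q, r, t] [4099, 4225, 8258, 270337, 16781312, 68719476737, 68736253952] = 0 := by
    simp only [ev, mon, Nat.reduceMod, Nat.reduceDiv]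
    linear_combination hB
  have key := E.sound [a, b, v, z, p, q, r, t]
    (.add (.add (.add (.add (.poly [68719480836, 68753035264, 68753043456, 68753043458,
    137438953474, 137455730691, 137455730693, 137472507904, 137472507906, 137472516098,
    137489285123, 206191988736]) (.add (.mul (.poly [4097, 12289, 270337, 16781314, 16781440,
    16785473, 16789504, 17047552, 33558529, 50335744, 1090523200, 1090527233, 1107304448,
    2164264960, 68719742977, 68736262146, 68753035328, 69809999873, 69826777088, 70866960385,
    70883737600, 137438957569, 137455734784, 137455734786, 137472512001, 138512695298,
    138529472513, 206175207426, 206191984641, 4466765991937]) (.poly [16777281, 16781312,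
    1073741826, 68719476737, 68736253952, 4398046511105])) (.mul (.poly [0, 16777217,
    2147483648, 68719480832, 68736258049, 137472507904, 4398046515200]) (.poly [16781376,
    1073745921, 68719476801, 68719738882, 68736254016, 68736258049, 68736516097])))) (.add
    (.mul (.poly [68719476736]) (.poly [12290, 528386, 33558528, 68719476738, 68753031168]))
    (.add (.mul (.poly [4097, 16781312, 33554496, 1090519041, 68719476737, 68736253952,
    68753031169, 68769808384, 4398063288320]) (.poly [4099, 4225, 8258, 270337, 16781312,
    68719476737, 68736253952])) (.mul (.poly [4161, 266240, 16781376, 33562624, 1090523136,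
    68719476801, 68736254016, 69793218561, 137438953474, 137455730689]) (.poly (F2L 3 3))))))
    (.add (.add (.mul (.poly [1, 4160, 16777216, 68719476800, 137438953473]) (.poly (F2L 3 2)))
    (.add (.mul (.poly [128, 4161, 8192, 16785409, 33562624, 1073741888, 1090523136,
    68719480832, 68736254016, 68736258049, 68753035264, 69809995776]) (.poly (F2L 2 2))) (.mul
    (.poly [16781376, 33554432, 1090523136, 68719480834, 68736258049, 69809995776]) (.poly (F1L
    3 3))))) (.add (.mul (.poly [65, 4096, 4098, 16781313, 1073741825]) (.poly (F2L 2 1)))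
    (.add (.mul (.poly [1, 4160, 68719476800, 68736258048, 137438953473, 137455730688]) (.poly
    (F2L 2 3))) (.mul (.poly [4096, 4098, 68719476738, 68736253953]) (.poly (F1L 1 2)))))))
    (.add (.add (.add (.mul (.poly [16781312, 68736253952]) (.poly (F2L 3 1))) (.add (.mul
    (.poly [16781312]) (.poly (F1L 0 2))) (.mul (.poly [4160, 16777216, 16785408, 1073745920,
    69793218560, 137438953473, 137455730688]) (.poly (F1L 3 2))))) (.add (.mul (.poly [2, 4161,
    8194, 16777217, 68719480832]) (.poly (F2L 1 1))) (.add (.mul (.poly [4097]) (.poly (F2L 2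
    0))) (.mul (.poly [1073745920, 68719480833, 137438953473]) (.poly (F1L 2 3)))))) (.add
    (.add (.mul (.poly [137438953473]) (.poly (F1L 0 1))) (.add (.mul (.poly [4161, 8194,
    16777217, 16781376, 1073741888, 68719476801, 68719480834, 68736258049, 69793218561,
    137438953472, 4398046515200, 4466765987840]) (.poly (F1L 2 2))) (.mul (.poly [16777216,
    1073745920, 69793218560]) (.poly (F2L 1 0))))) (.add (.mul (.poly [65, 4096, 4098,
    16777280, 16781313, 33558528, 68736253953, 68753031168]) (.poly (F2L 1 2))) (.add (.mul
    (.poly [8192, 16777217, 1073741888, 1073745921, 68736254016, 69793218561, 137438953472,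
    4398046515200, 4466765987840]) (.poly (F1L 1 1))) (.mul (.poly [4096, 68719476738,
    68736253953]) (.poly (F1L 2 1))))))))
    8 rfl (by decide +kernel)
  simp only [E.den, ev_F1 _ _ _ _ _ _ _ _ h, ev_F2 _ _ _ _ _ _ _ _ h, khF, khP, khZ, khB, mul_zero, add_zero] at key
  simp only [ev, mon, Nat.reduceMod, Nat.reduceDiv] at key
  linear_combination key

set_option maxRecDepth 100000 in
theorem c7_2 [CharP D 2] {a b v z p q r t : D} (h : form1 a b v z p q r t = 0)
    (hF : a * b * p + a ^ 2 * q + a * t + v * p + a * r + p * r = 0)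
    (hP : a * v * q + a ^ 2 * z * r+a * z * r * p + b * v * p + a * b * r+b * p * r+a * v * p *
    r = 0)
    (hZ : a ^ 2 * v * z ^ 2 + a ^ 2 * v ^ 3 + p ^ 2 * r + v * p ^ 2 + a ^ 2 * r = 0)
    (hB : a * v * b ^ 2 + a ^ 2 * v ^ 2 * b+a * v ^ 2 * z+a ^ 3 * v+p * v+a * r+p * r = 0)
    (he1 : a ^ 2 * v ^ 3 * p ^ 2+a ^ 5 * p * r+a ^ 2 * v ^ 2 * p ^ 2 * r+a ^ 3 * p ^ 3 * r+a ^
    4 * v+v ^ 3 * p ^ 2+a ^ 3 * p * r+a ^ 2 * p ^ 2 * r+v * p ^ 2 * r ^ 2+v * p ^ 2+a ^ 2 * r+p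
    ^ 2 * r = 0) :
    a ^ 1 * (a * v ^ 3 * p ^ 3+a ^ 4 * p ^ 2 * r+a ^ 2 * v ^ 2 * p ^ 2 * r+a * v ^ 2 * p ^ 3 *
    r+a ^ 2 * p ^ 4 * r+a ^ 3 * v * p+v ^ 3 * p ^ 2+a ^ 4 * r+a ^ 3 * p * r+v * p ^ 2 * r ^ 2+a
    ^ 2 * v) = 0 := by
  have khF : ev [a, b, v, z, p, q, r, t] [16777281, 16781312, 1073741826, 68719476737, 68736253952, 4398046511105] = 0 := by
    simp only [ev, mon, Nat.reduceMod, Nat.reduceDiv]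
    linear_combination hF
  have khP : ev [a, b, v, z, p, q, r, t] [16781376, 1073745921, 68719476801, 68719738882, 68736254016, 68736258049, 68736516097] = 0 := by
    simp only [ev, mon, Nat.reduceMod, Nat.reduceDiv]
    linear_combination hP
  have khZ : ev [a, b, v, z, p, q, r, t] [12290, 528386, 33558528, 68719476738, 68753031168] = 0 := by
    simp only [ev, mon, Nat.reduceMod, Nat.reduceDiv]
    linear_combination hZ
  have khB : ev [a, b, v, z, p, q, r, t] [4099, 4225, 8258, 270337, 16781312, 68719476737, 68736253952] = 0 := by
    simp only [ev, mon, Nat.reduceMod, Nat.reduceDiv]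
    linear_combination hB
  have khe1 : ev [a, b, v, z, p, q, r, t] [4100, 33558528, 33566720, 33566722, 68719476738, 68736253955, 68736253957, 68753031168, 68753031170, 68753039362, 68769808387, 137472512000] = 0 := by
    simp only [ev, mon, Nat.reduceMod, Nat.reduceDiv]
    linear_combination he1
  have key := E.sound [a, b, v, z, p, q, r, t]
    (.add (.add (.add (.add (.poly [4099, 16781316, 33566721, 50343938, 68719476741,
    68736253956, 68753031173, 68753039363, 68769816578, 68786585603, 137472512001]) (.mul
    (.poly [0, 16777217, 16785409, 1073741888, 68719476801, 68719480832, 68719480834,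
    68719738882, 68753293312, 69793218561, 69809995776, 137438953474, 137472507904,
    4398046515200, 4398046515202, 4398046773248, 4466765987842, 4466782765057]) (.poly
    [16777281, 16781312, 1073741826, 68719476737, 68736253952, 4398046511105]))) (.add (.mul
    (.poly [64, 262145, 33558529, 4398046511105, 4398063288320]) (.poly [16781376, 1073745921,
    68719476801, 68719738882, 68736254016, 68736258049, 68736516097])) (.mul (.poly [16777216])
    (.poly [12290, 528386, 33558528, 68719476738, 68753031168])))) (.add (.add (.mul (.poly
    [16777217, 33554432]) (.poly [4099, 4225, 8258, 270337, 16781312, 68719476737,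
    68736253952])) (.mul (.poly [16777216]) (.poly [4100, 33558528, 33566720, 33566722,
    68719476738, 68736253955, 68736253957, 68753031168, 68753031170, 68753039362, 68769808387,
    137472512000]))) (.add (.mul (.poly [66, 4099, 16781312, 16781314, 33554496, 1073741824])
    (.poly (F2L 3 3))) (.add (.mul (.poly [65, 4096, 16781313, 1090519040, 68719476738,
    68753031168, 4398046511104]) (.poly (F2L 3 2))) (.mul (.poly [4097]) (.poly (F2L 2 2)))))))
    (.add (.add (.add (.mul (.poly [4099, 16781312, 16781314, 68719476739, 68736253952,
    68736253954]) (.poly (F1L 3 3))) (.mul (.poly [65, 4096, 4098, 1073741825, 68719476736,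
    68736253953]) (.poly (F2L 2 3)))) (.add (.mul (.poly [4096, 4098, 68719476736]) (.poly (F1L
    3 2))) (.mul (.poly [4097, 16781312, 68719476737, 68736253952]) (.poly (F2L 1 1))))) (.add
    (.add (.mul (.poly [4096, 4098, 68719476736]) (.poly (F1L 2 3))) (.mul (.poly [4096,
    68719476736]) (.poly (F1L 0 1)))) (.add (.mul (.poly [64, 16781312, 1073741824,
    68719476737]) (.poly (F1L 2 2))) (.add (.mul (.poly [4096, 68719476736]) (.poly (F2L 1 0)))
    (.mul (.poly [64, 4097, 1073741824, 68736253952]) (.poly (F1L 1 1))))))))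
    8 rfl (by decide +kernel)
  simp only [E.den, ev_F1 _ _ _ _ _ _ _ _ h, ev_F2 _ _ _ _ _ _ _ _ h, khF, khP, khZ, khB, khe1, mul_zero, add_zero] at key
  simp only [ev, mon, Nat.reduceMod, Nat.reduceDiv] at key
  linear_combination key

end
end Char2

theorem dim_of_integral {A D : Type*} [CommRing A] [CommRing D] [Algebra A D]
    [Algebra.IsIntegral A D] [FaithfulSMul A D] : ringKrullDim D = ringKrullDim A := by
  apply le_antisymm
  · refine Order.krullDim_le_of_strictMono (PrimeSpectrum.comap (algebraMap A D)) ?_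
    intro P Q h
    exact Ideal.IsIntegral.comap_lt_comap (R := A) (I := P.asIdeal) (J := Q.asIdeal) h
  · refine iSup_le fun l => ?_
    obtain ⟨Q, hQ, hQ'⟩ := Ideal.exists_ideal_over_prime_of_isIntegral l.head.asIdeal (⊥ : Ideal D)
      (by
        intro x hx
        have : algebraMap A D x = 0 := by simpa using hx
        have : x = 0 := (FaithfulSMul.algebraMap_eq_zero_iff A D).1 this
        simp [this])
    obtain ⟨hp, hc⟩ := hQ'
    have : Q.LiesOver l.head.asIdeal := ⟨hc.symm⟩
    obtain ⟨L, hL, -⟩ := Ideal.exists_ltSeries_of_hasGoingUp (S := D) l Q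
    rw [← hL]
    exact le_iSup (fun L : LTSeries (PrimeSpectrum D) => (L.length : WithBot ℕ∞)) L

theorem dim_eq_trdeg (k D : Type) [Field k] [CommRing D] [IsDomain D] [Algebra k D]
    [Algebra.FiniteType k D] :
    ∃ s : ℕ, ringKrullDim D = s ∧ Algebra.trdeg k D = s := by
  obtain ⟨s, g, hg, hi⟩ := exists_integral_inj_algHom_of_fg k D
  let := g.toRingHom.toAlgebra
  have : IsScalarTower k (MvPolynomial (Fin s) k) D :=
    IsScalarTower.of_algebraMap_eq (fun x => (g.commutes x).symm)
  have : Algebra.IsIntegral (MvPolynomial (Fin s) k) D := ⟨hi⟩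
  have : FaithfulSMul (MvPolynomial (Fin s) k) D :=
    (faithfulSMul_iff_algebraMap_injective _ _).2 hg
  refine ⟨s, ?_, ?_⟩
  · rw [dim_of_integral (A := MvPolynomial (Fin s) k),
      MvPolynomial.ringKrullDim_of_isNoetherianRing, ringKrullDim_eq_zero_of_field]
    simp
  · rw [← trdeg_add_eq k (MvPolynomial (Fin s) k) (A := D), MvPolynomial.trdeg_of_isDomain,
      trdeg_eq_zero]
    simp

/-- upper bound criterion -/
theorem dim_le_two (D : Type) [CommRing D] [IsDomain D] [Algebra (ZMod 2) D]
    [Algebra.FiniteType (ZMod 2) D] (x y : D)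
    [Algebra.IsAlgebraic (Algebra.adjoin (ZMod 2) {x, y}) D] : ringKrullDim D ≤ 2 := by
  obtain ⟨s, h1, h2⟩ := dim_eq_trdeg (ZMod 2) D
  have h3 := Algebra.IsAlgebraic.trdeg_le_cardinalMk (ZMod 2) ({x, y} : Set D)
  rw [h2] at h3
  have h4 : Cardinal.mk ({x, y} : Set D) ≤ 2 := by
    refine (Cardinal.mk_insert_le).trans ?_
    simp [one_add_one_eq_two]
  have : s ≤ 2 := by exact_mod_cast h3.trans h4
  rw [h1]
  exact_mod_cast this

/-- a subring closed under taking roots of nonzero polynomials -/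
def RootClosed {D : Type} [CommRing D] (B : Subring D) : Prop :=
  ∀ (n : ℕ) (c : Fin n → D) (x : D), (∀ i, c i ∈ B) → (∃ i, c i ≠ 0) →
    ∑ i, c i * x ^ (i : ℕ) = 0 → x ∈ B

theorem alg_exists {D : Type} [CommRing D] [IsDomain D] [Algebra (ZMod 2) D]
    [Algebra.FiniteType (ZMod 2) D] (x y : D) :
    ∃ B : Subring D, x ∈ B ∧ y ∈ B ∧ RootClosed B ∧ (B = ⊤ → ringKrullDim D ≤ 2) := by
  let A := Algebra.adjoin (ZMod 2) {x, y}
  let C : Subalgebra A D := Subalgebra.algebraicClosure A D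
  refine ⟨C.toSubring, ?_, ?_, ?_, ?_⟩
  · exact isAlgebraic_algebraMap (A := D) (⟨x, Algebra.subset_adjoin (by simp)⟩ : A)
  · exact isAlgebraic_algebraMap (A := D) (⟨y, Algebra.subset_adjoin (by simp)⟩ : A)
  · intro n c t hc ⟨i, hi⟩ hs
    have h1 : IsAlgebraic C t := by
      refine ⟨∑ i : Fin n, Polynomial.C (⟨c i, hc i⟩ : C) * Polynomial.X ^ (i : ℕ), ?_, ?_⟩
      · intro h0
        have := congrArg (fun f => Polynomial.coeff f (i : ℕ)) h0
        simp only [Polynomial.finsetSum_coeff, Polynomial.coeff_C_mul, Polynomial.coeff_X_pow,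
          Polynomial.coeff_zero] at this
        rw [Finset.sum_eq_single i] at this
        · simp only [if_true, mul_one] at this
          exact hi (congrArg Subtype.val this)
        · intro j _ hj
          rw [if_neg, mul_zero]
          intro h; exact hj (Fin.ext h.symm)
        · simp
      · simpa [map_sum] using hs
    exact IsAlgebraic.restrictScalars A h1
  · intro h
    have : Algebra.IsAlgebraic A D := ⟨fun d => by
      have : d ∈ C.toSubring := by rw [h]; trivial
      exact this⟩
    exact dim_le_two D x y

namespace Char2
section
variable {D : Type} [CommRing D] [IsDomain D]

theorem canc {m x : D} (hm : m ≠ 0) (h : m * x = 0) : x = 0 :=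
  (mul_eq_zero.1 h).resolve_left hm

theorem mm {B : Subring D} {x : D}
    (h : x ∈ B 
      := by repeat' (first | assumption | exact one_mem _ | exact zero_mem _ | apply add_mem | apply mul_mem | apply pow_mem)) : x ∈ B := h

theorem memS {B : Subring D} {x : D} (s : D) (h : x + s = 0)
    (hs : s ∈ B 
      := by repeat' (first | assumption | exact one_mem _ | exact zero_mem _ | apply add_mem | apply mul_mem | apply pow_mem)) : x ∈ B := by
  have : x = -s := by linear_combination h
  rw [this]; exact neg_mem hs

theorem rc1 {B : Subring D} (hB : RootClosed B) {x : D} (c0 c1 : D)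
    (n : c1 ≠ 0) (h : c0 + c1 * x = 0)
    (m0 : c0 ∈ B 
      := by repeat' (first | assumption | exact one_mem _ | exact zero_mem _ | apply add_mem | apply mul_mem | apply pow_mem))
    (m1 : c1 ∈ B 
      := by repeat' (first | assumption | exact one_mem _ | exact zero_mem _ | apply add_mem | apply mul_mem | apply pow_mem)) : x ∈ B := by
  refine hB 2 ![c0, c1] x ?_ ⟨1, by simpa using n⟩ ?_
  · intro i; fin_cases i <;> simp [m0, m1]
  · simp [Fin.sum_univ_succ]; linear_combination h

theorem rc2 {B : Subring D} (hB : RootClosed B) {x : D} (c0 c1 c2 : D)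
    (n : c2 ≠ 0) (h : c0 + c1 * x + c2 * x ^ 2 = 0)
    (m0 : c0 ∈ B 
      := by repeat' (first | assumption | exact one_mem _ | exact zero_mem _ | apply add_mem | apply mul_mem | apply pow_mem))
    (m1 : c1 ∈ B 
      := by repeat' (first | assumption | exact one_mem _ | exact zero_mem _ | apply add_mem | apply mul_mem | apply pow_mem))
    (m2 : c2 ∈ B 
      := by repeat' (first | assumption | exact one_mem _ | exact zero_mem _ | apply add_mem | apply mul_mem | apply pow_mem)) : x ∈ B := by
  refine hB 3 ![c0, c1, c2] x ?_ ⟨2, by simpa using n⟩ ?_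
  · intro i; fin_cases i <;> simp [m0, m1, m2]
  · simp [Fin.sum_univ_succ]; linear_combination h

theorem rc3 {B : Subring D} (hB : RootClosed B) {x : D} (c0 c1 c2 c3 : D)
    (n : c3 ≠ 0) (h : c0 + c1 * x + c2 * x ^ 2 + c3 * x ^ 3 = 0)
    (m0 : c0 ∈ B 
      := by repeat' (first | assumption | exact one_mem _ | exact zero_mem _ | apply add_mem | apply mul_mem | apply pow_mem))
    (m1 : c1 ∈ B 
      := by repeat' (first | assumption | exact one_mem _ | exact zero_mem _ | apply add_mem | apply mul_mem | apply pow_mem))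
    (m2 : c2 ∈ B 
      := by repeat' (first | assumption | exact one_mem _ | exact zero_mem _ | apply add_mem | apply mul_mem | apply pow_mem))
    (m3 : c3 ∈ B 
      := by repeat' (first | assumption | exact one_mem _ | exact zero_mem _ | apply add_mem | apply mul_mem | apply pow_mem)) : x ∈ B := by
  refine hB 4 ![c0, c1, c2, c3] x ?_ ⟨3, by simpa using n⟩ ?_
  · intro i; fin_cases i <;> simp [m0, m1, m2, m3]
  · simp [Fin.sum_univ_succ]; linear_combination h

theorem rc6 {B : Subring D} (hB : RootClosed B) {x : D} (c0 c2 c3 c4 : D)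
    (h : c0 + c2 * x ^ 2 + c3 * x ^ 3 + c4 * x ^ 4 + x ^ 6 = 0)
    (m0 : c0 ∈ B 
      := by repeat' (first | assumption | exact one_mem _ | exact zero_mem _ | apply add_mem | apply mul_mem | apply pow_mem))
    (m1 : c2 ∈ B 
      := by repeat' (first | assumption | exact one_mem _ | exact zero_mem _ | apply add_mem | apply mul_mem | apply pow_mem))
    (m2 : c3 ∈ B 
      := by repeat' (first | assumption | exact one_mem _ | exact zero_mem _ | apply add_mem | apply mul_mem | apply pow_mem))
    (m3 : c4 ∈ B 
      := by repeat' (first | assumption | exact one_mem _ | exact zero_mem _ | apply add_mem | apply mul_mem | apply pow_mem)) : x ∈ B := by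
  refine hB 7 ![c0, 0, c2, c3, c4, 0, 1] x ?_ ⟨6, by simp⟩ ?_
  · intro i; fin_cases i <;> simp [m0, m1, m2, m3]
  · simp [Fin.sum_univ_succ]; linear_combination h

variable [Algebra (ZMod 2) D] [Algebra.FiniteType (ZMod 2) D] [CharP D 2]
variable {a b v z p q r t : D}

theorem up1 (h : form1 a b v z p q r t = 0)
    (hgen : ∀ B : Subring D, a ∈ B → b ∈ B → v ∈ B → z ∈ B → p ∈ B → q ∈ B → r ∈ B → t ∈ B → B = ⊤)
    (wa : a = 0) (hp : p ≠ 0) : ringKrullDim D ≤ 2 := by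
  have two : (2 : D) = 0 := CharTwo.two_eq_zero
  obtain ⟨B, mp, mr, hB, hd⟩ := alg_exists p r
  have wv : v = r := by
    have := canc (pow_ne_zero _ hp) (c1_0 h wa)
    linear_combination this - r * two
  have h1 := canc (pow_ne_zero _ hp) (c1_1 h wa wv)
  have h2 := canc (pow_ne_zero _ hp) (c1_2 h wa wv h1)
  have h3 := canc (pow_ne_zero _ hp) (c1_3 h wa wv h1 h2)
  have h4 := canc (pow_ne_zero _ hp) (c1_4 h wa wv h1 h2 h3)
  have h5 := canc (pow_ne_zero _ hp) (c1_5 h wa wv h1 h2 h3 h4)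
  have ma : a ∈ B := wa ▸ zero_mem _
  have mv : v ∈ B := wv ▸ mr
  have mt : t ∈ B := rc2 hB (r ^ 2 + 1) 0 1 one_ne_zero (by linear_combination h1)
  have mb : b ∈ B := rc2 hB (p ^ 2 + r ^ 2) 0 1 one_ne_zero (by linear_combination h3)
  have mq : q ∈ B := rc2 hB (p ^ 2 * r ^ 2 + p ^ 2 + r ^ 2 + 1) 0 1 one_ne_zero
    (by linear_combination h4)
  have mz : z ∈ B := memS (p * q + p ^ 2 * r + t) (by linear_combination h5)
  exact hd (hgen B ma mb mv mz mp mq mr mt)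

theorem up2 (h : form1 a b v z p q r t = 0)
    (hgen : ∀ B : Subring D, a ∈ B → b ∈ B → v ∈ B → z ∈ B → p ∈ B → q ∈ B → r ∈ B → t ∈ B → B = ⊤)
    (wv : v = 0) (hr : r ≠ 0) : ringKrullDim D ≤ 2 := by
  have two : (2 : D) = 0 := CharTwo.two_eq_zero
  obtain ⟨B, mp, mr, hB, hd⟩ := alg_exists p r
  have wa : a = p := by
    have := canc (pow_ne_zero _ hr) (c2_0 h wv)
    linear_combination this - p * two
  have h1 := canc (pow_ne_zero _ hr) (c2_1 h wv wa)
  have h2 := c2_2 h wv wa h1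
  have h3 := canc (pow_ne_zero _ hr) (c2_3 h wv wa h1 h2)
  have h4 := c2_4 h wv wa
  have ma : a ∈ B := wa ▸ mp
  have mv : v ∈ B := wv ▸ zero_mem _
  have mz : z ∈ B := rc2 hB 1 0 1 one_ne_zero (by linear_combination h1)
  have mq : q ∈ B := rc2 hB (z * r + p ^ 2) 0 1 one_ne_zero (by linear_combination h2)
  have mb : b ∈ B := rc2 hB (z * r + p ^ 2) 0 1 one_ne_zero (by linear_combination h3)
  have mt : t ∈ B := memS (z ^ 3 + b * p + p * q + z) (by linear_combination h4)
  exact hd (hgen B ma mb mv mz mp mq mr mt)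

theorem up3 (h : form1 a b v z p q r t = 0)
    (hgen : ∀ B : Subring D, a ∈ B → b ∈ B → v ∈ B → z ∈ B → p ∈ B → q ∈ B → r ∈ B → t ∈ B → B = ⊤)
    (wa : a = 0) (wp : p = 0) : ringKrullDim D ≤ 2 := by
  have two : (2 : D) = 0 := CharTwo.two_eq_zero
  obtain ⟨B, mq, mr, hB, hd⟩ := alg_exists q r
  have h1 := c3_1 h wa wp
  have h2 := c3_2 h wa wp
  have h3 := c3_3 h wa wp
  have h4 := c3_4 h wa wp
  have ma : a ∈ B := wa ▸ zero_mem _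
  have mp : p ∈ B := wp ▸ zero_mem _
  have hv : v = q ^ 2 * t + (r ^ 3 + r) := by linear_combination h1 - (q ^ 2 * t + r ^ 3 + r) * two
  have hz : z = t ^ 3 + q ^ 2 * r + t := by linear_combination h2 - (t ^ 3 + q ^ 2 * r + t) * two
  have mt : t ∈ B := by
    refine rc6 hB ((q ^ 2 * r) ^ 2 + (r ^ 3 + r) ^ 2 + (r ^ 3 + r) * r + r ^ 2)
      (1 + q ^ 4) 0 1 ?_
    rw [hv, hz] at h4
    clear * - h4 two; grind
  have mv : v ∈ B := by rw [hv]; exact mm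
  have mz : z ∈ B := by rw [hz]; exact mm
  have mb : b ∈ B := rc2 hB (q ^ 2 + v ^ 2 + v * r + r ^ 2) q 1 one_ne_zero
    (by linear_combination h3)
  exact hd (hgen B ma mb mv mz mp mq mr mt)

theorem up4 (h : form1 a b v z p q r t = 0)
    (hgen : ∀ B : Subring D, a ∈ B → b ∈ B → v ∈ B → z ∈ B → p ∈ B → q ∈ B → r ∈ B → t ∈ B → B = ⊤)
    (wv : v = 0) (wr : r = 0) : ringKrullDim D ≤ 2 := by
  have two : (2 : D) = 0 := CharTwo.two_eq_zero
  obtain ⟨B, ma, mp, hB, hd⟩ := alg_exists a p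
  have h1 := c4_1 h wv wr
  have h2 := c4_2 h wv wr
  have h3 := c4_3 h wv wr
  have h4 := c4_4 h wv wr
  have mv : v ∈ B := wv ▸ zero_mem _
  have mr : r ∈ B := wr ▸ zero_mem _
  have h1' : (q ^ 2 + b + p ^ 2 + a) = 0 := by
    apply pow_eq_zero_iff (two_ne_zero) |>.1
    clear * - h1 two; grind
  have hb : b = q ^ 2 + p ^ 2 + a := by linear_combination h1' - (q ^ 2 + p ^ 2 + a) * two
  have h2' : b * q + b + a * p + q + a + p = 0 := by
    apply pow_eq_zero_iff (two_ne_zero) |>.1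
    clear * - h2 two; grind
  have mq : q ∈ B := by
    refine rc3 hB (p ^ 2 + a * p + p) (p ^ 2 + a + 1) 1 1 one_ne_zero ?_
    rw [hb] at h2'
    clear * - h2' two; grind
  have mb : b ∈ B := by rw [hb]; exact mm
  have ht : t = z ^ 3 + z + a * q + b * p := by
    linear_combination h3 - (z ^ 3 + z + a * q + b * p) * two
  have mz : z ∈ B := by
    refine rc6 hB (b ^ 2 + b * q + q ^ 2 + a ^ 2 + a * p + p ^ 2) 1 (a * q + b * p) 1
      ?_
    rw [ht] at h4
    clear * - h4 two; grind
  have mt : t ∈ B := by rw [ht]; exact mm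
  exact hd (hgen B ma mb mv mz mp mq mr mt)

theorem up5 (hF : a * b * p + a ^ 2 * q + a * t + v * p + a * r + p * r = 0)
    (hP : a * v * q + a ^ 2 * z * r+a * z * r * p + b * v * p + a * b * r+b * p * r+a * v * p * r = 0)
    (hZ : a ^ 2 * v * z ^ 2 + a ^ 2 * v ^ 3 + p ^ 2 * r + v * p ^ 2 + a ^ 2 * r = 0)
    (hb : a * v * b ^ 2 + a ^ 2 * v ^ 2 * b+a * v ^ 2 * z+a ^ 3 * v+p * v+a * r+p * r = 0)
    (hgen : ∀ B : Subring D, a ∈ B → b ∈ B → v ∈ B → z ∈ B → p ∈ B → q ∈ B → r ∈ B → t ∈ B → B = ⊤)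
    (ha : a ≠ 0) (hv : v ≠ 0) (B : Subring D) (hB : RootClosed B)
    (ma : a ∈ B) (mv : v ∈ B) (mp : p ∈ B) (mr : r ∈ B) : B = ⊤ := by
  have mz : z ∈ B := rc2 hB (a ^ 2 * v ^ 3 + p ^ 2 * r + v * p ^ 2 + a ^ 2 * r) 0 (a ^ 2 * v)
    (mul_ne_zero (pow_ne_zero _ ha) hv) (by linear_combination hZ)
  have mb : b ∈ B := rc2 hB (a * v ^ 2 * z+a ^ 3 * v+p * v+a * r+p * r) (a ^ 2 * v ^ 2) (a * v)
    (mul_ne_zero ha hv) (by linear_combination hb)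
  have mq : q ∈ B := rc1 hB
    (a ^ 2 * z * r+a * z * r * p + b * v * p + a * b * r+b * p * r+a * v * p * r) (a * v)
    (mul_ne_zero ha hv) (by linear_combination hP)
  have mt : t ∈ B := rc1 hB (a * b * p + a ^ 2 * q + v * p + a * r + p * r) a
    ha (by linear_combination hF)
  exact hgen B ma mb mv mz mp mq mr mt

theorem upper (h : form1 a b v z p q r t = 0)
    (hgen : ∀ B : Subring D, a ∈ B → b ∈ B → v ∈ B → z ∈ B → p ∈ B → q ∈ B → r ∈ B → t ∈ B → B = ⊤) :
    ringKrullDim D ≤ 2 := by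
  have two : (2 : D) = 0 := CharTwo.two_eq_zero
  by_cases ha : a = 0
  · by_cases hp : p = 0
    · exact up3 h hgen ha hp
    · exact up1 h hgen ha hp
  by_cases hv : v = 0
  · by_cases hr : r = 0
    · exact up4 h hgen hv hr
    · exact up2 h hgen hv hr
  have hav : a ^ 1 * v ^ 1 ≠ 0 := mul_ne_zero (pow_ne_zero _ ha) (pow_ne_zero _ hv)
  have hF := canc hav (c5_F h)
  have hP := c5_P h
  have hZ := c5_Z h hF hP
  have hb := canc (pow_ne_zero _ ha) (c5_B h hF hP hZ)
  have fin := up5 hF hP hZ hb hgen ha hv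
  by_cases hp : p = 0
  · have h1 := canc hav (c6_1 h hp hF hP hZ hb)
    obtain ⟨B, mv, mr, hB, hd⟩ := alg_exists v r
    have ma : a ∈ B := rc2 hB 1 0 1 one_ne_zero (by linear_combination h1)
    exact hd (fin B hB ma mv (hp ▸ zero_mem _) mr)
  by_cases hr : r = 0
  · have h1 := canc hav (c6_3 h hr hF hP hb)
    obtain ⟨B, ma, mp, hB, hd⟩ := alg_exists a p
    have mv : v ∈ B := rc2 hB 1 0 1 one_ne_zero (by linear_combination h1)
    exact hd (fin B hB ma mv mp (hr ▸ zero_mem _))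
  have h1 := canc (pow_ne_zero _ hr) (c7_1 h hF hP hZ hb)
  have h2 := canc (pow_ne_zero _ ha) (c7_2 h hF hP hZ hb h1)
  have rfin : ∀ B : Subring D, RootClosed B → a ∈ B → v ∈ B → p ∈ B → r ∈ B := by
    intro B hB ma mv mp
    refine rc2 hB (v * (a ^ 2 * v ^ 2 * p ^ 2 + a ^ 4 + v ^ 2 * p ^ 2 + p ^ 2))
      (a ^ 5 * p + a ^ 2 * v ^ 2 * p ^ 2 + a ^ 3 * p ^ 3 + a ^ 3 * p + a ^ 2 * p ^ 2 + a ^ 2 + p ^ 2)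
      (v * p ^ 2) (mul_ne_zero hv (pow_ne_zero _ hp)) ?_
    linear_combination h1
  by_cases hap : 1 + a * p = 0
  · obtain ⟨B, mp, mv, hB, hd⟩ := alg_exists p v
    have ma : a ∈ B := rc1 hB 1 p hp (by linear_combination hap)
    exact hd (fin B hB ma mv mp (rfin B hB ma mv mp))
  obtain ⟨B, ma, mp, hB, hd⟩ := alg_exists a p
  suffices mv : v ∈ B from hd (fin B hB ma mv mp (rfin B hB ma mv mp))
  obtain ⟨M0, hM0⟩ : ∃ x, x = a ^ 5 * p + a ^ 3 * p ^ 3 + a ^ 4 * p ^ 2 + a ^ 2 * p ^ 4 + a ^ 4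
    + a ^ 2 * p ^ 2 + a ^ 2 + p ^ 2 := ⟨_, rfl⟩
  obtain ⟨M1, hM1⟩ : ∃ x, x = a * p ^ 3 := ⟨_, rfl⟩
  obtain ⟨N0, hN0⟩ : ∃ x, x = (a + p) * (a ^ 3 + a + p) := ⟨_, rfl⟩
  obtain ⟨N1, hN1⟩ : ∃ x, x = (a + p) * (a * p ^ 2) := ⟨_, rfl⟩
  obtain ⟨K0, hK0⟩ : ∃ x, x = a ^ 5 * p + a ^ 3 * p ^ 3 + a ^ 3 * p + a ^ 2 * p ^ 2 + a ^ 2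
    + p ^ 2 := ⟨_, rfl⟩
  obtain ⟨K1, hK1⟩ : ∃ x, x = a ^ 2 * p ^ 2 := ⟨_, rfl⟩
  obtain ⟨W0, hW0⟩ : ∃ x, x = a ^ 4 + p ^ 2 := ⟨_, rfl⟩
  obtain ⟨W1, hW1⟩ : ∃ x, x = a ^ 2 * p ^ 2 + p ^ 2 := ⟨_, rfl⟩
  have mM0 : M0 ∈ B := by rw [hM0]; exact mm
  have mM1 : M1 ∈ B := by rw [hM1]; exact mm
  have mN0 : N0 ∈ B := by rw [hN0]; exact mm
  have mN1 : N1 ∈ B := by rw [hN1]; exact mm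
  have mK0 : K0 ∈ B := by rw [hK0]; exact mm
  have mK1 : K1 ∈ B := by rw [hK1]; exact mm
  have mW0 : W0 ∈ B := by rw [hW0]; exact mm
  have mW1 : W1 ∈ B := by rw [hW1]; exact mm
  have e1 : v * p ^ 2 * r ^ 2 + (K0 + v ^ 2 * K1) * r + v * (W0 + v ^ 2 * W1) = 0 := by
    rw [hK0, hK1, hW0, hW1]; linear_combination h1
  have e2 : r * (M0 + v ^ 2 * M1) = v * (N0 + v ^ 2 * N1) := by
    rw [hM0, hM1, hN0, hN1]
    clear * - h1 h2 two; grind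
  have e3 : v * (p ^ 2 * v ^ 2 * (N0 + v ^ 2 * N1) ^ 2
      + (K0 + v ^ 2 * K1) * (N0 + v ^ 2 * N1) * (M0 + v ^ 2 * M1)
      + (W0 + v ^ 2 * W1) * (M0 + v ^ 2 * M1) ^ 2) = 0 := by
    linear_combination (M0 + v ^ 2 * M1) ^ 2 * e1
      - (v * p ^ 2 * (r * (M0 + v ^ 2 * M1) + v * (N0 + v ^ 2 * N1))
        + (K0 + v ^ 2 * K1) * (M0 + v ^ 2 * M1)) * e2
  have e4 := canc hv e3
  have hlead : p ^ 2 * N1 ^ 2 + K1 * N1 * M1 + W1 * M1 ^ 2 ≠ 0 := by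
    have : p ^ 2 * N1 ^ 2 + K1 * N1 * M1 + W1 * M1 ^ 2 = a ^ 4 * p ^ 6 * (1 + a * p) := by
      rw [hN1, hK1, hM1, hW1]
      clear * - two; grind
    rw [this]
    exact mul_ne_zero (mul_ne_zero (pow_ne_zero _ ha) (pow_ne_zero _ hp)) hap
  have mV : v ^ 2 ∈ B := by
    refine rc3 hB (K0 * N0 * M0 + W0 * M0 ^ 2)
      (p ^ 2 * N0 ^ 2 + K1 * N0 * M0 + K0 * N1 * M0 + K0 * N0 * M1 + W1 * M0 ^ 2)
      (K1 * N1 * M0 + K1 * N0 * M1 + K0 * N1 * M1 + W0 * M1 ^ 2)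
      (p ^ 2 * N1 ^ 2 + K1 * N1 * M1 + W1 * M1 ^ 2) hlead ?_
    linear_combination e4 - (p ^ 2 * v ^ 4 * N0 * N1 + (W0 + v ^ 2 * W1) * v ^ 2 * M0 * M1) * two
  exact rc2 hB (v ^ 2) 0 1 one_ne_zero (by linear_combination v ^ 2 * two)

end
end Char2

theorem dim_le_of_quot {A : Type} [CommRing A] (n : WithBot ℕ∞)
    (H : ∀ P : PrimeSpectrum A, ringKrullDim (A ⧸ P.asIdeal) ≤ n) : ringKrullDim A ≤ n := by
  refine iSup_le fun l => ?_
  refine le_trans ?_ (H l.head)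
  rw [ringKrullDim_quotient]
  let L : LTSeries (PrimeSpectrum.zeroLocus (l.head.asIdeal : Set A)) :=
    { length := l.length
      toFun := fun i => ⟨l i, by
        rw [PrimeSpectrum.mem_zeroLocus]
        exact (l.head_le i : l.head.asIdeal ≤ (l i).asIdeal)⟩
      step := fun i => l.step i }
  exact le_iSup (fun L : LTSeries (PrimeSpectrum.zeroLocus (l.head.asIdeal : Set A)) =>
    (L.length : WithBot ℕ∞)) L

theorem upper_dim : ringKrullDim (SuzukiRing ⧸ IV) ≤ 2 := by
  refine dim_le_of_quot 2 fun P => ?_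
  let D := (SuzukiRing ⧸ IV) ⧸ P.asIdeal
  let φ : SuzukiRing →+* D := (Ideal.Quotient.mk P.asIdeal).comp (Ideal.Quotient.mk IV)
  have hφ : Function.Surjective φ :=
    Ideal.Quotient.mk_surjective.comp Ideal.Quotient.mk_surjective
  have : CharP D 2 := charP_of_injective_algebraMap (algebraMap (ZMod 2) D).injective 2
  have two : (2 : D) = 0 := CharTwo.two_eq_zero
  have hk : ∀ g ∈ IV, φ g = 0 := by
    intro g hg
    change Ideal.Quotient.mk P.asIdeal (Ideal.Quotient.mk IV g) = 0
    rw [Ideal.Quotient.eq_zero_iff_mem.2 hg, map_zero]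
  obtain ⟨a, ha⟩ : ∃ x, x = φ (X 0) := ⟨_, rfl⟩
  obtain ⟨b, hb⟩ : ∃ x, x = φ (X 1) := ⟨_, rfl⟩
  obtain ⟨v, hv⟩ : ∃ x, x = φ (X 4) := ⟨_, rfl⟩
  obtain ⟨z, hz⟩ : ∃ x, x = φ (X 5) + a ^ 2 * v + a * b := ⟨_, rfl⟩
  obtain ⟨p, hp⟩ : ∃ x, x = a + φ (X 2) := ⟨_, rfl⟩
  obtain ⟨r, hr⟩ : ∃ x, x = v + φ (X 6) := ⟨_, rfl⟩
  obtain ⟨q, hq⟩ : ∃ x, x = b + φ (X 3) + a * r := ⟨_, rfl⟩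
  obtain ⟨s, hs⟩ : ∃ x, x = z + b * p + a * (p * r + q) + (a + p) ^ 2 * (v + r)
    + (a + p) * (b + q + a * r) := ⟨_, rfl⟩
  obtain ⟨t, ht⟩ : ∃ x, x = φ (X 7) + s := ⟨_, rfl⟩
  have e2 : φ (X 2) = a + p := by linear_combination -hp - a * two
  have e6 : φ (X 6) = v + r := by linear_combination -hr - v * two
  have e3 : φ (X 3) = b + q + a * r := by linear_combination -hq - (b + a * r) * two
  have e5 : φ (X 5) = z + a ^ 2 * v + a * b := by
    linear_combination -hz - (a ^ 2 * v + a * b) * two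
  have e7 : φ (X 7) = t + s := by linear_combination -ht - s * two
  have e7' : φ (X 7) = t + z + b * p + a * (p * r + q) + (a + p) ^ 2 * (v + r)
      + (a + p) * (b + q + a * r) := by rw [e7, hs]; ring
  have h := (rel_iff φ a b v z p q r t ha.symm hb.symm hv.symm e5 e2 e6 e3 e7').1 hk
  refine Char2.upper h ?_
  intro B ma mb mv mz mp mq mr mt
  have ms : s ∈ B := by rw [hs]; exact Char2.mm
  rw [eq_top_iff]
  rintro x -
  obtain ⟨f, rfl⟩ := hφ x
  induction f using MvPolynomial.induction_on with
  | C c =>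
    obtain ⟨n, rfl⟩ := ZMod.intCast_surjective c
    rw [map_intCast, map_intCast]
    exact intCast_mem B _
  | add f g hf hg => rw [map_add]; exact add_mem hf hg
  | mul_X f i hf =>
    rw [map_mul]
    refine mul_mem hf ?_
    fin_cases i
    · exact ha ▸ ma
    · exact hb ▸ mb
    · change φ (X 2) ∈ B; rw [e2]; exact Char2.mm
    · change φ (X 3) ∈ B; rw [e3]; exact Char2.mm
    · exact hv ▸ mv
    · change φ (X 5) ∈ B; rw [e5]; exact Char2.mm
    · change φ (X 6) ∈ B; rw [e6]; exact Char2.mm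
    · change φ (X 7) ∈ B; rw [e7]; exact Char2.mm

namespace Char2
section
variable {D : Type} [CommRing D]

def lowG : EM := ef1
    (.poly [1])
    (.poly [1073741889])
    (.poly [64])
    (.poly [64, 16777280])
    (.poly [1, 4097])
    (.poly [65, 262209, 16781377, 17043521, 1073741889, 1074008129])
    (.poly [64, 262208])
    (.poly [64, 66, 262210, 266304, 16781378, 17043522, 1073745986, 1074008130])

def J0L : List Nat := [0, 270336, 33554560]
def J1L : List Nat := [0, 2, 128, 266240, 16777344, 1073741954, 2147483778]
def J2L : List Nat := [2, 8194, 266240, 17039488, 17043584, 33554560, 33554562]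
def J3L : List Nat := [2, 4098, 262144, 262146, 266242, 528384, 17043456, 33816704]
def J4L : List Nat := [0, 2, 8194, 262272, 266368, 524416, 528512, 16777344, 16777346, 17039490, 33554562]

theorem low00 [CharP D 2] {a v S L y B : D}
    (h : ∀ l ∈ [J0L, J1L, J2L, J3L, J4L], ev [a, v, S, L, y, B] l = 0) :
    (lowG 0 0).den [a, v, S, L, y, B] = 0 := by
  have key := E.sound [a, v, S, L, y, B]
    (.add (.add (lowG 0 0) (.add (.mul (.poly [262146, 262272, 524416, 528384, 16777344,
    16777346, 17039488, 17301632, 33554560, 33554562, 33816704, 33816706]) (.poly J0L)) (.mul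
    (.poly [0, 266240, 532480]) (.poly J1L)))) (.add (.mul (.poly [2, 4098, 262144, 16777344,
    17039488, 33554560, 33816704]) (.poly J2L)) (.add (.mul (.poly [4224, 266368, 16777344,
    16777346, 16781440, 17043584]) (.poly J3L)) (.mul (.poly [0, 2, 4098]) (.poly J4L))))) 6 rfl (by decide +kernel)
  simpa only [E.den, add_zero, mul_zero, h J0L (by simp), h J1L (by simp), h J2L (by simp), h J3L (by simp), h J4L (by simp)] using key

theorem low01 [CharP D 2] {a v S L y B : D}
    (h : ∀ l ∈ [J0L, J1L, J2L, J3L, J4L], ev [a, v, S, L, y, B] l = 0) :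
    (lowG 0 1).den [a, v, S, L, y, B] = 0 := by
  have key := E.sound [a, v, S, L, y, B]
    (.add (.add (lowG 0 1) (.add (.mul (.poly [1, 3, 4099, 262273, 16777345, 16777347,
    1074004097]) (.poly J0L)) (.mul (.poly [1]) (.poly J1L)))) (.add (.mul (.poly [3, 4097,
    4099, 16777345, 17039489]) (.poly J2L)) (.add (.mul (.poly [4225, 262273, 266369, 16777345,
    16777347, 1073741953]) (.poly J3L)) (.mul (.poly [3, 4097, 4099, 266241]) (.poly J4L))))) 6 rfl (by decide +kernel)
  simpa only [E.den, add_zero, mul_zero, h J0L (by simp), h J1L (by simp), h J2L (by simp), h J3L (by simp), h J4L (by simp)] using key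

theorem low02 [CharP D 2] {a v S L y B : D}
    (h : ∀ l ∈ [J0L, J1L, J2L, J3L, J4L], ev [a, v, S, L, y, B] l = 0) :
    (lowG 0 2).den [a, v, S, L, y, B] = 0 := by
  have key := E.sound [a, v, S, L, y, B]
    (.add (.add (lowG 0 2) (.add (.mul (.poly [262209, 1073741891, 1073745987, 1090519233,
    1090519235, 1090781377]) (.poly J0L)) (.mul (.poly [65, 4161, 262209, 266305, 1073741889])
    (.poly J1L)))) (.add (.mul (.poly [1073741889, 1073741891, 1073745987, 1090519233,
    1090781377]) (.poly J2L)) (.add (.mul (.poly [65, 1073742017, 1073746113, 1074004161,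
    1074008257, 1090519235]) (.poly J3L)) (.mul (.poly [1073741889, 1073741891, 1073745987,
    1074008129]) (.poly J4L))))) 6 rfl (by decide +kernel)
  simpa only [E.den, add_zero, mul_zero, h J0L (by simp), h J1L (by simp), h J2L (by simp), h J3L (by simp), h J4L (by simp)] using key

theorem low03 [CharP D 2] {a v S L y B : D}
    (h : ∀ l ∈ [J0L, J1L, J2L, J3L, J4L], ev [a, v, S, L, y, B] l = 0) :
    (lowG 0 3).den [a, v, S, L, y, B] = 0 := by
  have key := E.sound [a, v, S, L, y, B]
    (.add (.add (lowG 0 3) (.add (.mul (.poly [66, 8258, 266304, 16777280, 16777408, 16777410,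
    17043648]) (.poly J0L)) (.mul (.poly [64]) (.poly J1L)))) (.add (.mul (.poly [64, 66, 4162,
    266304, 270400, 16777408, 17039552]) (.poly J2L)) (.add (.mul (.poly [192, 4160, 4288,
    262336, 266432, 16777408, 16777410, 16781504]) (.poly J3L)) (.mul (.poly [64, 66, 4162,
    266304]) (.poly J4L))))) 6 rfl (by decide +kernel)
  simpa only [E.den, add_zero, mul_zero, h J0L (by simp), h J1L (by simp), h J2L (by simp), h J3L (by simp), h J4L (by simp)] using key

theorem low10 [CharP D 2] {a v S L y B : D}
    (h : ∀ l ∈ [J0L, J1L, J2L, J3L, J4L], ev [a, v, S, L, y, B] l = 0) :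
    (lowG 1 0).den [a, v, S, L, y, B] = 0 := by
  have key := E.sound [a, v, S, L, y, B]
    (.add (.add (lowG 1 0) (.mul (.poly [1, 262273, 266241, 274435, 524417, 16777347, 16781443,
    17043587, 17305729, 17309825, 33554561, 33554563, 33558657, 33558659, 33820801, 50594049,
    1090519169, 1090519171]) (.poly J0L))) (.add (.mul (.poly [266241, 536577]) (.poly J1L))
    (.add (.mul (.poly [4097, 266241, 536577, 17039489, 33554561, 33558657, 1090519169]) (.poly
    J2L)) (.mul (.poly [129, 266369, 16785537, 50331905, 1073741953, 1073746049]) (.poly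
    J3L))))) 6 rfl (by decide +kernel)
  simpa only [E.den, add_zero, mul_zero, h J0L (by simp), h J1L (by simp), h J2L (by simp), h J3L (by simp), h J4L (by simp)] using key

theorem low11 [CharP D 2] {a v S L y B : D}
    (h : ∀ l ∈ [J0L, J1L, J2L, J3L, J4L], ev [a, v, S, L, y, B] l = 0) :
    (lowG 1 1).den [a, v, S, L, y, B] = 0 := by
  have key := E.sound [a, v, S, L, y, B]
    (.add (.add (lowG 1 1) (.add (.mul (.poly [262146, 266370, 528384, 528512, 17039490,
    17043584, 17043586, 17301632, 33816704, 33816706, 1074008194]) (.poly J0L)) (.mul (.poly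
    [0, 266240, 532480]) (.poly J1L)))) (.add (.mul (.poly [2, 4098, 262144, 17043584,
    33816704]) (.poly J2L)) (.add (.mul (.poly [4226, 270464, 16777346, 17043584, 1073746050])
    (.poly J3L)) (.mul (.poly [0, 2, 4098]) (.poly J4L))))) 6 rfl (by decide +kernel)
  simpa only [E.den, add_zero, mul_zero, h J0L (by simp), h J1L (by simp), h J2L (by simp), h J3L (by simp), h J4L (by simp)] using key

theorem low12 [CharP D 2] {a v S L y B : D}
    (h : ∀ l ∈ [J0L, J1L, J2L, J3L, J4L], ev [a, v, S, L, y, B] l = 0) :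
    (lowG 1 2).den [a, v, S, L, y, B] = 0 := by
  have key := E.sound [a, v, S, L, y, B]
    (.add (.add (lowG 1 2) (.add (.mul (.poly [68, 194, 4162, 262208, 16777280, 16777282,
    16777408, 17039552, 1073742020, 2147483844]) (.poly J0L)) (.mul (.poly [64, 4162, 266304,
    266306, 16777280, 17039552, 17043648, 33554624]) (.poly J1L)))) (.add (.mul (.poly [192,
    4162, 266304, 16777280, 17039552, 1073742018, 2147483842]) (.poly J2L)) (.add (.mul (.poly
    [192, 4160, 4162, 4288, 262336, 266432, 16777410]) (.poly J3L)) (.mul (.poly [64, 66, 4162,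
    266304]) (.poly J4L))))) 6 rfl (by decide +kernel)
  simpa only [E.den, add_zero, mul_zero, h J0L (by simp), h J1L (by simp), h J2L (by simp), h J3L (by simp), h J4L (by simp)] using key

theorem low13 [CharP D 2] {a v S L y B : D}
    (h : ∀ l ∈ [J0L, J1L, J2L, J3L, J4L], ev [a, v, S, L, y, B] l = 0) :
    (lowG 1 3).den [a, v, S, L, y, B] = 0 := by
  have key := E.sound [a, v, S, L, y, B]
    (.add (.add (lowG 1 3) (.add (.mul (.poly [67, 4163, 262209, 16777409, 16777411, 17039553,
    1073741891, 1073745987, 1090519233, 1090519235, 1090781377]) (.poly J0L)) (.mul (.poly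
    [4161, 262209, 266305, 1073741889]) (.poly J1L)))) (.add (.mul (.poly [65, 67, 4163,
    16777409, 17039553, 1073741889, 1073741891, 1073745987, 1090519233, 1090781377]) (.poly
    J2L)) (.add (.mul (.poly [65, 193, 4289, 262337, 266433, 16777411, 1073742017, 1073746113,
    1074004161, 1074008257, 1090519235]) (.poly J3L)) (.mul (.poly [65, 67, 4163, 266305,
    1073741889, 1073741891, 1073745987, 1074008129]) (.poly J4L))))) 6 rfl (by decide +kernel)
  simpa only [E.den, add_zero, mul_zero, h J0L (by simp), h J1L (by simp), h J2L (by simp), h J3L (by simp), h J4L (by simp)] using key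

theorem low20 [CharP D 2] {a v S L y B : D}
    (h : ∀ l ∈ [J0L, J1L, J2L, J3L, J4L], ev [a, v, S, L, y, B] l = 0) :
    (lowG 2 0).den [a, v, S, L, y, B] = 0 := by
  have key := E.sound [a, v, S, L, y, B]
    (.add (.add (lowG 2 0) (.add (.mul (.poly [65, 69, 4163, 8259, 8261, 262211, 262213,
    266307, 266433, 270405, 274499, 524353, 524481, 528449, 528451, 528577, 532545, 536643,
    790593, 790595, 794691, 798785, 1056833, 16777281, 16777287, 16777409, 16781379, 16781381,
    16781383, 16781507, 16785477, 17039427, 17039431, 17039555, 17043523, 17043525, 17043527,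
    17043651, 17047619, 17301699, 17305665, 17305669, 17305793, 17313857, 17563841, 33554499,
    33558721, 33558723, 33562691, 33816771, 33820741, 33820867, 33824833, 33824835, 34083009,
    34086977, 34087105, 50335937, 50335939, 50593985, 50594113, 50598083, 50860227, 67109057,
    67109059, 1073741891, 1073741893, 1073750085, 1074004033, 1074004035, 1074004037,
    1074004161, 1074008131, 1074008259, 1074012227, 1074012229, 1074266177, 1074266307,
    1074270275, 1074270401, 1074270403, 1074274369, 1074274371, 1074528449, 1074536513,
    1090519107, 1090527299, 1090781377, 1090785345, 1090785347, 1090785473, 1090789441,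
    1090789443, 1091043521, 1091043523, 1091047489, 1091047619, 1091051585, 1091305665,
    1107562689, 1107820739, 1107824835, 1124073665, 1124073667, 2147750083, 2148008131,
    2164523203, 2164789443, 3221754051]) (.poly J0L)) (.mul (.poly [65, 4161, 262209, 266305,
    270401, 524353, 17039425, 17047617, 17305665, 17313857, 33820865, 34078913, 34083009,
    50593985, 50860225, 1074008129, 1074270273, 1107824833]) (.poly J1L)))) (.add (.mul (.poly
    [65, 67, 8259, 266305, 270401, 524355, 532547, 790593, 16777281, 16777283, 16777285,
    16777409, 16781377, 16781381, 16785475, 17039427, 17039429, 17043523, 17043525, 17301697,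
    17571905, 33554497, 33558721, 33816769, 33820737, 33820739, 33820865, 34086977, 50335937,
    50598081, 67109057, 1073745987, 1073750083, 1074004035, 1074008129, 1074008131, 1074012225,
    1074266179, 1074274371, 1074532417, 1090519105, 1090781377, 1091043521, 1091047489,
    1091051585, 1107558593, 1124073665]) (.poly J2L)) (.add (.mul (.poly [193, 4161, 4289,
    8259, 12355, 262211, 266305, 266307, 524481, 528577, 540737, 798785, 16777281, 16777283,
    16777409, 16781377, 16785475, 16785477, 16785601, 16789571, 17039553, 17047621, 17051713,
    17301697, 17309761, 17313857, 33558721, 33562817, 33820865, 50331969, 50598083, 1073741891,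
    1073742017, 1073745985, 1073754179, 1074004033, 1074004035, 1074004161, 1074008129,
    1074008131, 1074008257, 1074012225, 1074016321, 1074270273, 1074270401, 1074278465,
    1090523329, 1090781377, 1091043521, 1107296451, 1107558595, 1107562691]) (.poly J3L)) (.mul
    (.poly [4161, 528449, 1073741889, 1074004033]) (.poly J4L))))) 6 rfl (by decide +kernel)
  simpa only [E.den, add_zero, mul_zero, h J0L (by simp), h J1L (by simp), h J2L (by simp), h J3L (by simp), h J4L (by simp)] using key

theorem low21 [CharP D 2] {a v S L y B : D}
    (h : ∀ l ∈ [J0L, J1L, J2L, J3L, J4L], ev [a, v, S, L, y, B] l = 0) :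
    (lowG 2 1).den [a, v, S, L, y, B] = 0 := by
  have key := E.sound [a, v, S, L, y, B]
    (.add (.add (lowG 2 1) (.add (.mul (.poly [66, 4164, 8260, 262210, 262336, 266306, 266308,
    270402, 270404, 524352, 524354, 524356, 528448, 532548, 786624, 790594, 794688, 794690,
    16777280, 16777282, 16785474, 17039552, 17039554, 17043648, 17043650, 17305664, 17305666,
    17305792, 17305794, 17309762, 17563840, 33554624, 33554626, 33816768, 33816772]) (.poly
    J0L)) (.mul (.poly [266304, 798784, 16777280, 17309760]) (.poly J1L)))) (.add (.mul (.poly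
    [4162, 8258, 266306, 524354, 528448, 790592, 16777280, 17039552, 17043648, 17301696,
    17305664, 33554624, 33816768, 33816770]) (.poly J2L)) (.add (.mul (.poly [192, 4160, 4162,
    12354, 262208, 262336, 266304, 270402, 270528, 528448, 528576, 532546, 536642, 16777408,
    16781504, 17301696]) (.poly J3L)) (.mul (.poly [64]) (.poly J4L))))) 6 rfl (by decide +kernel)
  simpa only [E.den, add_zero, mul_zero, h J0L (by simp), h J1L (by simp), h J2L (by simp), h J3L (by simp), h J4L (by simp)] using key

theorem low22 [CharP D 2] {a v S L y B : D}
    (h : ∀ l ∈ [J0L, J1L, J2L, J3L, J4L], ev [a, v, S, L, y, B] l = 0) :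
    (lowG 2 2).den [a, v, S, L, y, B] = 0 := by
  have key := E.sound [a, v, S, L, y, B]
    (.add (.add (lowG 2 2) (.add (.mul (.poly [262146, 528384, 528512, 17039490, 17043584,
    17043586, 17301632, 33816704, 33816706, 1074008194]) (.poly J0L)) (.mul (.poly [0, 266240,
    532480]) (.poly J1L)))) (.add (.mul (.poly [2, 4098, 262144, 17043584, 33816704]) (.poly
    J2L)) (.add (.mul (.poly [270464, 16777346, 17043584, 1073746050]) (.poly J3L)) (.mul
    (.poly [0, 2, 4098]) (.poly J4L))))) 6 rfl (by decide +kernel)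
  simpa only [E.den, add_zero, mul_zero, h J0L (by simp), h J1L (by simp), h J2L (by simp), h J3L (by simp), h J4L (by simp)] using key

theorem low23 [CharP D 2] {a v S L y B : D}
    (h : ∀ l ∈ [J0L, J1L, J2L, J3L, J4L], ev [a, v, S, L, y, B] l = 0) :
    (lowG 2 3).den [a, v, S, L, y, B] = 0 := by
  have key := E.sound [a, v, S, L, y, B]
    (.add (.add (lowG 2 3) (.add (.mul (.poly [1, 3, 4099, 16777345, 16777347, 1074004097])
    (.poly J0L)) (.mul (.poly [1]) (.poly J1L)))) (.add (.mul (.poly [3, 4097, 4099, 16777345,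
    17039489]) (.poly J2L)) (.add (.mul (.poly [129, 4225, 262273, 266369, 16777345, 16777347,
    1073741953]) (.poly J3L)) (.mul (.poly [3, 4097, 4099, 266241]) (.poly J4L))))) 6 rfl (by decide +kernel)
  simpa only [E.den, add_zero, mul_zero, h J0L (by simp), h J1L (by simp), h J2L (by simp), h J3L (by simp), h J4L (by simp)] using key

theorem low30 [CharP D 2] {a v S L y B : D}
    (h : ∀ l ∈ [J0L, J1L, J2L, J3L, J4L], ev [a, v, S, L, y, B] l = 0) :
    (lowG 3 0).den [a, v, S, L, y, B] = 0 := by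
  have key := E.sound [a, v, S, L, y, B]
    (.add (.add (lowG 3 0) (.add (.mul (.poly [64, 194, 4162, 8260, 8386, 12356, 262208,
    262338, 266304, 266308, 266434, 270402, 270404, 270530, 274498, 274500, 524352, 524354,
    524356, 524480, 528576, 532548, 790594, 794690, 16777280, 16777284, 16777408, 16777410,
    16777412, 16781506, 16781508, 16785474, 16785602, 17039552, 17039554, 17039556, 17043648,
    17043652, 17047616, 17047620, 17047746, 17301698, 17305664, 17305666, 17305794, 17309762,
    17309888, 17309890, 17563840, 33554624, 33554626, 33558720, 33558722, 33816768, 33816772,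
    33816896, 33820864, 34079040, 50331840, 50331844, 50331968, 50331970, 50594114, 1073742020,
    1073746116, 1074004164, 2147483844, 2147487940, 2147745988]) (.poly J0L)) (.mul (.poly
    [4162, 8258, 262208, 262210, 266304, 536642, 794688, 16785474, 17039552, 17043648,
    17309762, 33554624, 33558722, 33816770]) (.poly J1L)))) (.add (.mul (.poly [64, 192, 4160,
    4162, 12354, 274498, 524354, 536640, 536642, 790592, 16777282, 16777408, 17043520,
    17305664, 17305792, 17309762, 33554624, 33558720, 33816770, 50331840, 50331842, 50331968,
    1073742018, 2147483842]) (.poly J2L)) (.add (.mul (.poly [192, 194, 4288, 4290, 12354,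
    262208, 262336, 262338, 266304, 266432, 266434, 270402, 274496, 528448, 532544, 532546,
    536642, 16785600, 17047744, 17301696, 33558848, 33816896, 50331970]) (.poly J3L)) (.mul
    (.poly [8258, 12354, 262210, 266304, 266306]) (.poly J4L))))) 6 rfl (by decide +kernel)
  simpa only [E.den, add_zero, mul_zero, h J0L (by simp), h J1L (by simp), h J2L (by simp), h J3L (by simp), h J4L (by simp)] using key

theorem low31 [CharP D 2] {a v S L y B : D}
    (h : ∀ l ∈ [J0L, J1L, J2L, J3L, J4L], ev [a, v, S, L, y, B] l = 0) :
    (lowG 3 1).den [a, v, S, L, y, B] = 0 := by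
  have key := E.sound [a, v, S, L, y, B]
    (.add (.add (lowG 3 1) (.add (.mul (.poly [65, 4163, 262211, 262337, 266305, 266307,
    266433, 270403, 274499, 524481, 528449, 528451, 532545, 536643, 786625, 790593, 790595,
    794691, 798785, 1056833, 16777281, 16777283, 16777409, 16781381, 16781507, 16785477,
    17039425, 17039427, 17039553, 17043521, 17043523, 17043525, 17043649, 17043651, 17047619,
    17047621, 17301697, 17305667, 17305793, 17313857, 33554499, 33558721, 33558723, 33562691,
    33816771, 33820737, 33820865, 33820867, 33824833, 33824835, 34078913, 34083009, 34086977,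
    34087105, 50335937, 50335939, 50593985, 50594113, 50598083, 50860227, 67109057, 67109059,
    1073741891, 1073741893, 1073750085, 1074004033, 1074004035, 1074004037, 1074004161,
    1074008131, 1074008259, 1074012227, 1074012229, 1074266177, 1074266307, 1074270275,
    1074270401, 1074274369, 1074274371, 1074528449, 1074536513, 1090519107, 1090527299,
    1090781377, 1090785345, 1090785347, 1090785473, 1090789441, 1090789443, 1091043521,
    1091043523, 1091047489, 1091047619, 1091051585, 1091305665, 1107562689, 1107820739,
    1107824835, 1124073665, 1124073667, 2147750083, 2148008131, 2148012227, 2164523203,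
    2164789443, 3221754051]) (.poly J0L)) (.mul (.poly [65, 4161, 262209, 270401, 524353,
    528449, 17039425, 17047617, 17305665, 17313857, 33820865, 34078913, 50593985, 50860225,
    1074008129, 1074270273, 1107824833]) (.poly J1L)))) (.add (.mul (.poly [65, 262209, 528449,
    16777281, 16777409, 16781377, 16781379, 16785475, 17039553, 17043521, 17047617, 17305667,
    17309763, 17571905, 33554497, 33558721, 33816769, 33820865, 34086977, 50335937, 50598081,
    67109057, 1073745987, 1073750083, 1074004035, 1074008129, 1074008131, 1074012225,
    1074266179, 1074274371, 1074532417, 1090519105, 1090781377, 1091043521, 1091047489,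
    1091051585, 1107558593, 1124073665]) (.poly J2L)) (.add (.mul (.poly [65, 4161, 4289,
    262209, 262337, 266433, 524481, 528449, 540737, 798785, 16777409, 16781377, 16781505,
    16785601, 16789571, 17039553, 17043521, 17043523, 17043649, 17047617, 17051713, 17309761,
    17313857, 33562817, 33816769, 33820865, 50331969, 50598083, 1073741891, 1073742017,
    1073745985, 1073754179, 1074004033, 1074004035, 1074004161, 1074008129, 1074008131,
    1074008257, 1074012225, 1074016321, 1074270273, 1074270401, 1074278465, 1090523329,
    1090781377, 1091043521, 1107296451, 1107558595, 1107562691]) (.poly J3L)) (.mul (.poly [65,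
    4161, 262209, 528449, 1073741889, 1074004033]) (.poly J4L))))) 6 rfl (by decide +kernel)
  simpa only [E.den, add_zero, mul_zero, h J0L (by simp), h J1L (by simp), h J2L (by simp), h J3L (by simp), h J4L (by simp)] using key

theorem low32 [CharP D 2] {a v S L y B : D}
    (h : ∀ l ∈ [J0L, J1L, J2L, J3L, J4L], ev [a, v, S, L, y, B] l = 0) :
    (lowG 3 2).den [a, v, S, L, y, B] = 0 := by
  have key := E.sound [a, v, S, L, y, B]
    (.add (.add (lowG 3 2) (.mul (.poly [1, 262273, 266241, 274435, 524417, 16777345, 16781443,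
    17043587, 17305729, 17309825, 33554561, 33554563, 33558657, 33558659, 33820801, 50594049,
    1090519169, 1090519171]) (.poly J0L))) (.add (.mul (.poly [266241, 536577]) (.poly J1L))
    (.add (.mul (.poly [4097, 266241, 536577, 16777345, 17039489, 33554561, 33558657,
    1090519169]) (.poly J2L)) (.mul (.poly [4225, 266369, 16785537, 50331905, 1073741953,
    1073746049]) (.poly J3L))))) 6 rfl (by decide +kernel)
  simpa only [E.den, add_zero, mul_zero, h J0L (by simp), h J1L (by simp), h J2L (by simp), h J3L (by simp), h J4L (by simp)] using key

theorem low33 [CharP D 2] {a v S L y B : D}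
    (h : ∀ l ∈ [J0L, J1L, J2L, J3L, J4L], ev [a, v, S, L, y, B] l = 0) :
    (lowG 3 3).den [a, v, S, L, y, B] = 0 := by
  have key := E.sound [a, v, S, L, y, B]
    (.add (.add (lowG 3 3) (.add (.mul (.poly [262146, 262272, 524416, 528384, 16777344,
    16777346, 17039488, 17301632, 33554560, 33554562, 33816704, 33816706]) (.poly J0L)) (.mul
    (.poly [0, 266240, 532480]) (.poly J1L)))) (.add (.mul (.poly [2, 4098, 262144, 16777344,
    17039488, 33554560, 33816704]) (.poly J2L)) (.add (.mul (.poly [4224, 266368, 16777344,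
    16777346, 16781440, 17043584]) (.poly J3L)) (.mul (.poly [0, 2, 4098]) (.poly J4L))))) 6 rfl (by decide +kernel)
  simpa only [E.den, add_zero, mul_zero, h J0L (by simp), h J1L (by simp), h J2L (by simp), h J3L (by simp), h J4L (by simp)] using key

end
end Char2

namespace Char2

theorem low_form1 {D : Type} [CommRing D] [CharP D 2] {a v S L y B : D}
    (h0 : S ^ 2 * L + v ^ 2 * y ^ 2 + 1 = 0)
    (h1 : a ^ 2 * v ^ 2 * B ^ 2 + a ^ 2 * v ^ 2 * B + S * L + v ^ 2 * y + a ^ 2 + v ^ 2 + 1 = 0)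
    (h2 : v ^ 2 * S * L * y + a ^ 2 * v ^ 2 * y ^ 2 + a ^ 2 * S ^ 2 + v ^ 2 * L * y + v ^ 2 * y ^ 2
      + S * L + a ^ 2 = 0)
    (h3 : v ^ 2 * L * y ^ 2 + a ^ 2 * S * L + S * L ^ 2 + S * L * y + a ^ 2 * S + a ^ 2 * L + a ^ 2
      + L = 0)
    (h4 : v ^ 2 * S * L ^ 2 + a ^ 2 * v ^ 2 * L * y + a ^ 2 * v ^ 2 * y ^ 2 + a ^ 2 * S ^ 2
      + v ^ 2 * S * L + v ^ 2 * L ^ 2 + a ^ 2 * v ^ 2 * y + v ^ 2 * L + v ^ 2 * y + a ^ 2 + 1 = 0) :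
    ∃ b z q t : D, form1 a b v z (a * (S + 1)) q (v * (L + 1)) t = 0 := by
  have h : ∀ l ∈ [J0L, J1L, J2L, J3L, J4L], ev [a, v, S, L, y, B] l = 0 := by
    intro l hl
    simp only [List.mem_cons, List.not_mem_nil, or_false] at hl
    rcases hl with rfl | rfl | rfl | rfl | rfl
    · simp only [J0L, ev, mon, Nat.reduceMod, Nat.reduceDiv]
      linear_combination h0
    · simp only [J1L, ev, mon, Nat.reduceMod, Nat.reduceDiv]
      linear_combination h1
    · simp only [J2L, ev, mon, Nat.reduceMod, Nat.reduceDiv]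
      linear_combination h2
    · simp only [J3L, ev, mon, Nat.reduceMod, Nat.reduceDiv]
      linear_combination h3
    · simp only [J4L, ev, mon, Nat.reduceMod, Nat.reduceDiv]
      linear_combination h4
  have key : dM [a, v, S, L, y, B] lowG = 0 := by
    ext i j
    fin_cases i <;> fin_cases j
    exacts [low00 h, low01 h, low02 h, low03 h, low10 h, low11 h, low12 h, low13 h,
      low20 h, low21 h, low22 h, low23 h, low30 h, low31 h, low32 h, low33 h]
  rw [lowG, dM_ef1] at key
  have e1 : E.den [a, v, S, L, y, B] (E.poly [1]) = a := by simp [E.den, ev, mon]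
  have e2 : E.den [a, v, S, L, y, B] (E.poly [64]) = v := by simp [E.den, ev, mon]
  have e3 : E.den [a, v, S, L, y, B] (E.poly [1, 4097]) = a * (S + 1) := by
    simp [E.den, ev, mon]; ring
  have e4 : E.den [a, v, S, L, y, B] (E.poly [64, 262208]) = v * (L + 1) := by
    simp [E.den, ev, mon]; ring
  rw [e1, e2, e3, e4] at key
  exact ⟨_, _, _, _, key⟩

theorem quad_root {K : Type} [Field K] [IsAlgClosed K] (c0 c1 c2 : K) (h : c2 ≠ 0) :
    ∃ x : K, c2 * x ^ 2 + c1 * x + c0 = 0 := by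
  obtain ⟨x, hx⟩ := IsAlgClosed.exists_root
    (Polynomial.C c2 * Polynomial.X ^ 2 + Polynomial.C c1 * Polynomial.X + Polynomial.C c0)
    (by rw [Polynomial.degree_quadratic h]; norm_num)
  exact ⟨x, by simpa [Polynomial.IsRoot] using hx⟩

theorem low_point {K : Type} [Field K] [IsAlgClosed K] [CharP K 2] (S L : K) (hS : S ≠ 0)
    (hL : L ≠ 0) (hs : S + 1 ≠ 0) (hk : L + 1 ≠ 0) (hm : L * S + 1 ≠ 0) :
    ∃ a v b z q t : K, a ≠ 0 ∧ v ≠ 0 ∧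
      form1 a b v z (a * (S + 1)) q (v * (L + 1)) t = 0 := by
  have two : (2 : K) = 0 := CharTwo.two_eq_zero
  obtain ⟨V, hV⟩ := quad_root (L ^ 2 * S ^ 6)
    ((L * S + 1) ^ 2 * (S + 1) ^ 2 * (S ^ 2 * L + 1)) (L ^ 2 * (S + 1) ^ 4)
    (mul_ne_zero (pow_ne_zero _ hL) (pow_ne_zero _ hs))
  have V0 : V ≠ 0 := by
    rintro rfl
    have : L ^ 2 * S ^ 6 = 0 := by linear_combination hV
    exact mul_ne_zero (pow_ne_zero _ hL) (pow_ne_zero _ hS) this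
  obtain ⟨y, hy⟩ : ∃ y : K, (L * S + 1) * (S + 1) * V * y = L * S ^ 3 + L * (S + 1) ^ 2 * V :=
    ⟨(L * S ^ 3 + L * (S + 1) ^ 2 * V) / ((L * S + 1) * (S + 1) * V),
      mul_div_cancel₀ _ (mul_ne_zero (mul_ne_zero hm hs) V0)⟩
  have d2 : S ^ 2 * (L + 1) * (L * S + 1) ≠ 0 :=
    mul_ne_zero (mul_ne_zero (pow_ne_zero _ hS) hk) hm
  obtain ⟨A, hA⟩ : ∃ A : K, S ^ 2 * (L + 1) * (L * S + 1) * A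
      = L ^ 2 * (S + 1) ^ 2 * V + L ^ 2 * S ^ 2 + L * S ^ 2 + 1 :=
    ⟨_, mul_div_cancel₀ _ d2⟩
  have A0 : A ≠ 0 := by
    rintro rfl
    have hw : L ^ 2 * (S + 1) ^ 2 * V = L ^ 2 * S ^ 2 + L * S ^ 2 + 1 := by
      linear_combination -hA - (L ^ 2 * S ^ 2 + L * S ^ 2 + 1) * two
    have h1 : (L ^ 2 * (S + 1) ^ 2 * V) ^ 2
        + (L * S + 1) ^ 2 * (S ^ 2 * L + 1) * (L ^ 2 * (S + 1) ^ 2 * V) + L ^ 4 * S ^ 6 = 0 := by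
      linear_combination L ^ 2 * hV
    rw [hw] at h1
    have h2 : L ^ 3 * S ^ 4 * (L * S + 1) ^ 2 = 0 := by
      clear * - h1 two
      grind
    exact mul_ne_zero (mul_ne_zero (pow_ne_zero _ hL) (pow_ne_zero _ hS)) (pow_ne_zero _ hm) h2
  obtain ⟨B, hB⟩ := quad_root (S * L + V * y + A + V + 1) (A * V) (A * V) (mul_ne_zero A0 V0)
  obtain ⟨a, rfl⟩ := IsAlgClosed.exists_pow_nat_eq A (n := 2) (by norm_num)
  obtain ⟨v, rfl⟩ := IsAlgClosed.exists_pow_nat_eq V (n := 2) (by norm_num)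
  have R4 : L * S ^ 3 + (L * S + 1) * (S + 1) * v ^ 2 * y + L * (S + 1) ^ 2 * v ^ 2 = 0 := by
    linear_combination hy + (L * S ^ 3 + L * (S + 1) ^ 2 * v ^ 2) * two
  have R2 : a ^ 2 * S ^ 2 * (L + 1) * (L * S + 1) + L ^ 2 * (S + 1) ^ 2 * v ^ 2 + L ^ 2 * S ^ 2
      + L * S ^ 2 + 1 = 0 := by
    linear_combination hA + (L ^ 2 * (S + 1) ^ 2 * v ^ 2 + L ^ 2 * S ^ 2 + L * S ^ 2 + 1) * two
  have h0 : S ^ 2 * L + v ^ 2 * y ^ 2 + 1 = 0 := by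
    have : ((L * S + 1) ^ 2 * (S + 1) ^ 2 * v ^ 2) * (S ^ 2 * L + v ^ 2 * y ^ 2 + 1) = 0 := by
      linear_combination hV + ((L * S + 1) * (S + 1) * v ^ 2 * y + L * S ^ 3
        + L * (S + 1) ^ 2 * v ^ 2) * hy + L ^ 2 * S ^ 3 * (S + 1) ^ 2 * v ^ 2 * two
    exact canc (mul_ne_zero (mul_ne_zero (pow_ne_zero _ hm) (pow_ne_zero _ hs)) V0) this
  have h1 : a ^ 2 * v ^ 2 * B ^ 2 + a ^ 2 * v ^ 2 * B + S * L + v ^ 2 * y + a ^ 2 + v ^ 2 + 1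
      = 0 := by linear_combination hB
  have h2 : v ^ 2 * S * L * y + a ^ 2 * v ^ 2 * y ^ 2 + a ^ 2 * S ^ 2 + v ^ 2 * L * y
      + v ^ 2 * y ^ 2 + S * L + a ^ 2 = 0 := by
    apply canc hm
    generalize v ^ 2 = V at *
    generalize a ^ 2 = A at *
    clear * - h0 R2 R4 two
    have := congrArg₂ (· + ·) (congrArg (fun x => (1 + A + S * L + A * S * L) * x) h0)
      (congrArg₂ (· + ·) R2 (congrArg (fun x => L * x) R4))
    simp only [mul_zero, add_zero] at this
    grind
  have h3 : v ^ 2 * L * y ^ 2 + a ^ 2 * S * L + S * L ^ 2 + S * L * y + a ^ 2 * S + a ^ 2 * L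
      + a ^ 2 + L = 0 := by
    apply canc (pow_ne_zero 2 hS)
    generalize v ^ 2 = V at *
    generalize a ^ 2 = A at *
    clear * - h0 h2 R4 two
    have := congrArg₂ (· + ·) (congrArg (fun x => (A + A * S + S * L) * x) h0)
      (congrArg₂ (· + ·) (congrArg (fun x => (1 + S) * x) h2) (congrArg (fun x => y * x) R4))
    simp only [mul_zero, add_zero] at this
    clear h0 h2 R4
    grind
  have h4 : v ^ 2 * S * L ^ 2 + a ^ 2 * v ^ 2 * L * y + a ^ 2 * v ^ 2 * y ^ 2 + a ^ 2 * S ^ 2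
      + v ^ 2 * S * L + v ^ 2 * L ^ 2 + a ^ 2 * v ^ 2 * y + v ^ 2 * L + v ^ 2 * y + a ^ 2 + 1
      = 0 := by
    apply canc hs
    generalize v ^ 2 = V at *
    generalize a ^ 2 = A at *
    clear * - h0 h2 h3 R4 two
    have := congrArg₂ (· + ·) (congrArg₂ (· + ·) (congrArg (fun x => (V * y) * x) h3)
      (congrArg (fun x => (1 + S + S * L + V * L * y) * x) h0))
      (congrArg₂ (· + ·) (congrArg (fun x => (1 + S) * x) h2) (congrArg (fun x => (1 + L) * x) R4))
    simp only [mul_zero, add_zero] at this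
    clear h0 h2 h3 R4
    grind
  obtain ⟨b, z, q, t, hf⟩ := low_form1 h0 h1 h2 h3 h4
  exact ⟨a, v, b, z, q, t, by rintro rfl; simp at A0, by rintro rfl; simp at V0, hf⟩

end Char2

theorem two_le_dim {K : Type} [Field K] [Algebra (ZMod 2) K] (f : SuzukiRing →ₐ[ZMod 2] K)
    (x : Fin 2 → K) (hx : AlgebraicIndependent (ZMod 2) x)
    (m : Fin 2 → K) (hm : ∀ i, m i ≠ 0) (h1 : ∀ i, m i ∈ f.range) (h2 : ∀ i, m i * x i ∈ f.range) :
    2 ≤ ringKrullDim f.range := by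
  have : Algebra.FiniteType (ZMod 2) f.range :=
    Algebra.FiniteType.of_surjective f.rangeRestrict f.rangeRestrict_surjective
  obtain ⟨s, e1, e2⟩ := dim_eq_trdeg (ZMod 2) f.range
  let A : Subalgebra f.range K := Subalgebra.algebraicClosure f.range K
  have hA : ∀ i, x i ∈ A := by
    intro i
    change IsAlgebraic f.range (x i)
    refine ⟨Polynomial.C ⟨m i, h1 i⟩ * Polynomial.X - Polynomial.C ⟨m i * x i, h2 i⟩, ?_, ?_⟩
    · intro h
      have := congrArg (fun g => Polynomial.coeff g 1) h
      simp only [Polynomial.coeff_sub, Polynomial.coeff_C_mul, Polynomial.coeff_X_one,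
        Polynomial.coeff_C_succ, mul_one, sub_zero, Polynomial.coeff_zero] at this
      exact hm i (congrArg Subtype.val this)
    · rw [map_sub, map_mul, Polynomial.aeval_C, Polynomial.aeval_X, Polynomial.aeval_C]
      exact sub_self _
  let x' : Fin 2 → A := fun i => ⟨x i, hA i⟩
  have hx' : AlgebraicIndependent (ZMod 2) x' := by
    have : AlgebraicIndependent (ZMod 2) ((A.val.restrictScalars (ZMod 2)) ∘ x') := hx
    exact AlgebraicIndependent.of_comp _ this
  have h3 := hx'.cardinalMk_le_trdeg
  have : Algebra.IsAlgebraic f.range A := inferInstance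
  have : FaithfulSMul f.range A := (faithfulSMul_iff_algebraMap_injective f.range A).2
    fun g g' hg => Subtype.ext (congrArg (fun z : A => (z : K)) hg)
  have h4 := trdeg_add_eq (ZMod 2) f.range (A := A)
  rw [trdeg_eq_zero (R := f.range) (A := A), add_zero] at h4
  rw [← h4, e2] at h3
  have h5 : 2 ≤ s := by simpa using h3
  rw [e1]
  exact_mod_cast h5

theorem lower_dim : 2 ≤ ringKrullDim (SuzukiRing ⧸ IV) := by
  let P2 := MvPolynomial (Fin 2) (ZMod 2)
  let K := AlgebraicClosure (FractionRing P2)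
  have hinj : Function.Injective (algebraMap P2 K) := by
    rw [IsScalarTower.algebraMap_eq P2 (FractionRing P2) K]
    exact (algebraMap (FractionRing P2) K).injective.comp (IsFractionRing.injective _ _)
  have hne : ∀ g : P2, (∃ c : Fin 2 → ZMod 2, eval c g ≠ 0) → algebraMap P2 K g ≠ 0 := by
    rintro g ⟨c, hc⟩ h
    rw [map_eq_zero_iff _ hinj] at h
    rw [h] at hc
    simp at hc
  have hne' : ∀ g : P2, (∃ c : Fin 2 → ZMod 2, eval c (g + 1) ≠ 0) →
      algebraMap P2 K g + 1 ≠ 0 := fun g hg h =>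
    hne (g + 1) hg ((map_add (algebraMap P2 K) g 1).trans
      ((congrArg (algebraMap P2 K g + ·) (map_one (algebraMap P2 K))).trans h))
  have : CharP K 2 := charP_of_injective_algebraMap (algebraMap (ZMod 2) K).injective 2
  have two : (2 : K) = 0 := CharTwo.two_eq_zero
  let x : Fin 2 → K := fun i => algebraMap P2 K (X i)
  have hx : AlgebraicIndependent (ZMod 2) x :=
    (AlgHom.algebraicIndependent_iff (IsScalarTower.toAlgHom (ZMod 2) P2 K) hinj).2
      (MvPolynomial.algebraicIndependent_X (Fin 2) (ZMod 2))
  obtain ⟨a, v, b, z, q, t, ha, hv, hf⟩ := Char2.low_point (x 0) (x 1)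
    (hne (X 0) ⟨fun _ => 1, by simp⟩) (hne (X 1) ⟨fun _ => 1, by simp⟩)
    (hne' (X 0) ⟨fun _ => 0, by simp⟩)
    (hne' (X 1) ⟨fun _ => 0, by simp⟩)
    (fun h => hne' (X 1 * X 0) ⟨fun _ => 0, by simp⟩
      ((congrArg (· + 1) (map_mul (algebraMap P2 K) (X 1) (X 0))).trans h))
  obtain ⟨p, hp⟩ : ∃ p, p = a * (x 0 + 1) := ⟨_, rfl⟩
  obtain ⟨r, hr⟩ : ∃ r, r = v * (x 1 + 1) := ⟨_, rfl⟩
  rw [← hp, ← hr] at hf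
  let f : SuzukiRing →ₐ[ZMod 2] K := aeval ![a, b, a + p, b + q + a * r, v,
    z + a ^ 2 * v + a * b, v + r,
    t + z + b * p + a * (p * r + q) + (a + p) ^ 2 * (v + r) + (a + p) * (b + q + a * r)]
  have hfX : ∀ i, f (X i) = (![a, b, a + p, b + q + a * r, v,
    z + a ^ 2 * v + a * b, v + r,
    t + z + b * p + a * (p * r + q) + (a + p) ^ 2 * (v + r) + (a + p) * (b + q + a * r)] :
      Fin 8 → K) i := fun i => aeval_X _ i
  have hk : ∀ g ∈ IV, f g = 0 := by
    refine (rel_iff f.toRingHom a b v z p q r t ?_ ?_ ?_ ?_ ?_ ?_ ?_ ?_).2 hf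
    exacts [hfX 0, hfX 1, hfX 4, hfX 5, hfX 2, hfX 6, hfX 3, hfX 7]
  have h2 := two_le_dim f x hx ![a, v] (by
      intro i; fin_cases i
      · exact ha
      · exact hv)
    (by
      intro i; fin_cases i
      · exact ⟨X 0, hfX 0⟩
      · exact ⟨X 4, hfX 4⟩)
    (by
      intro i; fin_cases i
      · refine ⟨X 2, (hfX 2).trans ?_⟩
        change a + p = a * x 0
        linear_combination hp + a * two
      · refine ⟨X 6, (hfX 6).trans ?_⟩
        change v + r = v * x 1
        linear_combination hr + v * two)
  refine h2.trans ?_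
  refine ringKrullDim_le_of_surjective (Ideal.Quotient.lift IV f.rangeRestrict.toRingHom ?_) ?_
  · intro g hg
    exact Subtype.ext (hk g hg)
  · exact Ideal.Quotient.lift_surjective_of_surjective _ _ f.rangeRestrict_surjective

/-- The Krull dimension of `R/I_V` equals 2. -/
theorem krullDim_quotient_IV : ringKrullDim (SuzukiRing ⧸ IV) = 2 := by
  exact le_antisymm upper_dim lower_dim

end
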